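/- Let R be a reduced elliptic root system of rank l ≥ 2 with fundamental-set Π ∪ {a} and associated maps k, g, where the affine root system W_Π·Π is of type D_{l+1}^{(2)}, k(α₀) = 2, k(α₁) = 1, k(α_j) = 2 for 2 ≤ j ≤ l, and g(α) = ∅ for all α ∈ Π. Let 𝔤 = 𝔤(Π,k,g,ω₁) be the elliptic Lie algebra with trivial tuning and M := ℤδ ⊕ ℤa. Then dim 𝔤_σ = l+1 for every σ ∈ 2M ∖ {0}, and dim 𝔤_σ = 1 for every σ ∈ M ∖ 2M. -/

import Mathlib

/- ## Preliminaries: extended affine root systems (Saito) -/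

noncomputable section

open Set

/-- The reflection `s_v : z ↦ z - (v^∨, z) v = z - (2 (v,z)/(v,v)) v` associated to a
bilinear form `B` and a vector `v`.  (When `B v v = 0` this is the identity, by the
`division by zero = 0` convention; reflections are only ever used at non-isotropic `v`.) -/
def srefl {V : Type*} [AddCommGroup V] [Module ℝ V]
    (B : LinearMap.BilinForm ℝ V) (v : V) : Module.End ℝ V :=
  LinearMap.id - (((2 * (B v v)⁻¹) • (B v)).smulRight v)

/-- The Weyl group `W_S` generated by the reflections in the elements of `S`
(realized as the multiplicative closure; each generator is an involution, so this
agrees with the generated group). -/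
def weyl {V : Type*} [AddCommGroup V] [Module ℝ V]
    (B : LinearMap.BilinForm ℝ V) (S : Set V) : Submonoid (Module.End ℝ V) :=
  Submonoid.closure (srefl B '' S)

/-- The orbit `W_S · α`. -/
def worbit {V : Type*} [AddCommGroup V] [Module ℝ V]
    (B : LinearMap.BilinForm ℝ V) (S : Set V) (α : V) : Set V :=
  {v | ∃ w ∈ weyl B S, w α = v}

/-- `V⁰`, the set of isotropic vectors. -/
def nullSet {V : Type*} [AddCommGroup V] [Module ℝ V]
    (B : LinearMap.BilinForm ℝ V) : Set V := {v | B v v = 0}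

/-- `ℤR`, the subgroup of `V` generated by `R`. -/
def zspan {V : Type*} [AddCommGroup V] (R : Set V) : AddSubgroup V :=
  AddSubgroup.closure R

/-- `ℤ≥0 Π`, the set of nonnegative-integer linear combinations of elements of `Π`. -/
def nnspan {V : Type*} [AddCommMonoid V] (P : Set V) : Set V :=
  (AddSubmonoid.closure P : Set V)

/-- `(R, V)` is an `n`-extended affine root system of rank `l` (K. Saito). -/
structure IsEARS {V : Type*} [AddCommGroup V] [Module ℝ V]
    (B : LinearMap.BilinForm ℝ V) (R : Set V) (l n : ℕ) : Prop where
  rank_pos : 1 ≤ l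
  findim : FiniteDimensional ℝ V
  symm : ∀ u v, B u v = B v u
  posSemidef : ∀ v, 0 ≤ B v v
  dim_eq : Module.finrank ℝ V = l + n
  null_eq : nullSet B = (LinearMap.ker B : Set V)
  dim_null : Module.finrank ℝ (LinearMap.ker B) = n
  /-- (AX1), first half -/
  root_nonisotropic : ∀ α ∈ R, B α α ≠ 0
  /-- (AX1), second half -/
  span_eq_top : Submodule.span ℝ R = ⊤
  /-- (AX2) -/
  free : Module.Free ℤ (zspan R)
  /-- (AX2) -/
  rank_eq : Module.finrank ℤ (zspan R) = l + n
  /-- (AX3): `(α^∨, β) ∈ ℤ` -/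
  integral : ∀ α ∈ R, ∀ β ∈ R, ∃ m : ℤ, 2 * B α β = (m : ℝ) * B α α
  /-- (AX4) -/
  reflect : ∀ α ∈ R, srefl B α '' R = R
  /-- (AX5) -/
  connected : ∀ S' ⊆ R, S'.Nonempty → S' ≠ R → ∃ x ∈ S', ∃ y ∈ R \ S', B x y ≠ 0

/-- `R` is reduced, i.e. `R ∩ 2R = ∅`. -/
def IsReducedRS {V : Type*} [AddCommGroup V] [Module ℝ V] (R : Set V) : Prop :=
  ∀ α ∈ R, (2 : ℤ) • α ∉ R

/-- `Π₀` is a base (with `m` elements) of the root system `R₀`: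
`Π₀ ⊆ R₀`, `Π₀` consists of `m` linearly independent elements, and
`R₀ = (R₀ ∩ ℤ≥0 Π₀) ∪ (R₀ ∩ ℤ≤0 Π₀)`. -/
def IsBaseSet {M : Type*} [AddCommGroup M] [Module ℝ M] (R₀ P₀ : Set M) (m : ℕ) : Prop :=
  P₀ ⊆ R₀ ∧ P₀.Finite ∧ P₀.ncard = m ∧
  LinearIndependent ℝ ((↑) : P₀ → M) ∧
  R₀ = (R₀ ∩ nnspan P₀) ∪ (R₀ ∩ (-(nnspan P₀)))

/-- The bilinear form induced on a quotient `V ⧸ W` by a form vanishing on `W`. -/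
def quotForm {V : Type*} [AddCommGroup V] [Module ℝ V]
    (W : Submodule ℝ V) (B : LinearMap.BilinForm ℝ V)
    (h1 : ∀ w ∈ W, B w = 0) (h2 : ∀ v : V, ∀ w ∈ W, B v w = 0) :
    LinearMap.BilinForm ℝ (V ⧸ W) :=
  Submodule.liftQ W
    { toFun := fun v => Submodule.liftQ W (B v) (fun w hw => LinearMap.mem_ker.mpr (h2 v w hw))
      map_add' := fun u v => by
        ext x
        simp
      map_smul' := fun c v => by
        ext x
        simp }
    (fun w hw => by
      simp only [LinearMap.mem_ker]
      ext x
      simp [h1 w hw])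

end

/-- A fundamental-set `Π ∪ {a}` of a reduced elliptic root system `R` of rank `l`:
(FS1) `a ∈ (ℤR)⁰` and `(ℤR)⁰ = ℤa ⊕ ℤb` for some `b`;
(FS2) `|Π| = l+1`, `Π ⊆ R` and `π_a(Π)` is a base of the affine root system `π_a(R)`. -/
def IsFundamentalSet {V : Type*} [AddCommGroup V] [Module ℝ V]
    (B : LinearMap.BilinForm ℝ V) (R : Set V) (l : ℕ) (P : Set V) (a : V) : Prop :=
  a ∈ zspan R ∧ B a a = 0 ∧
  (∃ b : V, b ∈ zspan R ∧ B b b = 0 ∧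
    ((zspan R : Set V) ∩ nullSet B = {v | ∃ m n : ℤ, v = m • a + n • b}) ∧
    (∀ m n : ℤ, m • a + n • b = 0 → m = 0 ∧ n = 0)) ∧
  P ⊆ R ∧ P.Finite ∧ P.ncard = l + 1 ∧
  IsBaseSet ((Submodule.span ℝ {a}).mkQ '' R) ((Submodule.span ℝ {a}).mkQ '' P) (l + 1)

/-- The subset `⋃_{ε=±1} ((εα + ℤ kα a) ∪ (2εα + gα·kα a))` of the plane `ℝα ⊕ ℝa`;
here `gα : Bool`, with `false` encoding `g(α) = ∅` and `true` encoding `g(α) = 2ℤ+1`. -/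
def kgLine {V : Type*} [AddCommGroup V] (a α : V) (kα : ℕ) (gα : Bool) : Set V :=
  {v | ∃ ε m : ℤ, (ε = 1 ∨ ε = -1) ∧ v = ε • α + (m * kα) • a} ∪
  {v | gα = true ∧ ∃ ε m : ℤ, (ε = 1 ∨ ε = -1) ∧ Odd m ∧ v = (2 * ε) • α + (m * kα) • a}

/-- `k : Π → ℕ` and `g : Π → {∅, 2ℤ+1}` are the maps associated to the fundamental-set
`Π ∪ {a}`, i.e. `R ∩ (ℝα ⊕ ℝa) = ⋃_{ε=±1} ((εα + ℤ k(α) a) ∪ (2εα + g(α)k(α)a))`. -/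
def IsKG {V : Type*} [AddCommGroup V] [Module ℝ V]
    (R : Set V) (a : V) (P : Set V) (k : V → ℕ) (g : V → Bool) : Prop :=
  ∀ α ∈ P, 0 < k α ∧
    R ∩ (Submodule.span ℝ {α, a} : Set V) = kgLine a α (k α) (g α)

/-- `c(α) = 1` if `g(α) = ∅`, `c(α) = 2` if `g(α) = 2ℤ+1`. -/
def cMap {V : Type*} (g : V → Bool) (α : V) : ℕ := if g α then 2 else 1

/-- `α* := c(α)·α + k(α)·a`. -/
def starMap {V : Type*} [AddCommGroup V] (a : V) (k : V → ℕ) (g : V → Bool) (α : V) : V :=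
  (cMap g α : ℤ) • α + (k α : ℤ) • a

/-- `B₊ := {α, α* | α ∈ Π}`. -/
def bplus {V : Type*} [AddCommGroup V] (a : V) (P : Set V) (k : V → ℕ) (g : V → Bool) :
    Set V :=
  P ∪ (starMap a k g '' P)

/-- `B := B₊ ∪ (−B₊)`. -/
def bfull {V : Type*} [AddCommGroup V] (a : V) (P : Set V) (k : V → ℕ) (g : V → Bool) :
    Set V :=
  bplus a P k g ∪ (-(bplus a P k g))

/-- The set `R(Π,k,g) = ⋃_{w ∈ W_Π} ⋃_{α ∈ Π} ((w(α) + ℤk(α)a) ∪ (w(2α) + g(α)k(α)a))`. -/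
def kgUnion {V : Type*} [AddCommGroup V] [Module ℝ V]
    (B : LinearMap.BilinForm ℝ V) (P : Set V) (a : V) (k : V → ℕ) (g : V → Bool) :
    Set V :=
  {v | ∃ w ∈ weyl B P, ∃ α ∈ P,
    (∃ m : ℤ, v = w α + (m * k α) • a) ∨
    (g α = true ∧ ∃ m : ℤ, Odd m ∧ v = w ((2 : ℤ) • α) + (m * k α) • a)}

noncomputable section

/-- `ω : 𝒜 → ℂ^×` is a tuning: it is nonzero on
`𝒜 = {(α,β) : (α,β^∨) = -1}` and `ω(α,β)ω(β,α) = 1` whenever also `(α^∨,β) = -1`. -/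
def IsTuning {V : Type*} [AddCommGroup V] [Module ℝ V]
    (B : LinearMap.BilinForm ℝ V) (P : Set V) (ω : V → V → ℂ) : Prop :=
  ∀ α ∈ P, ∀ β ∈ P,
    (2 * B α β = -(B β β) → ω α β ≠ 0) ∧
    (2 * B α β = -(B β β) → 2 * B α β = -(B α α) → ω α β * ω β α = 1)

/-- `δ = δ(Π)`: a positive-integer combination of the elements of `Π` with
`ℤδ = (ℤΠ)⁰`. -/
def IsDelta {V : Type*} [AddCommGroup V] [Module ℝ V]
    (B : LinearMap.BilinForm ℝ V) (P : Set V) (δ : V) : Prop :=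
  (∃ s : Finset V, (s : Set V) = P ∧
    ∃ c : V → ℕ, (∀ α ∈ s, 0 < c α) ∧ δ = ∑ α ∈ s, (c α : ℤ) • α) ∧
  (AddSubgroup.closure {δ} : Set V) = (AddSubgroup.closure P : Set V) ∩ nullSet B

end

/-- The affine root system `W_Π·Π` is of type `D_{l+1}^{(2)}`, realized (after rescaling
the form) by an enumeration `αf : Fin (l+1) → V` of `Π = {α₀, α₁, …, α_l}` with the
prescribed Gram matrix: `(α₀,α₀) = (α₁,α₁) = 1`, `(α_j,α_j) = 2` for `2 ≤ j ≤ l`,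
`(α₁,α₂) = −1`, `(α_j,α_{j+1}) = −1` for `2 ≤ j ≤ l−1`, `(α_l,α₀) = −1`, and all other
off-diagonal entries `0`. -/
def IsTypeDTwo {V : Type*} [AddCommGroup V] [Module ℝ V]
    (B : LinearMap.BilinForm ℝ V) (P : Set V) (l : ℕ) (αf : Fin (l + 1) → V) : Prop :=
  Function.Injective αf ∧ Set.range αf = P ∧
  B (αf 0) (αf 0) = 1 ∧ B (αf 1) (αf 1) = 1 ∧
  (∀ j : Fin (l + 1), 2 ≤ (j : ℕ) → B (αf j) (αf j) = 2) ∧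
  B (αf 1) (αf 2) = -1 ∧
  (∀ j : ℕ, ∀ _h2 : 2 ≤ j, ∀ _h3 : j + 1 ≤ l,
    B (αf ⟨j, by omega⟩) (αf ⟨j + 1, by omega⟩) = -1) ∧
  B (αf (Fin.last l)) (αf 0) = -1 ∧
  (∀ i j : Fin (l + 1), i ≠ j →
    ¬(({(i : ℕ), (j : ℕ)} : Finset ℕ) = {1, 2} ∨
      (∃ m : ℕ, 2 ≤ m ∧ m + 1 ≤ l ∧ ({(i : ℕ), (j : ℕ)} : Finset ℕ) = {m, m + 1}) ∨
      ({(i : ℕ), (j : ℕ)} : Finset ℕ) = {l, 0}) →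
    B (αf i) (αf j) = 0)

noncomputable section

/- ## The elliptic Lie algebra `𝔤(Π, k, g, ω)` presented by (SR1)–(SR9) -/

open TensorProduct

/-- The complexification `V^ℂ = ℂ ⊗_ℝ V`. -/
abbrev Vc (V : Type*) [AddCommGroup V] [Module ℝ V] : Type _ := ℂ ⊗[ℝ] V

/-- `v^∨ := 2v/(v,v)`. -/
def vee {V : Type*} [AddCommGroup V] [Module ℝ V]
    (B : LinearMap.BilinForm ℝ V) (v : V) : V := (2 / B v v) • v

/-- The exponent `x_{μ,ν} = 1 - ((μ^∨,ν) - |(μ^∨,ν)|)/2` (a positive integer since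
`(μ^∨,ν) ∈ ℤ`). -/
def xExp {V : Type*} [AddCommGroup V] [Module ℝ V]
    (B : LinearMap.BilinForm ℝ V) (μ ν : V) : ℕ :=
  1 + ⌈-(2 * B μ ν / B μ μ)⌉₊

/-- The type of generators of the presented elliptic Lie algebra:
`h_σ` for `σ ∈ V^ℂ` and `E_μ` for `μ ∈ B = B₊ ∪ (−B₊)`. -/
def EllGen {V : Type*} [AddCommGroup V] [Module ℝ V]
    (a : V) (P : Set V) (k : V → ℕ) (g : V → Bool) : Type _ :=
  Vc V ⊕ ↥(bfull a P k g)

/-- The generator `h_σ` inside the free Lie algebra. -/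
def hFree {V : Type*} [AddCommGroup V] [Module ℝ V]
    (a : V) (P : Set V) (k : V → ℕ) (g : V → Bool) (σ : Vc V) :
    FreeLieAlgebra ℂ (EllGen a P k g) :=
  FreeLieAlgebra.of ℂ (Sum.inl σ)

open scoped Classical in
/-- The generator `E_μ` inside the free Lie algebra (`0` if `μ ∉ B`; the relations only
ever use it at points of `B`). -/
def eFree {V : Type*} [AddCommGroup V] [Module ℝ V]
    (a : V) (P : Set V) (k : V → ℕ) (g : V → Bool) (μ : V) :
    FreeLieAlgebra ℂ (EllGen a P k g) :=
  if h : μ ∈ bfull a P k g then FreeLieAlgebra.of ℂ (Sum.inr ⟨μ, h⟩) else 0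

/-- The relations (SR1)–(SR9) of Definition 5.2, as elements of the free Lie algebra. -/
def ellRels {V : Type*} [AddCommGroup V] [Module ℝ V]
    (B : LinearMap.BilinForm ℝ V) (a : V) (P : Set V) (k : V → ℕ) (g : V → Bool)
    (ω : V → V → ℂ) : Set (FreeLieAlgebra ℂ (EllGen a P k g)) :=
  -- (SR1)
  {z | ∃ (x y : ℂ) (σ τ : Vc V),
    z = x • hFree a P k g σ + y • hFree a P k g τ - hFree a P k g (x • σ + y • τ)} ∪
  -- (SR2)
  {z | ∃ σ τ : Vc V, z = ⁅hFree a P k g σ, hFree a P k g τ⁆} ∪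
  -- (SR3)
  {z | ∃ σ : Vc V, ∃ μ ∈ bfull a P k g,
    z = ⁅hFree a P k g σ, eFree a P k g μ⁆
      - (LinearMap.BilinForm.baseChange ℂ B σ ((1 : ℂ) ⊗ₜ[ℝ] μ)) • eFree a P k g μ} ∪
  -- (SR4)
  {z | ∃ μ ∈ bplus a P k g,
    z = ⁅eFree a P k g μ, eFree a P k g (-μ)⁆
      - hFree a P k g ((1 : ℂ) ⊗ₜ[ℝ] vee B μ)} ∪
  -- (SR5)
  {z | ∃ μ ∈ bfull a P k g, ∃ ν ∈ bfull a P k g, μ ≠ ν ∧ ν ≠ -μ ∧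
    z = ((LieAlgebra.ad ℂ _ (eFree a P k g μ)) ^ xExp B μ ν) (eFree a P k g ν)} ∪
  -- (SR6)
  {z | ∃ α ∈ P, ∃ β ∈ P, 2 * B α β = -(B β β) ∧
    z = (cMap g α : ℂ) •
          ((LieAlgebra.ad ℂ _ (eFree a P k g (starMap a k g α))) ^ (k β / k α))
            (eFree a P k g β)
      - ω α β •
          ((LieAlgebra.ad ℂ _ (eFree a P k g α)) ^ (cMap g α * (k β / k α)))
            (eFree a P k g (starMap a k g β))} ∪
  -- (SR7)
  {z | ∃ α ∈ P, ∃ β ∈ P, 2 * B α β = -(B β β) ∧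
    z = ((-1 : ℂ) ^ (cMap g α + 1) * (cMap g α : ℂ)) •
          ((LieAlgebra.ad ℂ _ (eFree a P k g (-(starMap a k g α)))) ^ (k β / k α))
            (eFree a P k g (-β))
      - (ω α β)⁻¹ •
          ((LieAlgebra.ad ℂ _ (eFree a P k g (-α))) ^ (cMap g α * (k β / k α)))
            (eFree a P k g (-(starMap a k g β)))} ∪
  -- (SR8)
  {z | ∃ α ∈ P, ∃ β ∈ P, 2 * B α β = -(B β β) ∧ ∃ i : ℕ, 1 ≤ i ∧ i ≤ k β / k α - 1 ∧
    z = ((LieAlgebra.ad ℂ _ (eFree a P k g α)) ^ i)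
          (((LieAlgebra.ad ℂ _ (eFree a P k g (starMap a k g α))) ^ (k β / k α - i))
            (eFree a P k g β))} ∪
  -- (SR9)
  {z | ∃ α ∈ P, ∃ β ∈ P, 2 * B α β = -(B β β) ∧ ∃ i : ℕ, 1 ≤ i ∧ i ≤ k β / k α - 1 ∧
    z = ((LieAlgebra.ad ℂ _ (eFree a P k g (-α))) ^ i)
          (((LieAlgebra.ad ℂ _ (eFree a P k g (-(starMap a k g α)))) ^ (k β / k α - i))
            (eFree a P k g (-β)))}

/-- The Lie ideal generated by the relations (SR1)–(SR9). -/
def ellIdeal {V : Type*} [AddCommGroup V] [Module ℝ V]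
    (B : LinearMap.BilinForm ℝ V) (a : V) (P : Set V) (k : V → ℕ) (g : V → Bool)
    (ω : V → V → ℂ) : LieIdeal ℂ (FreeLieAlgebra ℂ (EllGen a P k g)) :=
  LieSubmodule.lieSpan ℂ _ (ellRels B a P k g ω)

/-- The elliptic Lie algebra `𝔤(Π,k,g,ω)`, presented by generators and the relations
(SR1)–(SR9). -/
abbrev EllipticLieAlg {V : Type*} [AddCommGroup V] [Module ℝ V]
    (B : LinearMap.BilinForm ℝ V) (a : V) (P : Set V) (k : V → ℕ) (g : V → Bool)
    (ω : V → V → ℂ) : Type _ :=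
  FreeLieAlgebra ℂ (EllGen a P k g) ⧸ ellIdeal B a P k g ω

/-- The element `h_σ` of the elliptic Lie algebra. -/
def hbar {V : Type*} [AddCommGroup V] [Module ℝ V]
    (B : LinearMap.BilinForm ℝ V) (a : V) (P : Set V) (k : V → ℕ) (g : V → Bool)
    (ω : V → V → ℂ) (σ : Vc V) : EllipticLieAlg B a P k g ω :=
  LieSubmodule.Quotient.mk (N := ellIdeal B a P k g ω) (hFree a P k g σ)

/-- The element `E_μ` of the elliptic Lie algebra. -/
def ebar {V : Type*} [AddCommGroup V] [Module ℝ V]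
    (B : LinearMap.BilinForm ℝ V) (a : V) (P : Set V) (k : V → ℕ) (g : V → Bool)
    (ω : V → V → ℂ) (μ : V) : EllipticLieAlg B a P k g ω :=
  LieSubmodule.Quotient.mk (N := ellIdeal B a P k g ω) (eFree a P k g μ)

open scoped Classical in
/-- `gr` is the `ℤR`-grading `𝔤 = ⊕_{σ ∈ ℤR} 𝔤_σ` of the elliptic Lie algebra
(indexed by `V`, supported on `ℤR`), with `E_μ ∈ 𝔤_μ` and `h_σ ∈ 𝔤_0`. -/
def IsEllGrading {V : Type*} [AddCommGroup V] [Module ℝ V]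
    (B : LinearMap.BilinForm ℝ V) (R : Set V) (a : V) (P : Set V) (k : V → ℕ)
    (g : V → Bool) (ω : V → V → ℂ)
    (gr : V → Submodule ℂ (EllipticLieAlg B a P k g ω)) : Prop :=
  DirectSum.IsInternal gr ∧
  (∀ σ τ : V, ∀ x ∈ gr σ, ∀ y ∈ gr τ, ⁅x, y⁆ ∈ gr (σ + τ)) ∧
  (∀ σ : V, gr σ ≠ ⊥ → σ ∈ zspan R) ∧
  (∀ σ : Vc V, hbar B a P k g ω σ ∈ gr 0) ∧
  (∀ μ ∈ bfull a P k g, ebar B a P k g ω μ ∈ gr μ)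

end

namespace Ell
set_option linter.unusedSectionVars false

section RankOne
variable {G : Type*} [LieRing G] [LieAlgebra ℂ G]

structure Quad (e E f F h c : G) : Prop where
  ef : ⁅e, f⁆ = h
  EF : ⁅E, F⁆ = h + c
  cz : ∀ x : G, ⁅c, x⁆ = 0
  he : ⁅h, e⁆ = (2:ℂ) • e
  hE : ⁅h, E⁆ = (2:ℂ) • E
  hf : ⁅h, f⁆ = (-2:ℂ) • f
  hF : ⁅h, F⁆ = (-2:ℂ) • F
  eE : ⁅e, E⁆ = 0
  fF : ⁅f, F⁆ = 0
  eeeF : ⁅e, ⁅e, ⁅e, F⁆⁆⁆ = 0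
  fffE : ⁅f, ⁅f, ⁅f, E⁆⁆⁆ = 0
  EEEf : ⁅E, ⁅E, ⁅E, f⁆⁆⁆ = 0
  FFFe : ⁅F, ⁅F, ⁅F, e⁆⁆⁆ = 0

theorem sk0 {x y : G} (h : ⁅x, y⁆ = 0) : ⁅y, x⁆ = 0 := by rw [← lie_skew, h, neg_zero]

theorem Quad.swap {e E f F h c : G} (q : Quad e E f F h c) : Quad E e F f (h + c) (-c) where
  ef := q.EF
  EF := by rw [q.ef]; abel
  cz x := by rw [neg_lie, q.cz, neg_zero]
  he := by rw [add_lie, q.cz, q.hE, add_zero]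
  hE := by rw [add_lie, q.cz, q.he, add_zero]
  hf := by rw [add_lie, q.cz, q.hF, add_zero]
  hF := by rw [add_lie, q.cz, q.hf, add_zero]
  eE := sk0 q.eE
  fF := sk0 q.fF
  eeeF := q.EEEf
  fffE := q.FFFe
  EEEf := q.eeeF
  FFFe := q.fffE

theorem Quad.inv {e E f F h c : G} (q : Quad e E f F h c) : Quad f F e E (-h) (-c) where
  ef := by rw [← lie_skew, q.ef]
  EF := by rw [← lie_skew, q.EF]; abel
  cz x := by rw [neg_lie, q.cz, neg_zero]
  he := by rw [neg_lie, q.hf]; module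
  hE := by rw [neg_lie, q.hF]; module
  hf := by rw [neg_lie, q.he]; module
  hF := by rw [neg_lie, q.hE]; module
  eE := q.fF
  fF := q.eE
  eeeF := q.fffE
  fffE := q.eeeF
  EEEf := q.FFFe
  FFFe := q.EEEf

/-- families generated by the two rank one Heisenberg operators -/
structure Fam (e E f F h c : G) (es fs : ℤ → G) : Prop where
  q : Quad e E f F h c
  e0 : es 0 = e
  e1 : es 1 = E
  f0 : fs 0 = f
  f1 : fs (-1) = F
  ue : ∀ n, ⁅⁅E, f⁆, es n⁆ = (2:ℂ) • es (n + 1)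
  de : ∀ n, ⁅⁅e, F⁆, es n⁆ = (2:ℂ) • es (n - 1)
  uf : ∀ n, ⁅⁅E, f⁆, fs n⁆ = (-2:ℂ) • fs (n + 1)
  df : ∀ n, ⁅⁅e, F⁆, fs n⁆ = (-2:ℂ) • fs (n - 1)

theorem zfam {M : Type*} [AddCommGroup M] [Module ℂ M] (T S : Module.End ℂ M)
    (h : ∀ x, T (S x) = S (T x)) (x : M) (hx : T (S x) = x) :
    ∃ X : ℤ → M, X 0 = x ∧ (∀ n, T (X n) = X (n + 1)) ∧ (∀ n, S (X n) = X (n - 1)) := by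
  have h1 : ∀ (n : ℕ) , T (S ((S ^ n) x)) = (S ^ n) x := by
    intro n
    induction n with
    | zero => simpa using hx
    | succ n ih => rw [pow_succ', Module.End.mul_apply, h, ih]
  have h2 : ∀ (n : ℕ) , S (T ((T ^ n) x)) = (T ^ n) x := by
    intro n
    induction n with
    | zero => rw [← h]; simpa using hx
    | succ n ih => rw [pow_succ', Module.End.mul_apply, ← h, ih]
  refine ⟨fun n => match n with
    | Int.ofNat n => (T ^ n) x
    | Int.negSucc n => (S ^ (n + 1)) x, by simp, ?_, ?_⟩
  · rintro (n | n)
    · have : (Int.ofNat n + 1) = Int.ofNat (n + 1) := rfl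
      rw [this]; simp only; rw [pow_succ', Module.End.mul_apply]
    · cases n with
      | zero => simpa using hx
      | succ n =>
        have : (Int.negSucc (n + 1) + 1) = Int.negSucc n := by omega
        rw [this]; simp only
        rw [pow_succ', Module.End.mul_apply, h1]
  · rintro (n | n)
    · cases n with
      | zero =>
        have : (Int.ofNat 0 - 1) = Int.negSucc 0 := rfl
        rw [this]; simp
      | succ n =>
        have : (Int.ofNat (n + 1) - 1) = Int.ofNat n := by simp
        rw [this]; simp only
        rw [pow_succ', Module.End.mul_apply, h2]
    · have : (Int.negSucc n - 1) = Int.negSucc (n + 1) := by omega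
      rw [this]; simp only; rw [pow_succ' _ (n + 1), Module.End.mul_apply]

namespace Quad
variable {e E f F h c : G} (q : Quad e E f F h c)
include q
theorem ue : ⁅⁅E, f⁆, e⁆ = (2:ℂ) • E := by
  rw [lie_lie, ← lie_skew f e, q.ef, sk0 q.eE, lie_zero, lie_neg, lie_skew, q.hE, sub_zero]
theorem uF : ⁅⁅E, f⁆, F⁆ = (-2:ℂ) • f := by
  rw [lie_lie, q.fF, q.EF, lie_zero, zero_sub, lie_skew, add_lie, q.cz, add_zero, q.hf]
theorem ud : ⁅⁅E, f⁆, ⁅e, F⁆⁆ = (2:ℂ) • c := by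
  rw [leibniz_lie, q.ue, q.uF, smul_lie, lie_smul, q.EF, q.ef]; module
end Quad

theorem Quad.fam {e E f F h c : G} (q : Quad e E f F h c) : ∃ es fs, Fam e E f F h c es fs := by
  have q' := q.swap
  set u := ⁅E, f⁆ with hu
  set d := ⁅e, F⁆ with hd
  have hc : ∀ x : G, ⁅u, ⁅d, x⁆⁆ = ⁅d, ⁅u, x⁆⁆ := by
    intro x
    rw [leibniz_lie, q.ud, smul_lie, q.cz, smul_zero, zero_add]
  obtain ⟨es, e0, e1, e2⟩ := zfam ((1/2:ℂ) • LieAlgebra.ad ℂ G u) ((1/2:ℂ) • LieAlgebra.ad ℂ G d)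
    (by intro x; simp [hc]) e (by
      simp only [LinearMap.smul_apply, LieAlgebra.ad_apply, lie_smul]
      rw [hc, q.ue, lie_smul, q'.ue]; module)
  obtain ⟨fs, f0, f1, f2⟩ := zfam ((-1/2:ℂ) • LieAlgebra.ad ℂ G u) ((-1/2:ℂ) • LieAlgebra.ad ℂ G d)
    (by intro x; simp [hc]) f (by
      simp only [LinearMap.smul_apply, LieAlgebra.ad_apply, lie_smul]
      rw [q'.uF, lie_smul, q.uF]; module)
  simp only [LinearMap.smul_apply, LieAlgebra.ad_apply] at e1 e2 f1 f2
  refine ⟨es, fs, q, e0, ?_, f0, ?_, ?_, ?_, ?_, ?_⟩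
  · rw [← zero_add 1, ← e1, e0, q.ue]; module
  · rw [← zero_sub 1, ← f2, f0, q'.uF]; module
  · intro n; rw [← e1]; module
  · intro n; rw [← e2]; module
  · intro n; rw [← f1]; module
  · intro n; rw [← f2]; module

theorem Fam.swap {e E f F h c : G} {es fs : ℤ → G} (q : Fam e E f F h c es fs) :
    Fam E e F f (h + c) (-c) (fun n => es (1 - n)) (fun n => fs (-1 - n)) where
  q := q.q.swap
  e0 := by simp [q.e1]
  e1 := by simp [q.e0]
  f0 := by simp [q.f1]
  f1 := by simp [q.f0]
  ue n := by rw [q.de]; congr 2; ring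
  de n := by rw [q.ue]; congr 2; ring
  uf n := by rw [q.df]; congr 2; ring
  df n := by rw [q.uf]; congr 2; ring

theorem Fam.inv {e E f F h c : G} {es fs : ℤ → G} (q : Fam e E f F h c es fs) :
    Fam f F e E (-h) (-c) (fun n => fs (- n)) (fun n => es (- n)) where
  q := q.q.inv
  e0 := by simp [q.f0]
  e1 := by simp [q.f1]
  f0 := by simp [q.e0]
  f1 := by simp [q.e1]
  ue n := by
    rw [← lie_skew F e, neg_lie, q.df, ← neg_smul, neg_neg]; congr 2; ring
  de n := by
    rw [← lie_skew f E, neg_lie, q.uf, ← neg_smul, neg_neg]; congr 2; ring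
  uf n := by
    rw [← lie_skew F e, neg_lie, q.de, ← neg_smul]; congr 2; ring
  df n := by
    rw [← lie_skew f E, neg_lie, q.ue, ← neg_smul]; congr 2; ring

namespace Fam
variable {e E f F h c : G} {es fs : ℤ → G} (q : Fam e E f F h c es fs)
include q

theorem up (i j : ℤ) : ⁅⁅E, f⁆, ⁅es i, fs j⁆⁆ =
    (2:ℂ) • (⁅es (i+1), fs j⁆ - ⁅es i, fs (j+1)⁆) := by
  rw [leibniz_lie, q.ue, q.uf, smul_lie, lie_smul]; module

theorem dp (i j : ℤ) : ⁅⁅e, F⁆, ⁅es i, fs j⁆⁆ =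
    (2:ℂ) • (⁅es (i-1), fs j⁆ - ⁅es i, fs (j-1)⁆) := by
  rw [leibniz_lie, q.de, q.df, smul_lie, lie_smul]; module

theorem uh : ⁅⁅E, f⁆, h⁆ = 0 := by
  rw [lie_lie, ← lie_skew f h, ← lie_skew E h, q.q.hf, q.q.hE, lie_neg, lie_neg, lie_smul, lie_smul,
    ← lie_skew f E]
  module

theorem y12 : ⁅es 1, es 2⁆ = 0 := by
  have h1 := q.ue 1
  have h2 := q.q.EEEf
  have h3 : ⁅E, ⁅E, f⁆⁆ = (-2:ℂ) • es 2 := by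
    rw [q.e1] at h1
    rw [← lie_skew, h1]; norm_num
  rw [h3, lie_smul, ← q.e1] at h2
  simpa using h2

theorem z01 : ⁅fs 0, fs 1⁆ = 0 := by
  have h3 := q.q.fffE
  have h4 := q.uf 0
  have : ⁅f, ⁅f, E⁆⁆ = (-2:ℂ) • fs 1 := by
    rw [q.f0] at h4
    rw [← lie_skew f E, lie_neg, lie_skew, h4]; simp
  rw [this, lie_smul, ← q.f0] at h3
  simpa using h3

theorem comm_fam (H : G) (r : ℤ) (a0 : ⁅H, e⁆ = (2:ℂ) • es r) (b0 : ⁅H, f⁆ = (-2:ℂ) • fs r)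
    (hu : ∀ x : G, ⁅⁅⁅E, f⁆, H⁆, x⁆ = 0) (hd : ∀ x : G, ⁅⁅⁅e, F⁆, H⁆, x⁆ = 0) :
    (∀ j, ⁅H, es j⁆ = (2:ℂ) • es (r + j)) ∧ (∀ j, ⁅H, fs j⁆ = (-2:ℂ) • fs (r + j)) := by
  have cu : ∀ x : G, ⁅H, ⁅⁅E, f⁆, x⁆⁆ = ⁅⁅E, f⁆, ⁅H, x⁆⁆ := by
    intro x; rw [leibniz_lie ⁅E, f⁆ H x, hu, zero_add]
  have cd : ∀ x : G, ⁅H, ⁅⁅e, F⁆, x⁆⁆ = ⁅⁅e, F⁆, ⁅H, x⁆⁆ := by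
    intro x; rw [leibniz_lie ⁅e, F⁆ H x, hd, zero_add]
  constructor
  · intro j
    induction j using Int.induction_on with
    | zero => rw [q.e0, a0, add_zero]
    | succ n ih =>
      have := cu (es n)
      rw [q.ue, ih, lie_smul, lie_smul, q.ue] at this
      rw [← add_assoc]
      exact smul_right_injective _ (two_ne_zero (α := ℂ)) this
    | pred n ih =>
      have := cd (es (-n))
      rw [q.de, ih, lie_smul, lie_smul, q.de] at this
      rw [← add_sub_assoc]
      exact smul_right_injective _ (two_ne_zero (α := ℂ)) this
  · intro j
    induction j using Int.induction_on with
    | zero => rw [q.f0, b0, add_zero]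
    | succ n ih =>
      have := cu (fs n)
      rw [q.uf, ih, lie_smul, lie_smul, q.uf] at this
      rw [← add_assoc]
      exact smul_right_injective _ (neg_ne_zero.2 (two_ne_zero (α := ℂ))) this
    | pred n ih =>
      have := cd (fs (-n))
      rw [q.df, ih, lie_smul, lie_smul, q.df] at this
      rw [← add_sub_assoc]
      exact smul_right_injective _ (neg_ne_zero.2 (two_ne_zero (α := ℂ))) this

theorem hpos (r : ℕ) : ∃ H : G,
    (∀ j, ⁅H, es j⁆ = (2:ℂ) • es (r + 1 + j)) ∧ (∀ j, ⁅H, fs j⁆ = (-2:ℂ) • fs (r + 1 + j)) ∧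
    ⁅⁅E, f⁆, H⁆ = 0 ∧ (∀ i : ℕ, i ≤ r + 1 → ⁅es i, fs (r + 1 - i)⁆ = H) ∧
    (1 ≤ r → ⁅⁅e, F⁆, H⁆ = 0) := by
  induction r with
  | zero =>
    have h01 : ⁅es 0, fs 1⁆ = ⁅E, f⁆ := by
      have := q.up 0 0
      rw [q.e0, q.f0, q.q.ef, q.uh, zero_add, q.e1] at this
      have h := smul_eq_zero.1 this.symm
      rcases h with h | h
      · norm_num at h
      · rw [q.e0]; exact (sub_eq_zero.1 h).symm
    refine ⟨⁅E, f⁆, ?_, ?_, lie_self _, ?_, by simp⟩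
    · intro j; rw [q.ue]; congr 2; push_cast; ring
    · intro j; rw [q.uf]; congr 2; push_cast; ring
    · intro i hi
      obtain rfl | rfl : i = 0 ∨ i = 1 := by omega
      · simpa using h01
      · simp [q.e1, q.f0]
  | succ r ih =>
    obtain ⟨H, he, hf, hu, hp, -⟩ := ih
    have z2 : ∀ {x : G}, (2:ℂ) • x = 0 → x = 0 := fun h => by simpa using h
    -- the next level
    have hp2 : ∀ i : ℕ, i ≤ r + 1 → ⁅es (i + 1 : ℕ), fs (r + 1 - i)⁆ = ⁅es i, fs (r + 2 - i)⁆ := by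
      intro i hi
      have := q.up i (r + 1 - i)
      rw [hp i hi, hu] at this
      have := sub_eq_zero.1 (z2 this.symm)
      push_cast
      rw [this]; congr 2; ring
    have hp3 : ∀ i : ℕ, i ≤ r + 2 → ⁅es i, fs (r + 2 - i)⁆ = ⁅es 0, fs (r + 2)⁆ := by
      intro i
      induction i with
      | zero => simp
      | succ i ih =>
        intro hi
        rw [← ih (by omega), ← hp2 i (by omega)]; congr 2; push_cast; ring
    obtain ⟨K, hK⟩ : ∃ K, K = ⁅es 0, fs (r + 2)⁆ := ⟨_, rfl⟩
    rw [← hK] at hp3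
    have k1 : ⁅es 1, fs (r + 1)⁆ = K := by
      rw [← hp3 1 (by omega)]; congr 2; push_cast; ring
    have k2 : ⁅es 2, fs r⁆ = K := by
      rw [← hp3 2 (by omega)]; congr 2; push_cast; ring
    have kr : ⁅es (r + 1), fs 1⁆ = K := by
      rw [← hp3 (r + 1) (by omega)]; congr 2; push_cast; ring
    have K0 : ⁅K, es 0⁆ = (2:ℂ) • es (r + 2) := by
      have a1 : ⁅es 0, fs (r + 1)⁆ = H := by simpa using hp 0 (by omega)
      have a2 : ⁅es 1, es 0⁆ = 0 := by rw [q.e1, q.e0, sk0 q.q.eE]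
      rw [← k1, lie_lie, a2, lie_zero, sub_zero, ← lie_skew (fs _), a1, lie_neg, lie_skew, he]
      congr 2
    have K1 : ⁅K, es 1⁆ = (2:ℂ) • es (r + 3) := by
      have a1 : ⁅es 1, fs r⁆ = H := by
        rw [← hp 1 (by omega)]; congr 2; push_cast; ring
      rw [← k2, lie_lie, sk0 q.y12, lie_zero, sub_zero, ← lie_skew (fs _), a1, lie_neg, lie_skew, he]
      congr 2
    have Kf : ⁅K, fs 0⁆ = (-2:ℂ) • fs (r + 2) := by
      have a1 : ⁅es (r + 1), fs 0⁆ = H := by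
        rw [← hp (r + 1) (by omega)]; congr 2; push_cast; ring
      rw [← kr, lie_lie, sk0 q.z01, lie_zero, zero_sub, a1, lie_skew, hf]
      congr 2
    have Ku : ⁅⁅E, f⁆, K⁆ = 0 := by
      have D : ∀ i : ℕ, i ≤ r + 2 → ⁅⁅E, f⁆, K⁆ =
          (2:ℂ) • (⁅es (i + 1 : ℕ), fs (r + 2 - i)⁆ - ⁅es i, fs (r + 3 - i)⁆) := by
        intro i hi
        rw [← hp3 i hi, q.up]; congr 4
        · ring
      have D2 : ∀ i : ℕ, i ≤ r + 2 → (2:ℂ) • ⁅es (i + 1 : ℕ), fs (r + 2 - i)⁆ =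
          (2:ℂ) • ⁅es 1, fs (r + 2)⁆ + (i : ℂ) • ⁅⁅E, f⁆, K⁆ := by
        intro i
        induction i with
        | zero => intro _; simp
        | succ i ih =>
          intro hi
          have h1 := ih (by omega)
          have h2 := D (i + 1) hi
          rw [show (r + 3 - ((i + 1 : ℕ) : ℤ) : ℤ) = r + 2 - i by push_cast; ring, smul_sub, h1] at h2
          push_cast at h2 ⊢
          rw [sub_eq_iff_eq_add.1 h2.symm]; module
      have h1 := D2 (r + 2) le_rfl
      have h2 := D2 0 (by omega)
      have h3 : ⁅K, ⁅E, f⁆⁆ = (2:ℂ) • ⁅es (r + 3), fs 0⁆ - (2:ℂ) • ⁅es 1, fs (r + 2)⁆ := by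
        rw [leibniz_lie, ← q.e1, K1, ← q.f0, Kf, smul_lie, lie_smul]; module
      rw [show (((r + 2) + 1 : ℕ) : ℤ) = r + 3 by push_cast; ring,
        show (r + 2 - ((r + 2 : ℕ) : ℤ) : ℤ) = 0 by push_cast; ring] at h1
      rw [h1, ← lie_skew] at h3
      have h4 : ((r : ℂ) + 3) • ⁅⁅E, f⁆, K⁆ = 0 := by
        have : -⁅⁅E, f⁆, K⁆ = ((r + 2 : ℕ) : ℂ) • ⁅⁅E, f⁆, K⁆ := by rw [h3]; module
        push_cast at this
        linear_combination (norm := module) (-1:ℂ) • this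
      rcases smul_eq_zero.1 h4 with h | h
      · exfalso
        have : ((r + 3 : ℕ) : ℂ) ≠ 0 := Nat.cast_ne_zero.2 (by omega)
        push_cast at this; exact this h
      · exact h
    have Kd : ⁅⁅e, F⁆, K⁆ = 0 := by
      rw [← k1, q.dp]
      have a1 : ⁅es 0, fs (r + 1)⁆ = H := by simpa using hp 0 (by omega)
      have a2 : ⁅es 1, fs r⁆ = H := by
        rw [← hp 1 (by omega)]; congr 2; push_cast; ring
      simp [a1, a2]
    rw [q.e0] at K0
    rw [q.f0] at Kf
    have := q.comm_fam K (r + 2) K0 Kf (by simp [Ku]) (by simp [Kd])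
    refine ⟨K, ?_, ?_, Ku, ?_, fun _ => Kd⟩
    · intro j; rw [this.1]; congr 2
    · intro j; rw [this.2]; congr 2
    · intro i hi; rw [← hp3 i (by omega)]; congr 2

end Fam

/-- the rank one loop relations that are used later -/
structure Loop (es fs hs : ℤ → G) (c : G) : Prop where
  cz : ∀ x : G, ⁅c, x⁆ = 0
  he : ∀ m n, ⁅hs m, es n⁆ = (2:ℂ) • es (m + n)
  hf : ∀ m n, ⁅hs m, fs n⁆ = (-2:ℂ) • fs (m + n)
  ef0 : ∀ n, ⁅es n, fs 0⁆ = hs n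
  ef1 : ∀ n, ⁅es n, fs (-1)⁆ = hs (n - 1) + if n = 1 then c else 0
  fe0 : ∀ n, ⁅es 0, fs n⁆ = hs n
  fe1 : ∀ n, ⁅es 1, fs n⁆ = hs (n + 1) + if n = -1 then c else 0
  ee : ∀ m n, ⁅es m, es n⁆ = 0
  ff : ∀ m n, ⁅fs m, fs n⁆ = 0

theorem Fam.loop_he {e E f F h c : G} {es fs : ℤ → G} (q : Fam e E f F h c es fs) :
    (∀ m n, ⁅⁅es m, fs 0⁆, es n⁆ = (2:ℂ) • es (m + n)) ∧
    (∀ m n, ⁅⁅es m, fs 0⁆, fs n⁆ = (-2:ℂ) • fs (m + n)) ∧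
    (∀ n, ⁅es n, fs (-1)⁆ = ⁅es (n - 1), fs 0⁆ + if n = 1 then c else 0) ∧
    (∀ n, ⁅es 0, fs n⁆ = ⁅es n, fs 0⁆) ∧
    (∀ n, ⁅es 1, fs n⁆ = ⁅es (n + 1), fs 0⁆ + if n = -1 then c else 0) := by
  have dh : ⁅⁅e, F⁆, h⁆ = 0 := by
    have := q.swap.uh
    rw [lie_add, ← lie_skew _ c, q.q.cz] at this; simpa using this
  have z2 : ∀ {x : G}, (2:ℂ) • x = 0 → x = 0 := fun h => by simpa using h
  -- negative modes
  have neg : ∀ r : ℕ, ∃ H : G, (∀ j, ⁅H, es j⁆ = (2:ℂ) • es (-(r + 1) + j)) ∧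
      (∀ j, ⁅H, fs j⁆ = (-2:ℂ) • fs (-(r + 1) + j)) ∧ ⁅⁅e, F⁆, H⁆ = 0 ∧
      (∀ i : ℤ, 0 ≤ i → i ≤ r + 1 → ⁅es (1 - i), fs (-1 - (r + 1 - i))⁆ = H) := by
    intro r
    obtain ⟨H, a1, a2, a3, a4, -⟩ := q.swap.hpos r
    refine ⟨H, ?_, ?_, a3, ?_⟩
    · intro j
      have := a1 (1 - j)
      rw [show 1 - (1 - j) = j by ring] at this
      rw [this]; congr 2; ring
    · intro j
      have := a2 (-1 - j)
      rw [show -1 - (-1 - j) = j by ring] at this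
      rw [this]; congr 2; ring
    · intro i h0 hi
      lift i to ℕ using h0
      exact a4 i (by omega)
  have neg0 : ∀ r : ℕ, ∃ H : G, (∀ j, ⁅H, es j⁆ = (2:ℂ) • es (-(r + 1) + j)) ∧
      (∀ j, ⁅H, fs j⁆ = (-2:ℂ) • fs (-(r + 1) + j)) ∧ ⁅⁅e, F⁆, H⁆ = 0 ∧
      (∀ i : ℤ, 0 ≤ i → i ≤ r + 1 → ⁅es (1 - i), fs (-1 - (r + 1 - i))⁆ = H) ∧
      ⁅es (-(r + 1)), fs 0⁆ = H := by
    intro r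
    induction r with
    | zero =>
      obtain ⟨H, a1, a2, a3, a4⟩ := neg 0
      refine ⟨H, a1, a2, a3, a4, ?_⟩
      rw [← a4 1 (by omega) (by simp)]
      have := q.dp 0 0
      rw [q.e0, q.f0, q.q.ef, dh] at this
      have := sub_eq_zero.1 (z2 this.symm)
      simp only [Nat.cast_zero, zero_add, sub_self, sub_zero]
      rw [q.f0, q.e0]
      simpa using this
    | succ r ih =>
      obtain ⟨K, -, -, b3, -, b5⟩ := ih
      obtain ⟨H, a1, a2, a3, a4⟩ := neg (r + 1)
      refine ⟨H, a1, a2, a3, a4, ?_⟩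
      rw [← a4 (r + 2) (by omega) (by push_cast; omega)]
      have := q.dp (-(r + 1)) 0
      rw [b5, b3] at this
      have := sub_eq_zero.1 (z2 this.symm)
      push_cast
      rw [show (-(r + 1 + 1) : ℤ) = -(r + 1) - 1 by ring, this]
      congr 2 <;> ring
  have key : ∀ m : ℤ, (∃ r : ℕ, m = -(r + 1)) ∨ m = 0 ∨ ∃ r : ℕ, m = r + 1 := by
    intro m
    rcases lt_trichotomy m 0 with h | h | h
    · left; exact ⟨(-m - 1).toNat, by omega⟩
    · right; left; exact h
    · right; right; exact ⟨(m - 1).toNat, by omega⟩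
  have h00 : ⁅es 0, fs 0⁆ = h := by rw [q.e0, q.f0, q.q.ef]
  have hh := q.comm_fam h 0 (by rw [q.q.he, q.e0]) (by rw [q.q.hf, q.f0]) (by simp [q.uh])
    (by simp [dh])
  have h11 : ⁅es 1, fs (-1)⁆ = h + c := by rw [q.e1, q.f1, q.q.EF]
  refine ⟨?_, ?_, ?_, ?_, ?_⟩
  · intro m
    rcases key m with ⟨r, rfl⟩ | rfl | ⟨r, rfl⟩
    · obtain ⟨H, a1, a2, a3, a4, a5⟩ := neg0 r
      rw [a5]; exact a1
    · rw [h00]; exact hh.1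
    · obtain ⟨H, a1, a2, a3, a4, a5⟩ := q.hpos r
      have := a4 (r + 1) le_rfl
      push_cast at this
      rw [sub_self] at this
      rw [this]; exact a1
  · intro m
    rcases key m with ⟨r, rfl⟩ | rfl | ⟨r, rfl⟩
    · obtain ⟨H, a1, a2, a3, a4, a5⟩ := neg0 r
      rw [a5]; exact a2
    · rw [h00]; exact hh.2
    · obtain ⟨H, a1, a2, a3, a4, a5⟩ := q.hpos r
      have := a4 (r + 1) le_rfl
      push_cast at this
      rw [sub_self] at this
      rw [this]; exact a2
  · intro n
    rcases key (n - 1) with ⟨r, hr⟩ | hr | ⟨r, hr⟩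
    · obtain ⟨H, a1, a2, a3, a4, a5⟩ := neg0 r
      rw [hr, a5, ← a4 (r + 1) (by omega) le_rfl, if_neg (by omega), add_zero]; congr 2 <;> omega
    · obtain rfl : n = 1 := by omega
      rw [h11, hr, h00, if_pos rfl]
    · obtain ⟨H, a1, a2, a3, a4, a5⟩ := q.hpos (r + 1)
      have h1 := a4 (r + 1 + 1) le_rfl
      have h2 := q.dp n 0
      rw [show ((r + 1 + 1 : ℕ) : ℤ) = n by push_cast; omega,
        show (((r + 1 : ℕ) : ℤ) + 1 - n) = 0 by push_cast; omega] at h1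
      rw [h1, a5 (by omega)] at h2
      rw [if_neg (by omega), add_zero]
      exact (sub_eq_zero.1 (z2 h2.symm)).symm
  · intro m
    rcases key m with ⟨r, rfl⟩ | rfl | ⟨r, rfl⟩
    · obtain ⟨H, a1, a2, a3, a4, a5⟩ := neg0 r
      rw [a5, ← a4 1 (by omega) (by omega)]; congr 2; omega
    · rfl
    · obtain ⟨H, a1, a2, a3, a4, a5⟩ := q.hpos r
      have h1 := a4 (r + 1) le_rfl
      have h2 := a4 0 (by omega)
      push_cast at h1 h2
      rw [sub_self] at h1
      rw [sub_zero] at h2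
      rw [h1, h2]
  · intro n
    rcases key (n + 1) with ⟨r, hr⟩ | hr | ⟨r, hr⟩
    · obtain ⟨H, a1, a2, a3, a4, a5⟩ := neg0 r
      rw [hr, a5, ← a4 0 (by omega) (by omega), if_neg (by omega), add_zero]; congr 2 <;> omega
    · obtain rfl : n = -1 := by omega
      rw [h11, hr, h00, if_pos rfl]
    · obtain ⟨H, a1, a2, a3, a4, a5⟩ := q.hpos r
      have h1 := a4 (r + 1) le_rfl
      have h2 := a4 1 (by omega)
      push_cast at h1 h2
      rw [sub_self] at h1
      rw [hr, h1, if_neg (by omega), add_zero, ← h2]; congr 2; omega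

theorem lie_comm_of_h {es hs : ℤ → G}
    (he : ∀ m n, ⁅hs m, es n⁆ = (2:ℂ) • es (m + n)) (h1 : ⁅es 0, es 1⁆ = 0)
    (h2 : ⁅es 0, es (-1)⁆ = 0) : ∀ m n, ⁅es m, es n⁆ = 0 := by
  have key : ∀ r m n, ⁅hs r, ⁅es m, es n⁆⁆ = (2:ℂ) • (⁅es (r + m), es n⁆ + ⁅es m, es (r + n)⁆) := by
    intro r m n
    rw [leibniz_lie, he, he, smul_lie, lie_smul]; module
  have z2 : ∀ {x : G}, (2:ℂ) • x = 0 → x = 0 := fun h => by simpa using h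
  have a1 : ∀ r, ⁅es r, es 1⁆ = - ⁅es 0, es (r + 1)⁆ := by
    intro r
    have := key r 0 1
    rw [h1, lie_zero] at this
    rw [eq_neg_iff_add_eq_zero]; simpa using z2 this.symm
  have a2 : ∀ r, ⁅es r, es (-1)⁆ = - ⁅es 0, es (r - 1)⁆ := by
    intro r
    have := key r 0 (-1)
    rw [h2, lie_zero] at this
    rw [eq_neg_iff_add_eq_zero]; simpa [sub_eq_add_neg] using z2 this.symm
  have z : ∀ s : ℤ, ⁅es 0, es s⁆ = 0 := by
    intro s
    induction s using Int.induction_on with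
    | zero => simp
    | succ n ih =>
      have := key 1 0 n
      rw [ih, lie_zero, add_zero, ← lie_skew, a1, neg_neg, add_comm (1:ℤ)] at this
      have := z2 this.symm
      rw [← two_smul ℂ] at this
      exact z2 this
    | pred n ih =>
      have := key (-1) 0 (-n)
      rw [ih, lie_zero, add_zero, ← lie_skew, a2, neg_neg, add_comm (-1:ℤ), ← sub_eq_add_neg] at this
      have := z2 this.symm
      rw [← two_smul ℂ] at this
      exact z2 this
  intro m n
  have := key m 0 n
  rw [z, z, lie_zero, add_zero, add_zero] at this
  exact z2 this.symm

theorem Quad.loop {e E f F h c : G} (q : Quad e E f F h c) :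
    ∃ es fs hs, Loop es fs hs c ∧ es 0 = e ∧ es 1 = E ∧ fs 0 = f ∧ fs (-1) = F := by
  obtain ⟨es, fs, q⟩ := q.fam
  obtain ⟨h1, h2, h3, h4, h5⟩ := q.loop_he
  refine ⟨es, fs, fun n => ⁅es n, fs 0⁆, ⟨q.q.cz, h1, h2, fun _ => rfl, h3, h4, h5, ?_, ?_⟩, q.e0, q.e1,
    q.f0, q.f1⟩
  · refine lie_comm_of_h (hs := fun n => ⁅es n, fs 0⁆) h1 ?_ ?_
    · rw [q.e0, q.e1, q.q.eE]
    · have := q.swap.y12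
      simpa using this
  · refine lie_comm_of_h (hs := fun n => -⁅es n, fs 0⁆) (fun m n => ?_) ?_ ?_
    · rw [neg_lie, h2]; module
    · exact q.z01
    · rw [q.f0, q.f1, q.q.fF]

theorem Loop.inv {es fs hs : ℤ → G} {c : G} (q : Loop es fs hs c) :
    Loop (fun n => fs (-n)) (fun n => es (-n)) (fun n => - hs (-n)) (-c) where
  cz x := by rw [neg_lie, q.cz, neg_zero]
  he m n := by rw [neg_lie, q.hf, neg_add]; module
  hf m n := by rw [neg_lie, q.he, neg_add]; module
  ef0 n := by rw [neg_zero, ← lie_skew, q.fe0]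
  ef1 n := by
    rw [neg_neg, ← lie_skew, q.fe1]
    by_cases h : n = 1
    · subst h; simp; abel
    · rw [if_neg (by omega), if_neg h]; simp; ring_nf
  fe0 n := by rw [neg_zero, ← lie_skew, q.ef0]
  fe1 n := by
    rw [← lie_skew, q.ef1]
    by_cases h : n = -1
    · subst h; simp; abel
    · rw [if_neg (by omega), if_neg h]; simp; ring_nf
  ee m n := q.ff _ _
  ff m n := q.ee _ _

end RankOne
end Ell

namespace Ell
set_option linter.unusedSectionVars false

section Sl2
variable {G : Type*} [LieRing G] [LieAlgebra ℂ G]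

structure Sl2 (e f h : G) : Prop where
  ef : ⁅e, f⁆ = h
  he : ⁅h, e⁆ = (2:ℂ) • e
  hf : ⁅h, f⁆ = (-2:ℂ) • f

theorem Sl2.inv {e f h : G} (q : Sl2 e f h) : Sl2 f e (-h) where
  ef := by rw [← lie_skew, q.ef]
  he := by rw [neg_lie, q.hf]; module
  hf := by rw [neg_lie, q.he]; module

namespace Sl2
variable {e f h : G} (q : Sl2 e f h)
include q

theorem wt_f {v : G} {w : ℂ} (hv : ⁅h, v⁆ = w • v) : ⁅h, ⁅f, v⁆⁆ = (w - 2) • ⁅f, v⁆ := by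
  rw [leibniz_lie, q.hf, hv, smul_lie, lie_smul]; module

theorem wt_e {v : G} {w : ℂ} (hv : ⁅h, v⁆ = w • v) : ⁅h, ⁅e, v⁆⁆ = (w + 2) • ⁅e, v⁆ := by
  rw [leibniz_lie, q.he, hv, smul_lie, lie_smul]; module

theorem wt_fn {v : G} {w : ℂ} (hv : ⁅h, v⁆ = w • v) (n : ℕ) :
    ⁅h, (LieAlgebra.ad ℂ G f ^ n) v⁆ = (w - 2 * n) • (LieAlgebra.ad ℂ G f ^ n) v := by
  induction n with
  | zero => simp [hv]
  | succ n ih =>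
    rw [pow_succ', Module.End.mul_apply, LieAlgebra.ad_apply, q.wt_f ih]; congr 1; push_cast; ring

theorem e_fn {v : G} {w : ℂ} (hv : ⁅h, v⁆ = w • v) (n : ℕ) :
    ⁅e, (LieAlgebra.ad ℂ G f ^ (n + 1)) v⁆ = (LieAlgebra.ad ℂ G f ^ (n + 1)) ⁅e, v⁆
      + ((n + 1) * (w - n)) • (LieAlgebra.ad ℂ G f ^ n) v := by
  induction n with
  | zero =>
    simp only [zero_add, pow_one, pow_zero, LieAlgebra.ad_apply, Module.End.one_apply]
    rw [leibniz_lie, q.ef, hv]; push_cast; module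
  | succ n ih =>
    rw [pow_succ', Module.End.mul_apply, LieAlgebra.ad_apply, leibniz_lie, q.ef, q.wt_fn hv, ih,
      lie_add, lie_smul, Module.End.mul_apply, LieAlgebra.ad_apply, pow_succ' _ n,
      Module.End.mul_apply, Module.End.mul_apply, LieAlgebra.ad_apply, LieAlgebra.ad_apply]
    push_cast
    module

theorem eq_zero_of_high {v : G} {w : ℕ} (hv : ⁅h, v⁆ = (w:ℂ) • v) (he : ⁅e, v⁆ = 0)
    (hf : (LieAlgebra.ad ℂ G f ^ w) v = 0) : v = 0 := by
  have key : ∀ n : ℕ, n ≤ w → (LieAlgebra.ad ℂ G f ^ n) v = 0 → v = 0 := by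
    intro n
    induction n with
    | zero => intro _ h; simpa using h
    | succ n ih =>
      intro hn h
      apply ih (by omega)
      have := q.e_fn hv n
      rw [h, he, map_zero, lie_zero, zero_add] at this
      rcases smul_eq_zero.1 this.symm with h | h
      · exfalso
        have h1 : ((n + 1 : ℕ) : ℂ) ≠ 0 := Nat.cast_ne_zero.2 (by omega)
        have h2 : ((w - n : ℕ) : ℂ) ≠ 0 := Nat.cast_ne_zero.2 (by omega)
        rw [Nat.cast_sub (by omega)] at h2
        push_cast at h1
        exact mul_ne_zero h1 h2 h
      · exact h
  exact key w le_rfl hf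

theorem eq_zero {v : G} {w N : ℕ} (hv : ⁅h, v⁆ = (w:ℂ) • v) (he : (LieAlgebra.ad ℂ G e ^ N) v = 0)
    (hf : (LieAlgebra.ad ℂ G f ^ w) v = 0) : v = 0 := by
  induction N generalizing v w with
  | zero => simpa using he
  | succ N ih =>
    refine q.eq_zero_of_high hv ?_ hf
    refine ih (w := w + 2) ?_ ?_ ?_
    · rw [q.wt_e hv]; push_cast; rfl
    · rw [pow_succ, Module.End.mul_apply, LieAlgebra.ad_apply] at he; exact he
    · have h1 := q.e_fn hv (w + 1)
      have h2 : (LieAlgebra.ad ℂ G f ^ (w + 1)) v = 0 := by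
        rw [pow_succ', Module.End.mul_apply, hf, map_zero]
      rw [pow_succ', Module.End.mul_apply, h2, map_zero, lie_zero, smul_zero, add_zero] at h1
      rw [pow_succ']; exact h1.symm

theorem high_nil {v : G} {w N : ℕ} (hv : ⁅h, v⁆ = (w:ℂ) • v) (he : ⁅e, v⁆ = 0)
    (hf' : (LieAlgebra.ad ℂ G f ^ N) v = 0) : (LieAlgebra.ad ℂ G f ^ (w + 1)) v = 0 := by
  have hf : (LieAlgebra.ad ℂ G f ^ (w + 1 + N)) v = 0 := by
    rw [pow_add, Module.End.mul_apply, hf', map_zero]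
  clear hf'
  induction N with
  | zero => exact hf
  | succ N ih =>
    have := q.e_fn hv (w + 1 + N)
    rw [add_assoc (w + 1), hf, he, map_zero, lie_zero, zero_add] at this
    rcases smul_eq_zero.1 this.symm with h | h
    · exfalso
      have h1 : ((w + 1 + N + 1 : ℕ) : ℂ) ≠ 0 := Nat.cast_ne_zero.2 (by omega)
      have h2 : ((N + 1 : ℕ) : ℂ) ≠ 0 := Nat.cast_ne_zero.2 (by omega)
      push_cast at h1 h2 h
      refine mul_ne_zero h1 (neg_ne_zero.2 h2) ?_
      rw [← h]; ring
    · exact ih h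

end Sl2

/-- local ad-nilpotency -/
def LN (x : G) : Prop := ∀ v : G, ∃ N : ℕ, (LieAlgebra.ad ℂ G x ^ N) v = 0

theorem Sl2.high0 {e f h : G} (q : Sl2 e f h) (ln : LN f) {v : G} (hv : ⁅h, v⁆ = 0) (he : ⁅e, v⁆ = 0) :
    ⁅f, v⁆ = 0 := by
  obtain ⟨N, hN⟩ := ln v
  have := q.high_nil (w := 0) (by simpa using hv) he hN
  simpa using this

theorem Sl2.low0 {e f h : G} (q : Sl2 e f h) (ln : LN e) {v : G} (hv : ⁅h, v⁆ = 0) (he : ⁅f, v⁆ = 0) :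
    ⁅e, v⁆ = 0 := q.inv.high0 ln (by rw [neg_lie, hv, neg_zero]) he

theorem Sl2.low1 {e f h : G} (q : Sl2 e f h) (ln : LN e) {v : G} (hv : ⁅h, v⁆ = - v) (he : ⁅f, v⁆ = 0) :
    ⁅e, ⁅e, v⁆⁆ = 0 := by
  obtain ⟨N, hN⟩ := ln v
  have := q.inv.high_nil (w := 1) (by simp [hv]) he hN
  simpa [pow_succ] using this

end Sl2
end Ell

namespace Ell
set_option linter.unusedSectionVars false

section Pair
variable {G : Type*} [LieRing G] [LieAlgebra ℂ G]

theorem Loop.swap {es fs hs : ℤ → G} {c : G} (q : Loop es fs hs c) :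
    Loop (fun n => es (1 - n)) (fun n => fs (-1 - n)) (fun n => hs (-n) + if n = 0 then c else 0)
      (-c) where
  cz x := by rw [neg_lie, q.cz, neg_zero]
  he m n := by
    rw [add_lie, q.he]
    split_ifs
    · rw [q.cz, add_zero]; congr 2; ring
    · rw [zero_lie, add_zero]; congr 2; ring
  hf m n := by
    rw [add_lie, q.hf]
    split_ifs
    · rw [q.cz, add_zero]; congr 2; ring
    · rw [zero_lie, add_zero]; congr 2; ring
  ef0 n := by
    rw [sub_zero, q.ef1]
    by_cases h : n = 0
    · subst h; simp
    · rw [if_neg (by omega), if_neg h, add_zero, add_zero]; congr 1; ring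
  ef1 n := by
    rw [show (-1 - -1 : ℤ) = 0 by ring, q.ef0]
    by_cases h : n = 1
    · subst h; simp
    · rw [if_neg (by omega), if_neg h, add_zero, add_zero]; congr 1; ring
  fe0 n := by
    rw [sub_zero, q.fe1]
    by_cases h : n = 0
    · subst h; simp
    · rw [if_neg (by omega), if_neg h, add_zero, add_zero]; congr 1; ring
  fe1 n := by
    rw [show (1 - 1 : ℤ) = 0 by ring, q.fe0]
    by_cases h : n = -1
    · subst h; simp
    · rw [if_neg (by omega), if_neg h, add_zero, add_zero]; congr 1; ring
  ee m n := q.ee _ _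
  ff m n := q.ff _ _

theorem spread {X : ℤ → G} {U D T : G} {k0 k : ℂ} (hk : k0 ≠ 0) (s : ℤ)
    (hU : ∀ n, ⁅U, X n⁆ = k0 • X (n + 1)) (hD : ∀ n, ⁅D, X n⁆ = k0 • X (n - 1))
    (cU : ∀ x : G, ⁅⁅U, T⁆, x⁆ = 0) (cD : ∀ x : G, ⁅⁅D, T⁆, x⁆ = 0) (n0 : ℤ)
    (h0 : ⁅T, X n0⁆ = k • X (n0 + s)) :
    ∀ n, ⁅T, X n⁆ = k • X (n + s) := by
  have cu : ∀ x : G, ⁅T, ⁅U, x⁆⁆ = ⁅U, ⁅T, x⁆⁆ := by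
    intro x; rw [leibniz_lie U T x, cU, zero_add]
  have cd : ∀ x : G, ⁅T, ⁅D, x⁆⁆ = ⁅D, ⁅T, x⁆⁆ := by
    intro x; rw [leibniz_lie D T x, cD, zero_add]
  have up : ∀ n, ⁅T, X n⁆ = k • X (n + s) → ⁅T, X (n + 1)⁆ = k • X (n + 1 + s) := by
    intro n h
    have := cu (X n)
    rw [hU, h, lie_smul, lie_smul, hU, smul_comm] at this
    rw [add_right_comm]
    exact smul_right_injective _ hk this
  have dn : ∀ n, ⁅T, X n⁆ = k • X (n + s) → ⁅T, X (n - 1)⁆ = k • X (n - 1 + s) := by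
    intro n h
    have := cd (X n)
    rw [hD, h, lie_smul, lie_smul, hD, smul_comm] at this
    rw [sub_add_eq_add_sub]
    exact smul_right_injective _ hk this
  intro n
  induction n using Int.inductionOn' (b := n0) with
  | zero => exact h0
  | succ k _ ih => exact up k ih
  | pred k _ ih => exact dn k ih

theorem grid_ind {P : ℤ → ℤ → Prop} (h0 : P 0 0) (h1 : ∀ m n, P m n → P (m + 1) n)
    (h2 : ∀ m n, P m n → P (m - 1) n) (h3 : ∀ m n, P m n → P m (n + 1))
    (h4 : ∀ m n, P m n → P m (n - 1)) : ∀ m n, P m n := by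
  intro m n
  induction n using Int.induction_on with
  | zero =>
    induction m using Int.induction_on with
    | zero => exact h0
    | succ k ih => exact h1 _ _ ih
    | pred k ih => exact h2 _ _ ih
  | succ k ih => exact h3 _ _ ih
  | pred k ih => exact h4 _ _ ih

theorem det2 {A B : G} {p q r s : ℂ} (hd : p * s - q * r ≠ 0) (h1 : p • A + q • B = 0)
    (h2 : r • A + s • B = 0) : A = 0 ∧ B = 0 := by
  have a : (p * s - q * r) • A = 0 := by
    linear_combination (norm := module) s • h1 - q • h2
  have b : (p * s - q * r) • B = 0 := by
    linear_combination (norm := module) p • h2 - r • h1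
  exact ⟨(smul_eq_zero.1 a).resolve_left hd, (smul_eq_zero.1 b).resolve_left hd⟩

theorem grid {q : ℤ → ℤ → G} {U U' D D' : G} {p t r s : ℂ} (hd : p * s - t * r ≠ 0)
    (hU : ∀ m n, ⁅U, q m n⁆ = p • q (m + 1) n + t • q m (n + 1))
    (hU' : ∀ m n, ⁅U', q m n⁆ = r • q (m + 1) n + s • q m (n + 1))
    (hD : ∀ m n, ⁅D, q m n⁆ = p • q (m - 1) n + t • q m (n - 1))
    (hD' : ∀ m n, ⁅D', q m n⁆ = r • q (m - 1) n + s • q m (n - 1))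
    (h0 : q 0 0 = 0) : ∀ m n, q m n = 0 := by
  have up : ∀ m n, q m n = 0 → q (m + 1) n = 0 ∧ q m (n + 1) = 0 := by
    intro m n h
    have h1 := hU m n
    have h2 := hU' m n
    rw [h, lie_zero] at h1 h2
    exact det2 hd h1.symm h2.symm
  have dn : ∀ m n, q m n = 0 → q (m - 1) n = 0 ∧ q m (n - 1) = 0 := by
    intro m n h
    have h1 := hD m n
    have h2 := hD' m n
    rw [h, lie_zero] at h1 h2
    exact det2 hd h1.symm h2.symm
  exact grid_ind h0 (fun m n h => (up m n h).1) (fun m n h => (dn m n h).1)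
    (fun m n h => (up m n h).2) (fun m n h => (dn m n h).2)

theorem grid2 {q : ℤ → ℤ → G} {U U' D D' : G} {p t s : ℂ} (hp : p ≠ 0) (hs : s ≠ 0)
    (hU : ∀ m n, ⁅U, q m n⁆ = p • q (m + 1) n + t • q m (n + 2))
    (hU' : ∀ m n, ⁅U', q m n⁆ = s • q m (n + 1))
    (hD : ∀ m n, ⁅D, q m n⁆ = p • q (m - 1) n + t • q m (n - 2))
    (hD' : ∀ m n, ⁅D', q m n⁆ = s • q m (n - 1))
    (h0 : q 0 0 = 0) : ∀ m n, q m n = 0 := by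
  have a1 : ∀ m n, q m n = 0 → q m (n + 1) = 0 := by
    intro m n h
    have h2 := hU' m n
    rw [h, lie_zero] at h2
    exact (smul_eq_zero.1 h2.symm).resolve_left hs
  have a2 : ∀ m n, q m n = 0 → q m (n - 1) = 0 := by
    intro m n h
    have h2 := hD' m n
    rw [h, lie_zero] at h2
    exact (smul_eq_zero.1 h2.symm).resolve_left hs
  refine grid_ind h0 ?_ ?_ a1 a2
  · intro m n h
    have h1 := hU m n
    have h2 := a1 _ _ (a1 _ _ h)
    rw [add_assoc] at h2
    rw [h, lie_zero, show (2:ℤ) = 1 + 1 by rfl, h2, smul_zero, add_zero] at h1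
    exact (smul_eq_zero.1 h1.symm).resolve_left hp
  · intro m n h
    have h1 := hD m n
    have h2 := a2 _ _ (a2 _ _ h)
    rw [sub_sub] at h2
    rw [h, lie_zero, show (2:ℤ) = 1 + 1 by rfl, h2, smul_zero, add_zero] at h1
    exact (smul_eq_zero.1 h1.symm).resolve_left hp

/-- conclusion about a pair of nodes -/
structure PairOK (ex fx hx ey fy hy : ℤ → G) : Prop where
  ef : ∀ m n, ⁅ex m, fy n⁆ = 0
  fe : ∀ m n, ⁅ey m, fx n⁆ = 0
  hxe : ∀ m n, ⁅hx m, ey n⁆ ∈ Submodule.span ℂ (Set.range ey)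
  hxf : ∀ m n, ⁅hx m, fy n⁆ ∈ Submodule.span ℂ (Set.range fy)
  hye : ∀ m n, ⁅hy m, ex n⁆ ∈ Submodule.span ℂ (Set.range ex)
  hyf : ∀ m n, ⁅hy m, fx n⁆ ∈ Submodule.span ℂ (Set.range fx)

/-- commutation of opposite generators of two nodes -/
structure Comm (ex fx ey fy : ℤ → G) : Prop where
  a00 : ⁅ex 0, fy 0⁆ = 0
  a01 : ⁅ex 0, fy (-1)⁆ = 0
  a10 : ⁅ex 1, fy 0⁆ = 0
  a11 : ⁅ex 1, fy (-1)⁆ = 0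
  b00 : ⁅ey 0, fx 0⁆ = 0
  b01 : ⁅ey 0, fx (-1)⁆ = 0
  b10 : ⁅ey 1, fx 0⁆ = 0
  b11 : ⁅ey 1, fx (-1)⁆ = 0

/-- weights `-b` of the node `y` generators under `hx 0` -/
structure Wts (hx0 : G) (ey fy : ℤ → G) (b : ℂ) : Prop where
  e0 : ⁅hx0, ey 0⁆ = (-b) • ey 0
  e1 : ⁅hx0, ey 1⁆ = (-b) • ey 1
  f0 : ⁅hx0, fy 0⁆ = b • fy 0
  f1 : ⁅hx0, fy (-1)⁆ = b • fy (-1)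

theorem Comm.swap {ex fx ey fy : ℤ → G} (q : Comm ex fx ey fy) :
    Comm (fun n => ex (1 - n)) (fun n => fx (-1 - n)) (fun n => ey (1 - n)) (fun n => fy (-1 - n)) where
  a00 := q.a11
  a01 := q.a10
  a10 := q.a01
  a11 := q.a00
  b00 := q.b11
  b01 := q.b10
  b10 := q.b01
  b11 := q.b00

theorem Comm.inv {ex fx ey fy : ℤ → G} (q : Comm ex fx ey fy) :
    Comm (fun n => fx (- n)) (fun n => ex (- n)) (fun n => fy (- n)) (fun n => ey (- n)) where
  a00 := sk0 q.b00
  a01 := sk0 q.b10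
  a10 := sk0 q.b01
  a11 := sk0 q.b11
  b00 := sk0 q.a00
  b01 := sk0 q.a10
  b10 := sk0 q.a01
  b11 := sk0 q.a11

theorem Wts.swap {h : G} {ey fy : ℤ → G} {b : ℂ} (q : Wts h ey fy b) {c : G} (hc : ∀ x : G, ⁅c, x⁆ = 0) :
    Wts (h + c) (fun n => ey (1 - n)) (fun n => fy (-1 - n)) b where
  e0 := by rw [add_lie, hc, add_zero]; exact q.e1
  e1 := by rw [add_lie, hc, add_zero]; exact q.e0
  f0 := by rw [add_lie, hc, add_zero]; exact q.f1
  f1 := by rw [add_lie, hc, add_zero]; exact q.f0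

theorem Wts.inv {h : G} {ey fy : ℤ → G} {b : ℂ} (q : Wts h ey fy b) :
    Wts (-h) (fun n => fy (-n)) (fun n => ey (-n)) b where
  e0 := by
    rw [neg_lie, neg_zero, q.f0]; module
  e1 := by
    rw [neg_lie, q.f1]; module
  f0 := by
    rw [neg_lie, neg_zero, q.e0]; module
  f1 := by
    rw [neg_lie, neg_neg, q.e1]; module

theorem Loop.sl2_0 {es fs hs : ℤ → G} {c : G} (q : Loop es fs hs c) : Sl2 (es 0) (fs 0) (hs 0) where
  ef := q.ef0 0
  he := by rw [q.he, zero_add]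
  hf := by rw [q.hf, zero_add]

theorem Loop.sl2_1 {es fs hs : ℤ → G} {c : G} (q : Loop es fs hs c) :
    Sl2 (es 1) (fs (-1)) (hs 0 + c) where
  ef := by rw [q.ef1]; simp
  he := by rw [add_lie, q.cz, add_zero, q.he, zero_add]
  hf := by rw [add_lie, q.cz, add_zero, q.hf, zero_add]

/-- local nilpotency of four generators -/
structure LN4 (ex fx : ℤ → G) : Prop where
  e0 : LN (ex 0)
  e1 : LN (ex 1)
  f0 : LN (fx 0)
  f1 : LN (fx (-1))

theorem LN4.swap {ex fx : ℤ → G} (q : LN4 ex fx) :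
    LN4 (fun n => ex (1 - n)) (fun n => fx (-1 - n)) := ⟨q.e1, q.e0, q.f1, q.f0⟩

theorem LN4.inv {ex fx : ℤ → G} (q : LN4 ex fx) :
    LN4 (fun n => fx (- n)) (fun n => ex (- n)) := ⟨q.f0, q.f1, q.e0, q.e1⟩

/-- an edge with equal `k`; `x` is long -/
structure PairEq (ex fx hx : ℤ → G) (cx : G) (ey fy hy : ℤ → G) (cy : G) (b : ℂ) : Prop where
  Lx : Loop ex fx hx cx
  Ly : Loop ey fy hy cy
  cm : Comm ex fx ey fy
  wx : Wts (hx 0) ey fy 1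
  wy : Wts (hy 0) ex fx b
  sr6 : ⁅ey 1, ex 0⁆ = ⁅ey 0, ex 1⁆
  sr7 : ⁅fy (-1), fx 0⁆ = ⁅fy 0, fx (-1)⁆
  s1 : ⁅ex 0, ⁅ex 0, ey 1⁆⁆ = 0
  s2 : ⁅ex 1, ⁅ex 1, ey 0⁆⁆ = 0
  s3 : ⁅fx 0, ⁅fx 0, fy (-1)⁆⁆ = 0
  s4 : ⁅fx (-1), ⁅fx (-1), fy 0⁆⁆ = 0
  ln : LN4 ex fx

theorem PairEq.swap {ex fx hx : ℤ → G} {cx : G} {ey fy hy : ℤ → G} {cy : G} {b : ℂ}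
    (q : PairEq ex fx hx cx ey fy hy cy b) :
    PairEq (fun n => ex (1 - n)) (fun n => fx (-1 - n)) (fun n => hx (-n) + if n = 0 then cx else 0)
      (-cx) (fun n => ey (1 - n)) (fun n => fy (-1 - n)) (fun n => hy (-n) + if n = 0 then cy else 0)
      (-cy) b where
  Lx := q.Lx.swap
  Ly := q.Ly.swap
  cm := q.cm.swap
  wx := by simpa using q.wx.swap q.Lx.cz
  wy := by simpa using q.wy.swap q.Ly.cz
  sr6 := q.sr6.symm
  sr7 := q.sr7.symm
  s1 := q.s2
  s2 := q.s1
  s3 := q.s4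
  s4 := q.s3
  ln := q.ln.swap

theorem PairEq.inv {ex fx hx : ℤ → G} {cx : G} {ey fy hy : ℤ → G} {cy : G} {b : ℂ}
    (q : PairEq ex fx hx cx ey fy hy cy b) :
    PairEq (fun n => fx (-n)) (fun n => ex (-n)) (fun n => - hx (-n)) (-cx)
      (fun n => fy (-n)) (fun n => ey (-n)) (fun n => - hy (-n)) (-cy) b where
  Lx := q.Lx.inv
  Ly := q.Ly.inv
  cm := q.cm.inv
  wx := by simpa using q.wx.inv
  wy := by simpa using q.wy.inv
  sr6 := q.sr7
  sr7 := q.sr6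
  s1 := q.s3
  s2 := q.s4
  s3 := q.s1
  s4 := q.s2
  ln := q.ln.inv

end Pair
end Ell

namespace Ell
set_option linter.unusedSectionVars false

section PairE
variable {G : Type*} [LieRing G] [LieAlgebra ℂ G]
variable {ex fx hx : ℤ → G} {cx : G} {ey fy hy : ℤ → G} {cy : G} {b : ℂ}

/-- facts (1) -/
structure PE1 (ex fx hx ey fy hy : ℤ → G) (b : ℂ) : Prop where
  ye : ⁅hy 1, ex 0⁆ = (-b) • ex 1
  xe : ⁅hx 1, ey 0⁆ = (-1:ℂ) • ey 1
  yf : ⁅hy 1, fx (-1)⁆ = b • fx 0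
  xf : ⁅hx 1, fy (-1)⁆ = (1:ℂ) • fy 0

theorem PairEq.pe1 (q : PairEq ex fx hx cx ey fy hy cy b) : PE1 ex fx hx ey fy hy b where
  ye := by
    have h : hy 1 = ⁅ey 1, fy 0⁆ := (q.Ly.ef0 1).symm
    rw [h, lie_lie, sk0 q.cm.a00, lie_zero, zero_sub, q.sr6, leibniz_lie, sk0 q.cm.a10, lie_zero,
      add_zero, ← lie_skew (fy 0), q.Ly.ef0, neg_lie, q.wy.e1]; module
  xe := by
    have h : hx 1 = ⁅ex 1, fx 0⁆ := (q.Lx.ef0 1).symm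
    rw [h, lie_lie, sk0 q.cm.b00, lie_zero, zero_sub, ← lie_skew (ex 1), ← q.sr6, lie_neg, leibniz_lie, sk0 q.cm.b10, zero_lie,
      zero_add, ← lie_skew (fx 0), q.Lx.ef0, lie_neg, ← lie_skew _ (hx 0), q.wx.e1]; module
  yf := by
    have h : hy 1 = ⁅ey 1, fy 0⁆ := (q.Ly.ef0 1).symm
    rw [h, lie_lie, q.cm.b11, lie_zero, sub_zero, ← q.sr7, leibniz_lie, q.cm.b10, lie_zero,
      add_zero, q.Ly.ef1, add_lie]
    simp only [if_true, q.Ly.cz, sub_self]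
    rw [q.wy.f0]; module
  xf := by
    have h : hx 1 = ⁅ex 1, fx 0⁆ := (q.Lx.ef0 1).symm
    rw [h, lie_lie, q.cm.a11, lie_zero, sub_zero, ← lie_skew (fx 0), q.sr7, lie_neg, leibniz_lie, q.cm.a10, zero_lie,
      zero_add, q.Lx.ef1, ← lie_skew, add_lie]
    simp only [if_true, q.Lx.cz, sub_self]
    rw [q.wx.f0]; module

/-- facts (2) -/
theorem PairEq.pe2 (q : PairEq ex fx hx cx ey fy hy cy b) :
    ⁅hy 1, ex 1⁆ = (-b) • ex 2 ∧ ⁅ex 0, ⁅ex 1, ey 1⁆⁆ = 0 := by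
  have h6 : ⁅ex 0, ey 1⁆ = ⁅ex 1, ey 0⁆ := by
    rw [← lie_skew, q.sr6, lie_skew]
  have hY0 : ⁅ex 0, ⁅ex 1, ey 1⁆⁆ = 0 := by
    rw [leibniz_lie, q.Lx.ee, zero_lie, zero_add, h6, q.s2]
  refine ⟨?_, hY0⟩
  have hx1y1 : ⁅hx 1, ey 1⁆ = ⁅⁅ex 1, ey 1⁆, fx 0⁆ := by
    rw [lie_lie (ex 1) (ey 1), q.cm.b10, lie_zero, q.Lx.ef0, zero_sub, lie_skew]
  have key : ⁅ex 2, ey 0⁆ = ⁅ex 1, ey 1⁆ := by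
    have h : ⁅hx 1, ⁅ex 0, ey 1⁆⁆ = ⁅hx 1, ⁅ex 1, ey 0⁆⁆ := by rw [h6]
    rw [leibniz_lie (hx 1) (ex 0), leibniz_lie (hx 1) (ex 1), q.Lx.he, q.Lx.he, q.pe1.xe, hx1y1,
      leibniz_lie (ex 0), hY0, zero_lie, zero_add, q.Lx.ef0, ← lie_skew _ (hx 0), leibniz_lie (hx 0),
      q.Lx.he, q.wx.e1, lie_smul] at h
    norm_num at h
    rw [← lie_skew (ey 1)] at h
    linear_combination (norm := module) (-1/2:ℂ) • h
  have z : ⁅ex 2, fy 0⁆ = 0 := by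
    have h1 : ⁅fx (-1), ⁅fx 0, fy 0⁆⁆ = 0 := by
      rw [leibniz_lie, q.Lx.ff, zero_lie, zero_add, ← lie_skew (fx (-1)), ← q.sr7, lie_skew, q.s3]
    have h2 : ⁅hx 0 + cx, ⁅fx 0, fy 0⁆⁆ = - ⁅fx 0, fy 0⁆ := by
      rw [add_lie, q.Lx.cz, leibniz_lie, q.Lx.hf, q.wx.f0]
      simp only [smul_lie, lie_smul, add_zero]; module
    have h3 := q.Lx.sl2_1.low1 q.ln.e1 h2 h1
    have e1 : ⁅ex 1, ⁅fx 0, fy 0⁆⁆ = ⁅hx 1, fy 0⁆ := by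
      rw [leibniz_lie, q.Lx.ef0, q.cm.a10, lie_zero, add_zero]
    rw [e1, leibniz_lie, q.cm.a10, lie_zero, add_zero, ← lie_skew (ex 1), q.Lx.he] at h3
    norm_num at h3
    exact h3
  have h4 : ⁅hy 1, ex 1⁆ = - ⁅⁅ex 1, ey 1⁆, fy 0⁆ := by
    rw [lie_lie (ex 1), q.cm.a10, lie_zero, sub_zero, q.Ly.ef0, lie_skew]
  have wy2 : ⁅hy 0, ex 2⁆ = (-b) • ex 2 := by
    have h0 : ⁅hy 0, hx 1⁆ = 0 := by
      have : hx 1 = ⁅ex 1, fx 0⁆ := (q.Lx.ef0 1).symm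
      rw [this, leibniz_lie, q.wy.e1, q.wy.f0]
      simp
    have h := q.Lx.he 1 1
    have h' : ⁅hy 0, ⁅hx 1, ex 1⁆⁆ = (-b) • ⁅hx 1, ex 1⁆ := by
      rw [leibniz_lie, h0, zero_lie, zero_add, q.wy.e1, lie_smul]
    rw [h] at h'
    norm_num at h'
    rw [smul_comm] at h'
    have := smul_right_injective G (two_ne_zero (α := ℂ)) (a₁ := ⁅hy 0, ex 2⁆) (a₂ := -(b • ex 2))
      (by simp only [smul_neg]; rw [h'])
    rw [this]; module
  rw [h4, ← key, lie_lie (ex 2), z, lie_zero, sub_zero, q.Ly.ef0, ← lie_skew, wy2]; module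

/-- the action of `hy (±1)` on the node x (coefficient b) -/
structure HAct (hy ex fx : ℤ → G) (b : ℂ) : Prop where
  ue : ∀ n, ⁅hy 1, ex n⁆ = (-b) • ex (n + 1)
  uf : ∀ n, ⁅hy 1, fx n⁆ = b • fx (n + 1)
  de : ∀ n, ⁅hy (-1), ex n⁆ = (-b) • ex (n - 1)
  df : ∀ n, ⁅hy (-1), fx n⁆ = b • fx (n - 1)
  ze : ∀ n, ⁅hy 0, ex n⁆ = (-b) • ex n
  zf : ∀ n, ⁅hy 0, fx n⁆ = b • fx n

theorem Loop.ue {es fs hs : ℤ → G} {c : G} (q : Loop es fs hs c) (n) : ⁅hs 1, es n⁆ = (2:ℂ) • es (n+1) := by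
  rw [q.he, add_comm]
theorem Loop.de {es fs hs : ℤ → G} {c : G} (q : Loop es fs hs c) (n) : ⁅hs (-1), es n⁆ = (2:ℂ) • es (n-1) := by
  rw [q.he, neg_add_eq_sub]
theorem Loop.uf {es fs hs : ℤ → G} {c : G} (q : Loop es fs hs c) (n) : ⁅hs 1, fs n⁆ = (-2:ℂ) • fs (n+1) := by
  rw [q.hf, add_comm]
theorem Loop.df {es fs hs : ℤ → G} {c : G} (q : Loop es fs hs c) (n) : ⁅hs (-1), fs n⁆ = (-2:ℂ) • fs (n-1) := by
  rw [q.hf, neg_add_eq_sub]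

theorem PairEq.hact (q : PairEq ex fx hx cx ey fy hy cy b) : HAct hy ex fx b ∧ HAct hx ey fy 1 := by
  have A1 := q.pe1
  have A2 := q.pe2.1
  have D1 := q.swap.pe1
  have D2 := q.swap.pe2.1
  have B2 := q.inv.swap.pe2.1
  have C2 := q.swap.inv.swap.pe2.1
  obtain ⟨D1a, D1b, D1c, D1d⟩ := D1
  norm_num at D1a D1b D1c D1d D2 B2 C2
  have B2 : ⁅hy 1, fx 0⁆ = b • fx 1 := by rw [← lie_skew, B2, neg_neg]
  have C2 : ⁅hy (-1), fx (-1)⁆ = b • fx (-2) := by rw [← lie_skew, C2, neg_neg]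
  have hx1 : hx 1 = ⁅ex 1, fx 0⁆ := (q.Lx.ef0 1).symm
  have hxm : hx (-1) = ⁅ex 0, fx (-1)⁆ := (q.Lx.fe0 (-1)).symm
  have c1 : ⁅hy 1, hx 1⁆ = 0 := by
    rw [hx1, leibniz_lie, A2, B2, lie_smul, smul_lie, q.Lx.ef0, q.Lx.fe1]; norm_num
  have c2 : ⁅hy (-1), hx 1⁆ = b • cx := by
    rw [hx1, leibniz_lie, D1a, D1c, lie_smul, neg_lie, smul_lie, q.Lx.ef0, q.Lx.fe1]; norm_num
  have c3 : ⁅hy 1, hx (-1)⁆ = (-b) • cx := by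
    rw [hxm, leibniz_lie, A1.ye, A1.yf, lie_smul, smul_lie, q.Lx.ef0, q.Lx.fe1]; norm_num
  have c4 : ⁅hy (-1), hx (-1)⁆ = 0 := by
    rw [hxm, leibniz_lie, D2, C2, lie_smul, neg_lie, smul_lie, q.Lx.fe0, q.Lx.ef1]; norm_num
  have c5 : ⁅hy 0, hx 1⁆ = 0 := by
    rw [hx1, leibniz_lie, q.wy.e1, q.wy.f0]; simp
  have c6 : ⁅hy 0, hx (-1)⁆ = 0 := by
    rw [hxm, leibniz_lie, q.wy.e0, q.wy.f1]; simp
  have hy1 : hy 1 = ⁅ey 1, fy 0⁆ := (q.Ly.ef0 1).symm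
  have hym : hy (-1) = ⁅ey 0, fy (-1)⁆ := (q.Ly.fe0 (-1)).symm
  have c7 : ⁅hx 0, hy 1⁆ = 0 := by
    rw [hy1, leibniz_lie, q.wx.e1, q.wx.f0, smul_lie, lie_smul]; module
  have c8 : ⁅hx 0, hy (-1)⁆ = 0 := by
    rw [hym, leibniz_lie, q.wx.e0, q.wx.f1, smul_lie, lie_smul]; module
  have k1 : ∀ x : G, ⁅⁅hy 1, hx 1⁆, x⁆ = 0 := fun x => by rw [c1, zero_lie]
  have k2 : ∀ x : G, ⁅⁅hy (-1), hx 1⁆, x⁆ = 0 := fun x => by rw [c2, smul_lie, q.Lx.cz, smul_zero]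
  have k3 : ∀ x : G, ⁅⁅hy 1, hx (-1)⁆, x⁆ = 0 := fun x => by rw [c3, smul_lie, q.Lx.cz, smul_zero]
  have k4 : ∀ x : G, ⁅⁅hy (-1), hx (-1)⁆, x⁆ = 0 := fun x => by rw [c4, zero_lie]
  have k5 : ∀ x : G, ⁅⁅hy 0, hx 1⁆, x⁆ = 0 := fun x => by rw [c5, zero_lie]
  have k6 : ∀ x : G, ⁅⁅hy 0, hx (-1)⁆, x⁆ = 0 := fun x => by rw [c6, zero_lie]
  have k7 : ∀ x : G, ⁅⁅hx 0, hy 1⁆, x⁆ = 0 := fun x => by rw [c7, zero_lie]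
  have k8 : ∀ x : G, ⁅⁅hx 0, hy (-1)⁆, x⁆ = 0 := fun x => by rw [c8, zero_lie]
  have fl : ∀ {u v : G}, (∀ x : G, ⁅⁅u, v⁆, x⁆ = 0) → ∀ x : G, ⁅⁅v, u⁆, x⁆ = 0 := by
    intro u v h x; rw [← lie_skew v u, neg_lie, h, neg_zero]
  have two : (2:ℂ) ≠ 0 := two_ne_zero
  have two' : (-2:ℂ) ≠ 0 := by norm_num
  refine ⟨⟨?_, ?_, ?_, ?_, ?_, ?_⟩, ⟨?_, ?_, ?_, ?_, ?_, ?_⟩⟩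
  · exact spread two 1 q.Lx.ue q.Lx.de (fl k1) (fl k3) 0 A1.ye
  · exact spread two' 1 q.Lx.uf q.Lx.df (fl k1) (fl k3) (-1) A1.yf
  · refine spread two (-1) q.Lx.ue q.Lx.de (fl k2) (fl k4) 1 ?_
    rw [D1a]; simp
  · refine spread two' (-1) q.Lx.uf q.Lx.df (fl k2) (fl k4) 0 ?_
    rw [D1c]; simp
  · have := spread two 0 q.Lx.ue q.Lx.de (fl k5) (fl k6) 0 (k := -b) q.wy.e0
    simpa using this
  · have := spread two' 0 q.Lx.uf q.Lx.df (fl k5) (fl k6) 0 (k := b) q.wy.f0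
    simpa using this
  · exact spread two 1 q.Ly.ue q.Ly.de k1 k2 0 A1.xe
  · exact spread two' 1 q.Ly.uf q.Ly.df k1 k2 (-1) A1.xf
  · refine spread two (-1) q.Ly.ue q.Ly.de k3 k4 1 ?_
    rw [D1b]; simp
  · refine spread two' (-1) q.Ly.uf q.Ly.df k3 k4 0 ?_
    rw [D1d]; simp
  · have := spread two 0 q.Ly.ue q.Ly.de (fl k7) (fl k8) 0 (k := -1) q.wx.e0
    simpa using this
  · have := spread two' 0 q.Ly.uf q.Ly.df (fl k7) (fl k8) 0 (k := 1) q.wx.f0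
    simpa using this

theorem PairEq.half (q : PairEq ex fx hx cx ey fy hy cy b) (hb : b ≠ 4) :
    (∀ m n, ⁅ex m, fy n⁆ = 0) ∧ (∀ m n, ⁅ey m, fx n⁆ = 0) ∧
    (∀ m n, ⁅hx m, ey n⁆ ∈ Submodule.span ℂ (Set.range ey)) ∧
    (∀ m n, ⁅hy m, ex n⁆ ∈ Submodule.span ℂ (Set.range ex)) := by
  obtain ⟨hY, hX⟩ := q.hact
  have hb1 : b - 4 ≠ 0 := sub_ne_zero.2 hb
  have p1 : ∀ m n, ⁅ex m, fy n⁆ = 0 := by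
    refine grid (q := fun m n => ⁅ex m, fy n⁆) (U := hx 1) (U' := hy 1) (D := hx (-1)) (D' := hy (-1)) (p := 2) (t := 1) (r := -b) (s := -2)
      (by convert hb1 using 1; ring) ?_ ?_ ?_ ?_ q.cm.a00 <;> intro m n
    · rw [leibniz_lie, q.Lx.ue, hX.uf, smul_lie, lie_smul]
    · rw [leibniz_lie, q.Ly.uf, hY.ue, smul_lie, lie_smul]
    · rw [leibniz_lie, q.Lx.de, hX.df, smul_lie, lie_smul]
    · rw [leibniz_lie, q.Ly.df, hY.de, smul_lie, lie_smul]
  have p2 : ∀ m n, ⁅ey m, fx n⁆ = 0 := by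
    refine grid (q := fun m n => ⁅ey m, fx n⁆) (U := hy 1) (U' := hx 1) (D := hy (-1)) (D' := hx (-1)) (p := 2) (t := b) (r := -1) (s := -2)
      (by convert hb1 using 1; ring) ?_ ?_ ?_ ?_ q.cm.b00 <;> intro m n
    · rw [leibniz_lie, q.Ly.ue, hY.uf, smul_lie, lie_smul]
    · rw [leibniz_lie, q.Lx.uf, hX.ue, smul_lie, lie_smul]
    · rw [leibniz_lie, q.Ly.de, hY.df, smul_lie, lie_smul]
    · rw [leibniz_lie, q.Lx.df, hX.de, smul_lie, lie_smul]
  have p3 : ∀ m n, ⁅ey (m+1), ex n⁆ - ⁅ey m, ex (n+1)⁆ = 0 := by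
    refine grid (q := fun m n => ⁅ey (m+1), ex n⁆ - ⁅ey m, ex (n+1)⁆) (U := hy 1) (U' := hx 1) (D := hy (-1)) (D' := hx (-1)) (p := 2) (t := -b) (r := -1) (s := 2)
      (by convert neg_ne_zero.2 hb1 using 1; ring) ?_ ?_ ?_ ?_ ?_ 
    · intro m n
      rw [lie_sub, leibniz_lie, leibniz_lie (hy 1) (ey m), q.Ly.ue, hY.ue, q.Ly.ue, hY.ue]
      simp only [smul_lie, lie_smul, smul_sub]; module
    · intro m n
      rw [lie_sub, leibniz_lie, leibniz_lie (hx 1) (ey m), q.Lx.ue, hX.ue, q.Lx.ue, hX.ue]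
      simp only [smul_lie, lie_smul, smul_sub]; module
    · intro m n
      rw [lie_sub, leibniz_lie, leibniz_lie (hy (-1)) (ey m), q.Ly.de, hY.de, q.Ly.de, hY.de]
      simp only [smul_lie, lie_smul, smul_sub, sub_add_cancel, add_sub_cancel_right]; module
    · intro m n
      rw [lie_sub, leibniz_lie, leibniz_lie (hx (-1)) (ey m), q.Lx.de, hX.de, q.Lx.de, hX.de]
      simp only [smul_lie, lie_smul, smul_sub, sub_add_cancel, add_sub_cancel_right]; module
    · simpa [sub_eq_zero] using q.sr6
  have p4 : ∀ m n, ⁅ey m, ex n⁆ = ⁅ey 0, ex (m + n)⁆ := by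
    intro m
    induction m using Int.induction_on with
    | zero => intro n; rw [zero_add]
    | succ k ih => intro n; rw [sub_eq_zero.1 (p3 k n), ih]; congr 2; ring
    | pred k ih =>
      intro n
      have := sub_eq_zero.1 (p3 (-k-1) (n-1))
      rw [sub_add_cancel, sub_add_cancel] at this
      rw [← this, ih]; congr 2; ring
  refine ⟨p1, p2, ?_, ?_⟩
  · intro m n
    have : ⁅hx m, ey n⁆ = (-1:ℂ) • ey (m + n) := by
      rw [← q.Lx.ef0, lie_lie, sk0 (p2 n 0), lie_zero, zero_sub, ← lie_skew (ex m), p4, lie_neg, neg_neg]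
      have := p4 (m+n) 0
      rw [add_zero, add_comm] at this
      rw [← this, leibniz_lie, sk0 (p2 _ 0), zero_lie, zero_add, ← lie_skew _ (ex 0), q.Lx.ef0, ← lie_skew, neg_lie, neg_neg,
        hX.ze, add_comm]
    rw [this]
    exact Submodule.smul_mem _ _ (Submodule.subset_span ⟨_, rfl⟩)
  · intro m n
    have : ⁅hy m, ex n⁆ = (-b) • ex (m + n) := by
      rw [← q.Ly.ef0, lie_lie, sk0 (p1 n 0), lie_zero, zero_sub, p4, leibniz_lie, sk0 (p1 _ 0), lie_zero, add_zero,
       ← lie_skew _ (ey 0), q.Ly.ef0, neg_lie, neg_neg, hY.ze]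
    rw [this]
    exact Submodule.smul_mem _ _ (Submodule.subset_span ⟨_, rfl⟩)

theorem PairEq.ok (q : PairEq ex fx hx cx ey fy hy cy b) (hb : b ≠ 4) : PairOK ex fx hx ey fy hy := by
  obtain ⟨a1, a2, a3, a4⟩ := q.half hb
  obtain ⟨b1, b2, b3, b4⟩ := q.inv.half hb
  have rg : ∀ f : ℤ → G, Set.range (fun n => f (-n)) = Set.range f := fun f => 
    (Equiv.neg ℤ).surjective.range_comp f
  refine ⟨a1, a2, a3, ?_, a4, ?_⟩
  · intro m n
    have := b3 (-m) (-n)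
    simp only [neg_neg, neg_lie, Submodule.neg_mem_iff, rg] at this
    exact this
  · intro m n
    have := b4 (-m) (-n)
    simp only [neg_neg, neg_lie, Submodule.neg_mem_iff, rg] at this
    exact this

end PairE
end Ell

namespace Ell
set_option linter.unusedSectionVars false
set_option linter.unusedSimpArgs false

section PairO
variable {G : Type*} [LieRing G] [LieAlgebra ℂ G]
variable {ex fx hx : ℤ → G} {cx : G} {ey fy hy : ℤ → G} {cy : G}

theorem Loop.commAll (L : Loop ex fx hx cx) {z : G} (e0 : ⁅z, ex 0⁆ = 0) (e1 : ⁅z, ex 1⁆ = 0)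
    (f0 : ⁅z, fx 0⁆ = 0) (f1 : ⁅z, fx (-1)⁆ = 0) :
    (∀ n, ⁅z, ex n⁆ = 0) ∧ (∀ n, ⁅z, fx n⁆ = 0) ∧ (∀ n, ⁅z, hx n⁆ = 0) := by
  have hx1 : hx 1 = ⁅ex 1, fx 0⁆ := (L.ef0 1).symm
  have hxm : hx (-1) = ⁅ex 0, fx (-1)⁆ := (L.fe0 (-1)).symm
  have c1 : ⁅hx 1, z⁆ = 0 := by
    apply sk0; rw [hx1, leibniz_lie, e1, f0, zero_lie, lie_zero, zero_add]
  have c2 : ⁅hx (-1), z⁆ = 0 := by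
    apply sk0; rw [hxm, leibniz_lie, e0, f1, zero_lie, lie_zero, zero_add]
  have two : (2:ℂ) ≠ 0 := two_ne_zero
  have two' : (-2:ℂ) ≠ 0 := by norm_num
  have a := spread two 0 L.ue L.de (T := z) (k := 0) (by simp [c1]) (by simp [c2]) 0 (by rw [e0, zero_smul])
  have b := spread two' 0 L.uf L.df (T := z) (k := 0) (by simp [c1]) (by simp [c2]) 0 (by rw [f0, zero_smul])
  simp only [zero_smul] at a b
  refine ⟨a, b, fun n => ?_⟩
  rw [← L.ef0, leibniz_lie, a, b, zero_lie, lie_zero, zero_add]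

theorem PairOr.ok (Lx : Loop ex fx hx cx) (Ly : Loop ey fy hy cy) (cm : Comm ex fx ey fy)
    (a00 : ⁅ex 0, ey 0⁆ = 0) (a01 : ⁅ex 0, ey 1⁆ = 0) (a10 : ⁅ex 1, ey 0⁆ = 0) (a11 : ⁅ex 1, ey 1⁆ = 0)
    (b00 : ⁅fx 0, fy 0⁆ = 0) (b01 : ⁅fx 0, fy (-1)⁆ = 0) (b10 : ⁅fx (-1), fy 0⁆ = 0)
    (b11 : ⁅fx (-1), fy (-1)⁆ = 0) : PairOK ex fx hx ey fy hy := by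
  obtain ⟨p1, p2, p3⟩ := Lx.commAll (sk0 a00) (sk0 a10) cm.b00 cm.b01
  obtain ⟨q1, q2, q3⟩ := Lx.commAll (sk0 a01) (sk0 a11) cm.b10 cm.b11
  obtain ⟨r1, r2, r3⟩ := Lx.commAll (sk0 cm.a00) (sk0 cm.a10) (sk0 b00) (sk0 b10)
  obtain ⟨s1, s2, s3⟩ := Lx.commAll (sk0 cm.a01) (sk0 cm.a11) (sk0 b01) (sk0 b11)
  have X := fun n => Ly.commAll (sk0 (p1 n)) (sk0 (q1 n)) (sk0 (r1 n)) (sk0 (s1 n))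
  have Y := fun n => Ly.commAll (sk0 (p2 n)) (sk0 (q2 n)) (sk0 (r2 n)) (sk0 (s2 n))
  have Z := fun n => Ly.commAll (sk0 (p3 n)) (sk0 (q3 n)) (sk0 (r3 n)) (sk0 (s3 n))
  refine ⟨fun m n => (X m).2.1 n, fun m n => sk0 ((Y n).1 m), fun m n => ?_, fun m n => ?_,
    fun m n => ?_, fun m n => ?_⟩
  · rw [(Z m).1 n]; exact zero_mem _
  · rw [(Z m).2.1 n]; exact zero_mem _
  · rw [sk0 ((X n).2.2 m)]; exact zero_mem _
  · rw [sk0 ((Y n).2.2 m)]; exact zero_mem _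

/-- special edge, first version -/
structure PairSp0 (ex fx hx : ℤ → G) (cx : G) (ey fy hy : ℤ → G) (cy : G) : Prop where
  Lx : Loop ex fx hx cx
  Ly : Loop ey fy hy cy
  cm : Comm ex fx ey fy
  wx : Wts (hx 0) ey fy 1
  wy : Wts (hy 0) ex fx 2
  sr6 : ⁅ey 1, ⁅ey 1, ex 0⁆⁆ = ⁅ey 0, ⁅ey 0, ex 1⁆⁆
  sr7 : ⁅fy (-1), ⁅fy (-1), fx 0⁆⁆ = ⁅fy 0, ⁅fy 0, fx (-1)⁆⁆
  sr8 : ⁅ey 0, ⁅ey 1, ex 0⁆⁆ = 0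
  sr9 : ⁅fy 0, ⁅fy (-1), fx 0⁆⁆ = 0
  ln : LN4 ey fy
  t1 : ⁅ey 1, ⁅ey 1, ⁅ey 1, ex 0⁆⁆⁆ = 0
  t2 : ⁅fy (-1), ⁅fy (-1), ⁅fy (-1), fx 0⁆⁆⁆ = 0

theorem PairSp0.inv (q : PairSp0 ex fx hx cx ey fy hy cy) :
    PairSp0 (fun n => fx (-n)) (fun n => ex (-n)) (fun n => - hx (-n)) (-cx)
      (fun n => fy (-n)) (fun n => ey (-n)) (fun n => - hy (-n)) (-cy) where
  Lx := q.Lx.inv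
  Ly := q.Ly.inv
  cm := q.cm.inv
  wx := by simpa using q.wx.inv
  wy := by simpa using q.wy.inv
  sr6 := q.sr7
  sr7 := q.sr6
  sr8 := q.sr9
  sr9 := q.sr8
  ln := q.ln.inv
  t1 := q.t2
  t2 := q.t1

theorem PairSp0.hyex0 (q : PairSp0 ex fx hx cx ey fy hy cy) : ⁅hy 1, ex 0⁆ = 0 := by
  have w : ⁅hy 0, ⁅ey 1, ex 0⁆⁆ = 0 := by
    rw [leibniz_lie, q.Ly.he, q.wy.e0, zero_add, smul_lie, lie_smul]; module
  have := q.Ly.sl2_0.high0 q.ln.f0 w q.sr8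
  rw [leibniz_lie, sk0 q.cm.a00, lie_zero, add_zero, ← lie_skew (fy 0), q.Ly.ef0, neg_lie] at this
  exact neg_eq_zero.1 this

theorem PairSp0.hymex0 (q : PairSp0 ex fx hx cx ey fy hy cy) : ⁅hy (-1), ex 0⁆ = 0 := by
  have w : ⁅hy 0 + cy, ⁅ey 0, ex 0⁆⁆ = 0 := by
    rw [add_lie, q.Ly.cz, leibniz_lie, q.Ly.he, q.wy.e0, zero_add, smul_lie, lie_smul]; module
  have := q.Ly.sl2_1.high0 q.ln.f1 w (by
    rw [leibniz_lie, q.Ly.ee, zero_lie, zero_add, q.sr8])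
  rw [leibniz_lie, sk0 q.cm.a01, lie_zero, add_zero, ← lie_skew (fy (-1)), q.Ly.fe0, neg_lie] at this
  exact neg_eq_zero.1 this

theorem PairSp0.star (q : PairSp0 ex fx hx cx ey fy hy cy) : ⁅ey 0, ex 1⁆ = - ⁅ey 2, ex 0⁆ := by
  have h : ⁅fy 0, ⁅ey 1, ⁅ey 1, ex 0⁆⁆⁆ = ⁅fy 0, ⁅ey 0, ⁅ey 0, ex 1⁆⁆⁆ := by rw [q.sr6]
  have a1 : ⁅fy 0, ey 1⁆ = - hy 1 := by rw [← lie_skew, q.Ly.ef0]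
  have a0 : ⁅fy 0, ey 0⁆ = - hy 0 := by rw [← lie_skew, q.Ly.ef0]
  rw [leibniz_lie (fy 0) (ey 1), leibniz_lie (fy 0) (ey 1) (ex 0), sk0 q.cm.a00, a1, neg_lie, leibniz_lie (hy 1), q.Ly.he, neg_lie,
    q.hyex0, leibniz_lie (fy 0) (ey 0), leibniz_lie (fy 0) (ey 0), sk0 q.cm.a10, a0, neg_lie, leibniz_lie (hy 0),
    q.Ly.he, neg_lie, q.wy.e1] at h
  simp only [smul_lie, lie_smul, lie_zero, lie_neg, neg_zero, add_zero] at h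
  norm_num at h
  linear_combination (norm := module) (-1/2:ℂ) • h

theorem PairSp0.q0 (q : PairSp0 ex fx hx cx ey fy hy cy) : ⁅ey 1, ⁅ey 0, ex 1⁆⁆ = 0 := by
  have h : ⁅hy 1, ⁅ey 1, ⁅ey 1, ex 0⁆⁆⁆ = ⁅hy 1, ⁅ey 0, ⁅ey 0, ex 1⁆⁆⁆ := by rw [q.sr6]
  have e2 : ⁅ey 2, ⁅ey 1, ex 0⁆⁆ = ⁅ey 1, ⁅ey 2, ex 0⁆⁆ := by
    rw [leibniz_lie, q.Ly.ee, zero_lie, zero_add]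
  have e0 : ⁅ey 0, ⁅ey 1, ex 1⁆⁆ = ⁅ey 1, ⁅ey 0, ex 1⁆⁆ := by
    rw [leibniz_lie, q.Ly.ee, zero_lie, zero_add]
  have q3 : ⁅ey 0, ⁅ey 1, ⁅ey 0, ex 1⁆⁆⁆ = 0 := by
    rw [leibniz_lie, q.Ly.ee, zero_lie, zero_add, ← q.sr6, q.t1]
  have s2 : ⁅ey 2, ex 0⁆ = - ⁅ey 0, ex 1⁆ := by rw [q.star, neg_neg]
  have w0 : ⁅hy 1, ex 1⁆ = - ⁅fy 0, ⁅ey 1, ex 1⁆⁆ := by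
    rw [leibniz_lie, sk0 q.cm.a10, lie_zero, add_zero, ← lie_skew (fy 0), q.Ly.ef0, neg_lie, neg_neg]
  have w1 : ⁅hy 0, ⁅ey 1, ex 1⁆⁆ = 0 := by
    rw [leibniz_lie, q.Ly.he, q.wy.e1, zero_add, smul_lie, lie_smul]; module
  have w2 : ⁅ey 0, ⁅ey 0, ⁅hy 1, ex 1⁆⁆⁆ = (-2:ℂ) • ⁅ey 1, ⁅ey 0, ex 1⁆⁆ := by
    rw [w0, lie_neg, leibniz_lie (ey 0) (fy 0), q.Ly.ef0, w1, zero_add, e0, lie_neg, leibniz_lie (ey 0) (fy 0), q3,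
      lie_zero, add_zero, q.Ly.ef0, leibniz_lie, q.Ly.he, leibniz_lie (hy 0), q.Ly.he, q.wy.e1]
    simp only [smul_lie, lie_smul, lie_add, zero_add]; module
  rw [leibniz_lie (hy 1) (ey 1), leibniz_lie (hy 1) (ey 1), q.hyex0, leibniz_lie (hy 1) (ey 0), leibniz_lie (hy 1) (ey 0)] at h
  simp only [q.Ly.he, smul_lie, lie_smul, lie_add, lie_zero, add_zero] at h
  norm_num at h
  rw [e2, e0, w2, s2, lie_neg] at h
  linear_combination (norm := module) (-1/6:ℂ) • h

/-- special edge, symmetric version -/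
structure PairSp (ex fx hx : ℤ → G) (cx : G) (ey fy hy : ℤ → G) (cy : G) : Prop where
  Lx : Loop ex fx hx cx
  Ly : Loop ey fy hy cy
  cm : Comm ex fx ey fy
  wx : Wts (hx 0) ey fy 1
  wy : Wts (hy 0) ex fx 2
  st1 : ⁅ey 0, ex 1⁆ = - ⁅ey 2, ex 0⁆
  st2 : ⁅fy 0, fx (-1)⁆ = - ⁅fy (-2), fx 0⁆
  u1 : ⁅hy 1, ex 0⁆ = 0
  u2 : ⁅hy (-1), ex 0⁆ = 0
  u3 : ⁅hy 1, ex 1⁆ = 0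
  u4 : ⁅hy (-1), ex 1⁆ = 0
  v1 : ⁅hy 1, fx 0⁆ = 0
  v2 : ⁅hy (-1), fx 0⁆ = 0
  v3 : ⁅hy 1, fx (-1)⁆ = 0
  v4 : ⁅hy (-1), fx (-1)⁆ = 0

theorem PairSp0.u34 (q : PairSp0 ex fx hx cx ey fy hy cy) : ⁅hy 1, ex 1⁆ = 0 ∧ ⁅hy (-1), ex 1⁆ = 0 := by
  constructor
  · have w : ⁅hy 0, ⁅ey 1, ex 1⁆⁆ = 0 := by
      rw [leibniz_lie, q.Ly.he, q.wy.e1, zero_add, smul_lie, lie_smul]; module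
    have := q.Ly.sl2_0.high0 q.ln.f0 w (by rw [leibniz_lie, q.Ly.ee, zero_lie, zero_add, q.q0])
    rw [leibniz_lie, sk0 q.cm.a10, lie_zero, add_zero, ← lie_skew (fy 0), q.Ly.ef0, neg_lie] at this
    exact neg_eq_zero.1 this
  · have w : ⁅hy 0 + cy, ⁅ey 0, ex 1⁆⁆ = 0 := by
      rw [add_lie, q.Ly.cz, leibniz_lie, q.Ly.he, q.wy.e1, zero_add, smul_lie, lie_smul]; module
    have := q.Ly.sl2_1.high0 q.ln.f1 w q.q0
    rw [leibniz_lie, sk0 q.cm.a11, lie_zero, add_zero, ← lie_skew (fy (-1)), q.Ly.fe0, neg_lie] at this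
    exact neg_eq_zero.1 this

theorem PairSp0.sp (q : PairSp0 ex fx hx cx ey fy hy cy) : PairSp ex fx hx cx ey fy hy cy where
  Lx := q.Lx
  Ly := q.Ly
  cm := q.cm
  wx := q.wx
  wy := q.wy
  st1 := q.star
  st2 := q.inv.star
  u1 := q.hyex0
  u2 := q.hymex0
  u3 := q.u34.1
  u4 := q.u34.2
  v1 := by simpa using sk0 q.inv.hymex0
  v2 := by simpa using sk0 q.inv.hyex0
  v3 := by simpa using sk0 q.inv.u34.2
  v4 := by simpa using sk0 q.inv.u34.1

theorem PairSp.inv (q : PairSp ex fx hx cx ey fy hy cy) :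
    PairSp (fun n => fx (-n)) (fun n => ex (-n)) (fun n => - hx (-n)) (-cx)
      (fun n => fy (-n)) (fun n => ey (-n)) (fun n => - hy (-n)) (-cy) where
  Lx := q.Lx.inv
  Ly := q.Ly.inv
  cm := q.cm.inv
  wx := by simpa using q.wx.inv
  wy := by simpa using q.wy.inv
  st1 := q.st2
  st2 := q.st1
  u1 := by simpa using sk0 q.v2
  u2 := by simpa using sk0 q.v1
  u3 := by simpa using sk0 q.v4
  u4 := by simpa using sk0 q.v3
  v1 := by simpa using sk0 q.u2
  v2 := by simpa using sk0 q.u1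
  v3 := by simpa using sk0 q.u4
  v4 := by simpa using sk0 q.u3

theorem PairSp.hyall (q : PairSp ex fx hx cx ey fy hy cy) :
    ((∀ n, ⁅hy 1, ex n⁆ = 0) ∧ (∀ n, ⁅hy 1, fx n⁆ = 0) ∧ (∀ n, ⁅hy 1, hx n⁆ = 0)) ∧
    ((∀ n, ⁅hy (-1), ex n⁆ = 0) ∧ (∀ n, ⁅hy (-1), fx n⁆ = 0) ∧ (∀ n, ⁅hy (-1), hx n⁆ = 0)) :=
  ⟨q.Lx.commAll q.u1 q.u3 q.v1 q.v3, q.Lx.commAll q.u2 q.u4 q.v2 q.v4⟩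

theorem PairSp.fe (q : PairSp ex fx hx cx ey fy hy cy) (n : ℤ) : ⁅fx 0, ey n⁆ = 0 := by
  have := spread (X := ey) (U := hy 1) (D := hy (-1)) (T := fx 0) (k := 0) two_ne_zero 0 q.Ly.ue q.Ly.de
    (by rw [q.v1]; simp) (by rw [q.v2]; simp) 0 (by rw [sk0 q.cm.b00, zero_smul]) n
  rw [this, zero_smul]

theorem PairSp.ze (q : PairSp ex fx hx cx ey fy hy cy) (n : ℤ) : ⁅hx 0, ey n⁆ = (-1:ℂ) • ey n := by
  have := spread (X := ey) (U := hy 1) (D := hy (-1)) (T := hx 0) (k := -1) two_ne_zero 0 q.Ly.ue q.Ly.de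
    (by rw [q.hyall.1.2.2]; simp) (by rw [q.hyall.2.2.2]; simp) 0 q.wx.e0 n
  rwa [add_zero] at this

theorem PairSp.zye (q : PairSp ex fx hx cx ey fy hy cy) (n : ℤ) : ⁅hy 0, ex n⁆ = (-2:ℂ) • ex n := by
  have h1 : ⁅hx 1, hy 0⁆ = 0 := by
    have : hx 1 = ⁅ex 1, fx 0⁆ := (q.Lx.ef0 1).symm
    apply sk0; rw [this, leibniz_lie, q.wy.e1, q.wy.f0, smul_lie, lie_smul]; module
  have h2 : ⁅hx (-1), hy 0⁆ = 0 := by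
    have : hx (-1) = ⁅ex 0, fx (-1)⁆ := (q.Lx.fe0 (-1)).symm
    apply sk0; rw [this, leibniz_lie, q.wy.e0, q.wy.f1, smul_lie, lie_smul]; module
  have := spread (X := ex) (U := hx 1) (D := hx (-1)) (T := hy 0) (k := -2) two_ne_zero 0 q.Lx.ue q.Lx.de
    (by rw [h1]; simp) (by rw [h2]; simp) 0 q.wy.e0 n
  rwa [add_zero] at this

theorem PairSp.fe1 (q : PairSp ex fx hx cx ey fy hy cy) (n : ℤ) : ⁅fx (-1), ey n⁆ = 0 := by
  have := spread (X := ey) (U := hy 1) (D := hy (-1)) (T := fx (-1)) (k := 0) two_ne_zero 0 q.Ly.ue q.Ly.de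
    (by rw [q.v3]; simp) (by rw [q.v4]; simp) 0 (by rw [sk0 q.cm.b01, zero_smul]) n
  rw [this, zero_smul]

theorem PairSp.sh (q : PairSp ex fx hx cx ey fy hy cy) :
    (∀ n, ⁅hx 1, ey n⁆ = (1:ℂ) • ey (n + 2)) ∧ (∀ n, ⁅hx (-1), ey n⁆ = (1:ℂ) • ey (n - 2)) := by
  have s1 : ⁅ex 1, ey 0⁆ = - ⁅ex 0, ey 2⁆ := by
    rw [← lie_skew, q.st1, ← lie_skew (ex 0)]
  have s2 : ⁅ex 0, ey 2⁆ = - ⁅ex 1, ey 0⁆ := by rw [s1, neg_neg]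
  constructor
  · refine spread (X := ey) (U := hy 1) (D := hy (-1)) (T := hx 1) two_ne_zero 2 q.Ly.ue q.Ly.de
      (by rw [q.hyall.1.2.2]; simp) (by rw [q.hyall.2.2.2]; simp) 0 ?_
    rw [← q.Lx.ef0 1, lie_lie, q.fe, lie_zero, zero_sub, s1, lie_neg, leibniz_lie, q.fe, lie_zero, ← lie_skew (fx 0), q.Lx.ef0,
      neg_lie, q.ze, zero_add]; module
  · refine spread (X := ey) (U := hy 1) (D := hy (-1)) (T := hx (-1)) two_ne_zero (-2) q.Ly.ue q.Ly.de
      (by rw [q.hyall.1.2.2]; simp) (by rw [q.hyall.2.2.2]; simp) 2 ?_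
    rw [← q.Lx.fe0 (-1), lie_lie, q.fe1, lie_zero, zero_sub, s2, lie_neg, leibniz_lie, q.fe1, lie_zero, ← lie_skew (fx (-1)), q.Lx.ef1,
      neg_lie, add_lie, sub_self, q.ze, if_pos rfl, q.Lx.cz]
    norm_num

theorem PairSp.half (q : PairSp ex fx hx cx ey fy hy cy) :
    (∀ m n, ⁅ex m, fy n⁆ = 0) ∧ (∀ m n, ⁅ey m, fx n⁆ = 0) ∧
    (∀ m n, ⁅hx m, ey n⁆ ∈ Submodule.span ℂ (Set.range ey)) ∧
    (∀ m n, ⁅hy m, ex n⁆ ∈ Submodule.span ℂ (Set.range ex)) := by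
  obtain ⟨Su, Sd⟩ := q.sh
  obtain ⟨⟨e1, f1, -⟩, ⟨e2, f2, -⟩⟩ := q.hyall
  have Tu : ∀ n, ⁅hx 1, fy n⁆ = (-1:ℂ) • fy (n + 2) := by
    intro n
    have := q.inv.sh.2 (-n)
    simp only [neg_neg, neg_lie] at this
    rw [neg_eq_iff_eq_neg] at this
    rw [this, show -(-n-2) = n + 2 by ring]; module
  have Td : ∀ n, ⁅hx (-1), fy n⁆ = (-1:ℂ) • fy (n - 2) := by
    intro n
    have := q.inv.sh.1 (-n)
    simp only [neg_neg, neg_lie] at this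
    rw [neg_eq_iff_eq_neg] at this
    rw [this, show -(-n+2) = n - 2 by ring]; module
  have p1 : ∀ m n, ⁅ex m, fy n⁆ = 0 := by
    refine grid2 (q := fun m n => ⁅ex m, fy n⁆) (U := hx 1) (U' := hy 1) (D := hx (-1)) (D' := hy (-1)) (p := 2) (t := -1) (s := -2)
      two_ne_zero (by norm_num) ?_ ?_ ?_ ?_ q.cm.a00 <;> intro m n
    · rw [leibniz_lie, q.Lx.ue, Tu, smul_lie, lie_smul]
    · rw [leibniz_lie, q.Ly.uf, e1, zero_lie, lie_smul, zero_add]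
    · rw [leibniz_lie, q.Lx.de, Td, smul_lie, lie_smul]
    · rw [leibniz_lie, q.Ly.df, e2, zero_lie, lie_smul, zero_add]
  have p2 : ∀ m n, ⁅fx m, ey n⁆ = 0 := by
    refine grid2 (q := fun m n => ⁅fx m, ey n⁆) (U := hx 1) (U' := hy 1) (D := hx (-1)) (D' := hy (-1)) (p := -2) (t := 1) (s := 2)
      (by norm_num) two_ne_zero ?_ ?_ ?_ ?_ (sk0 q.cm.b00) <;> intro m n
    · rw [leibniz_lie, q.Lx.uf, Su, smul_lie, lie_smul]
    · rw [leibniz_lie, q.Ly.ue, f1, zero_lie, lie_smul, zero_add]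
    · rw [leibniz_lie, q.Lx.df, Sd, smul_lie, lie_smul]
    · rw [leibniz_lie, q.Ly.de, f2, zero_lie, lie_smul, zero_add]
  have p3 : ∀ m n, ⁅ex (m+1), ey n⁆ + ⁅ex m, ey (n+2)⁆ = 0 := by
    refine grid2 (q := fun m n => ⁅ex (m+1), ey n⁆ + ⁅ex m, ey (n+2)⁆) (U := hx 1) (U' := hy 1) (D := hx (-1)) (D' := hy (-1)) (p := 2) (t := 1) (s := 2)
      two_ne_zero two_ne_zero ?_ ?_ ?_ ?_ ?_
    · intro m n
      rw [lie_add, leibniz_lie, leibniz_lie (hx 1) (ex m)]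
      simp only [q.Lx.ue, Su, smul_lie, lie_smul]; module
    · intro m n
      rw [lie_add, leibniz_lie, leibniz_lie (hy 1) (ex m)]
      simp only [q.Ly.ue, e1, smul_lie, lie_smul, zero_lie]
      rw [show n + 2 + 1 = n + 1 + 2 by ring]; module
    · intro m n
      rw [lie_add, leibniz_lie, leibniz_lie (hx (-1)) (ex m)]
      simp only [q.Lx.de, Sd, smul_lie, lie_smul, sub_add_cancel, add_sub_cancel_right]; module
    · intro m n
      rw [lie_add, leibniz_lie, leibniz_lie (hy (-1)) (ex m)]
      simp only [q.Ly.de, e2, smul_lie, lie_smul, zero_lie]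
      rw [show n + 2 - 1 = n - 1 + 2 by ring]; module
    · have := q.st1
      rw [← lie_skew, ← lie_skew (ey 2), neg_neg, neg_eq_iff_eq_neg] at this
      simp only [zero_add, this, neg_add_cancel]
  refine ⟨p1, fun m n => sk0 (p2 n m), ?_, ?_⟩
  · have key : ∀ m n, ⁅fx 0, ⁅ex m, ey n⁆⁆ ∈ Submodule.span ℂ (Set.range ey) := by
      intro m
      induction m using Int.induction_on with
      | zero =>
        intro n
        rw [leibniz_lie, p2, lie_zero, add_zero, ← lie_skew (fx 0), q.Lx.ef0, neg_lie, q.ze, Submodule.neg_mem_iff]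
        exact Submodule.smul_mem _ _ (Submodule.subset_span ⟨_, rfl⟩)
      | succ k ih =>
        intro n
        rw [eq_neg_of_add_eq_zero_left (p3 k n), lie_neg, Submodule.neg_mem_iff]; exact ih _
      | pred k ih =>
        intro n
        have := eq_neg_of_add_eq_zero_right (p3 (-k-1) (n-2))
        rw [sub_add_cancel, sub_add_cancel] at this
        rw [this, lie_neg, Submodule.neg_mem_iff]; exact ih _
    intro m n
    rw [← q.Lx.ef0, lie_lie, p2, lie_zero, zero_sub, Submodule.neg_mem_iff]
    exact key m n
  · have k0 : ∀ n, ⁅fy 0, ⁅ex n, ey 0⁆⁆ ∈ Submodule.span ℂ (Set.range ex) := by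
      intro n
      rw [leibniz_lie, sk0 (p1 _ _), zero_lie, zero_add, ← lie_skew (fy 0), q.Ly.ef0, ← lie_skew, neg_lie, neg_neg, q.zye]
      exact Submodule.smul_mem _ _ (Submodule.subset_span ⟨_, rfl⟩)
    have k1 : ∀ n, ⁅fy 0, ⁅ex n, ey 1⁆⁆ ∈ Submodule.span ℂ (Set.range ex) := by
      intro n
      rw [leibniz_lie, sk0 (p1 _ _), zero_lie, zero_add, ← lie_skew (fy 0), q.Ly.ef0, ← lie_skew, neg_lie, neg_neg, e1]
      exact zero_mem _
    have key : ∀ m, (∀ n, ⁅fy 0, ⁅ex n, ey m⁆⁆ ∈ Submodule.span ℂ (Set.range ex)) ∧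
        (∀ n, ⁅fy 0, ⁅ex n, ey (m+1)⁆⁆ ∈ Submodule.span ℂ (Set.range ex)) := by
      intro m
      induction m using Int.induction_on with
      | zero => exact ⟨k0, k1⟩
      | succ k ih =>
        refine ⟨ih.2, fun n => ?_⟩
        rw [show (k:ℤ) + 1 + 1 = k + 2 by ring, eq_neg_of_add_eq_zero_right (p3 n k), lie_neg, Submodule.neg_mem_iff]; exact ih.1 _
      | pred k ih =>
        rw [sub_add_cancel]
        refine ⟨fun n => ?_, ih.1⟩
        have := eq_neg_of_add_eq_zero_left (p3 (n-1) (-k-1))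
        rw [sub_add_cancel] at this
        rw [this, lie_neg, Submodule.neg_mem_iff, show -(k:ℤ)-1+2 = -k+1 by ring]; exact ih.2 _
    intro m n
    rw [← q.Ly.ef0, lie_lie, sk0 (p1 _ _), lie_zero, zero_sub, ← lie_skew (ey m), lie_neg, neg_neg]
    exact (key m).1 n

theorem PairSp.ok (q : PairSp ex fx hx cx ey fy hy cy) : PairOK ex fx hx ey fy hy := by
  obtain ⟨a1, a2, a3, a4⟩ := q.half
  obtain ⟨b1, b2, b3, b4⟩ := q.inv.half
  have rg : ∀ f : ℤ → G, Set.range (fun n => f (-n)) = Set.range f := fun f => 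
    (Equiv.neg ℤ).surjective.range_comp f
  refine ⟨a1, a2, a3, ?_, a4, ?_⟩
  · intro m n
    have := b3 (-m) (-n)
    simp only [neg_neg, neg_lie, Submodule.neg_mem_iff, rg] at this
    exact this
  · intro m n
    have := b4 (-m) (-n)
    simp only [neg_neg, neg_lie, Submodule.neg_mem_iff, rg] at this
    exact this

theorem PairOK.symm (q : PairOK ex fx hx ey fy hy) : PairOK ey fy hy ex fx hx :=
  ⟨q.fe, q.ef, q.hye, q.hyf, q.hxe, q.hxf⟩

end PairO
end Ell

namespace Ell
set_option linter.unusedSectionVars false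
set_option linter.unusedSimpArgs false

section TriS
variable {G : Type*} [LieRing G] [LieAlgebra ℂ G]
variable {I : Type*} [DecidableEq I]

theorem iSupIndep_extract {D : Type*} {gr A : D → Submodule ℂ G} (ind : iSupIndep gr)
    (hA : ∀ d, A d ≤ gr d) (ht : ⨆ d, A d = ⊤) (d : D) : gr d ≤ A d := by
  intro x hx
  have h1 : x ∈ A d ⊔ ⨆ j, ⨆ (_ : j ≠ d), A j := by
    have : (⊤ : Submodule ℂ G) ≤ A d ⊔ ⨆ j, ⨆ (_ : j ≠ d), A j := by
      rw [← ht]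
      refine iSup_le fun j => ?_
      by_cases h : j = d
      · subst h; exact le_sup_left
      · exact le_sup_of_le_right (le_iSup₂_of_le j h le_rfl)
    exact this trivial
  obtain ⟨y, hy, z, hz, rfl⟩ := Submodule.mem_sup.1 h1
  have hz' : z ∈ ⨆ j, ⨆ (_ : j ≠ d), gr j := (iSup₂_mono fun j _ => hA j) hz
  have hz2 : z ∈ gr d := by
    have := sub_mem hx (hA d hy); simpa using this
  have : z = 0 := by
    have := (ind d).le_bot ⟨hz2, hz'⟩
    simpa using this
  rw [this, add_zero]; exact hy

theorem iSupIndep_uniq {D : Type*} {gr : D → Submodule ℂ G} (ind : iSupIndep gr) {d d' : D} {x : G}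
    (h : x ∈ gr d) (h' : x ∈ gr d') (hx : x ≠ 0) : d = d' := by
  by_contra hne
  exact hx (by simpa using (ind.pairwiseDisjoint hne).le_bot ⟨h, h'⟩)

theorem gen_top {s : Set G} (hs : LieSubalgebra.lieSpan ℂ G s = ⊤) {U : Submodule ℂ G}
    (h1 : s ⊆ U) (h2 : ∀ x ∈ s, ∀ y ∈ U, ⁅x, y⁆ ∈ U) : U = ⊤ := by
  have A : ∀ x : G, ∀ y ∈ U, ⁅x, y⁆ ∈ U := by
    intro x
    have hx : x ∈ LieSubalgebra.lieSpan ℂ G s := by rw [hs]; trivial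
    induction hx using LieSubalgebra.lieSpan_induction with
    | mem x h => exact h2 x h
    | zero => intro y _; simp
    | add x y _ _ h1 h2 => intro z hz; rw [add_lie]; exact add_mem (h1 z hz) (h2 z hz)
    | smul a x _ h => intro z hz; rw [smul_lie]; exact U.smul_mem _ (h z hz)
    | lie x y _ _ h1 h2 => intro z hz; rw [lie_lie]; exact sub_mem (h1 _ (h2 z hz)) (h2 _ (h1 z hz))
  rw [eq_top_iff]
  intro x _
  have hx : x ∈ LieSubalgebra.lieSpan ℂ G s := by rw [hs]; trivial
  induction hx using LieSubalgebra.lieSpan_induction with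
  | mem x h => exact h1 h
  | zero => exact zero_mem _
  | add x y _ _ h1 h2 => exact add_mem (h1 trivial) (h2 trivial)
  | smul a x _ h => exact U.smul_mem _ (h trivial)
  | lie x y _ _ h1 h2 => exact A _ _ (h2 trivial)

/-- triangular data -/
structure Tri (gr : (I → ℤ) × ℤ → Submodule ℂ G) (k : I → ℤ) (es fs hs : I → ℤ → G) (c : I → G) :
    Prop where
  ind : iSupIndep gr
  mul : ∀ d d', ∀ x ∈ gr d, ∀ y ∈ gr d', ⁅x, y⁆ ∈ gr (d + d')
  loop : ∀ i, Loop (es i) (fs i) (hs i) (c i)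
  ok : ∀ i j, i ≠ j → PairOK (es i) (fs i) (hs i) (es j) (fs j) (hs j)
  e0 : ∀ i, es i 0 ∈ gr (Pi.single i 1, 0)
  e1 : ∀ i, es i 1 ∈ gr (Pi.single i 1, k i)
  f0 : ∀ i, fs i 0 ∈ gr (-Pi.single i 1, 0)
  f1 : ∀ i, fs i (-1) ∈ gr (-Pi.single i 1, -k i)
  cg : ∀ i, c i ∈ gr 0
  gen : LieSubalgebra.lieSpan ℂ G {x | ∃ i, x = es i 0 ∨ x = es i 1 ∨ x = fs i 0 ∨ x = fs i (-1)} = ⊤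

variable {gr : (I → ℤ) × ℤ → Submodule ℂ G} {k : I → ℤ} {es fs hs : I → ℤ → G} {c : I → G}

theorem PairOK.inv {ex fx hx ey fy hy : ℤ → G} (q : PairOK ex fx hx ey fy hy) :
    PairOK (fun n => fx (-n)) (fun n => ex (-n)) (fun n => -hx (-n))
      (fun n => fy (-n)) (fun n => ey (-n)) (fun n => -hy (-n)) := by
  have rg : ∀ f : ℤ → G, Set.range (fun n => f (-n)) = Set.range f := fun f => 
    (Equiv.neg ℤ).surjective.range_comp f
  refine ⟨fun m n => sk0 (q.fe _ _), fun m n => sk0 (q.ef _ _), ?_, ?_, ?_, ?_⟩ <;> intro m n <;>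
    simp only [neg_lie, Submodule.neg_mem_iff, rg]
  · exact q.hxf _ _
  · exact q.hxe _ _
  · exact q.hyf _ _
  · exact q.hye _ _

theorem Tri.inv (q : Tri gr k es fs hs c) : Tri (fun d => gr (-d)) k (fun i n => fs i (-n))
    (fun i n => es i (-n)) (fun i n => - hs i (-n)) (fun i => - c i) where
  ind := q.ind.comp neg_injective
  mul d d' x hx y hy := by rw [neg_add]; exact q.mul _ _ x hx y hy
  loop i := (q.loop i).inv
  ok i j h := (q.ok i j h).inv
  e0 i := by simpa using q.f0 i
  e1 i := by simpa using q.f1 i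
  f0 i := by simpa using q.e0 i
  f1 i := by simpa using q.e1 i
  cg i := by simpa using q.cg i
  gen := by
    rw [← q.gen]
    congr 1
    ext x
    simp only [Set.mem_ofPred_eq, neg_neg, neg_zero]
    constructor <;> rintro ⟨i, h⟩ <;> exact ⟨i, by tauto⟩

theorem Tri.hs1 (q : Tri gr k es fs hs c) (i : I) : hs i 1 ∈ gr (0, k i) := by
  rw [← (q.loop i).ef0 1]
  have := q.mul _ _ _ (q.e1 i) _ (q.f0 i)
  simpa using this

theorem Tri.hsm (q : Tri gr k es fs hs c) (i : I) : hs i (-1) ∈ gr (0, -k i) := by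
  rw [← (q.loop i).fe0 (-1)]
  have := q.mul _ _ _ (q.e0 i) _ (q.f1 i)
  simpa using this

theorem Tri.es_deg (q : Tri gr k es fs hs c) (i : I) (m : ℤ) : es i m ∈ gr (Pi.single i 1, k i * m) := by
  induction m using Int.induction_on with
  | zero => rw [mul_zero]; exact q.e0 i
  | succ n ih =>
    have h := q.mul _ _ _ (q.hs1 i) _ ih
    rw [(q.loop i).ue, Submodule.smul_mem_iff _ two_ne_zero] at h
    convert h using 3
    · simp
    · simp; ring
  | pred n ih =>
    have h := q.mul _ _ _ (q.hsm i) _ ih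
    rw [(q.loop i).de, Submodule.smul_mem_iff _ two_ne_zero] at h
    convert h using 3
    · simp
    · simp; ring

theorem Tri.fs_deg (q : Tri gr k es fs hs c) (i : I) (m : ℤ) : fs i m ∈ gr (-Pi.single i 1, k i * m) := by
  have := q.inv.es_deg i (-m)
  simpa using this

theorem Tri.hs_deg (q : Tri gr k es fs hs c) (i : I) (m : ℤ) : hs i m ∈ gr (0, k i * m) := by
  rw [← (q.loop i).ef0 m]
  have := q.mul _ _ _ (q.es_deg i m) _ (q.f0 i)
  simpa using this

/-- iterated brackets -/
inductive Words (es : I → ℤ → G) : G → Prop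
  | base (i m) : Words es (es i m)
  | step (i m) {x : G} (h : Words es x) : Words es ⁅es i m, x⁆

/-- span of iterated brackets -/
def WS (es : I → ℤ → G) : Submodule ℂ G := Submodule.span ℂ {x | Words es x}

/-- the Cartan part -/
def HH (hs : I → ℤ → G) (c : I → G) : Submodule ℂ G :=
  Submodule.span ℂ {x | (∃ i n, x = hs i n) ∨ (∃ i, x = c i)}

theorem WS.es_mem (i : I) (m : ℤ) : es i m ∈ WS es := Submodule.subset_span (Words.base i m)

theorem WS.es_lie (i : I) (m : ℤ) {x : G} (h : x ∈ WS es) : ⁅es i m, x⁆ ∈ WS es := by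
  induction h using Submodule.span_induction with
  | mem x h => exact Submodule.subset_span (Words.step i m h)
  | zero => simp
  | add x y _ _ h1 h2 => rw [lie_add]; exact add_mem h1 h2
  | smul a x _ h => rw [lie_smul]; exact Submodule.smul_mem _ _ h

theorem WS.span_lie (i : I) {y : G} (hy : y ∈ Submodule.span ℂ (Set.range (es i))) {x : G} (h : x ∈ WS es) :
    ⁅y, x⁆ ∈ WS es := by
  induction hy using Submodule.span_induction with
  | mem y hy => obtain ⟨m, rfl⟩ := hy; exact WS.es_lie i m h
  | zero => simp
  | add x y _ _ h1 h2 => rw [add_lie]; exact add_mem h1 h2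
  | smul a x _ h => rw [smul_lie]; exact Submodule.smul_mem _ _ h

theorem Tri.hs_es (q : Tri gr k es fs hs c) (i j : I) (n m : ℤ) :
    ⁅hs i n, es j m⁆ ∈ Submodule.span ℂ (Set.range (es j)) := by
  by_cases h : i = j
  · subst h
    rw [(q.loop i).he]
    exact Submodule.smul_mem _ _ (Submodule.subset_span ⟨_, rfl⟩)
  · exact (q.ok i j h).hxe n m

theorem span_WS (i : I) : Submodule.span ℂ (Set.range (es i)) ≤ WS es := by
  rw [Submodule.span_le]; rintro _ ⟨m, rfl⟩; exact WS.es_mem i m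

theorem Tri.hs_WS (q : Tri gr k es fs hs c) (i : I) (n : ℤ) {x : G} (hx : x ∈ WS es) :
    ⁅hs i n, x⁆ ∈ WS es := by
  induction hx using Submodule.span_induction with
  | mem x h =>
    induction h with
    | base j m => exact span_WS j (q.hs_es i j n m)
    | step j m h ih =>
      rw [leibniz_lie]
      exact add_mem (WS.span_lie j (q.hs_es i j n m) (Submodule.subset_span h)) (WS.es_lie _ _ ih)
  | zero => simp
  | add x y _ _ h1 h2 => rw [lie_add]; exact add_mem h1 h2
  | smul a x _ h => rw [lie_smul]; exact Submodule.smul_mem _ _ h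

theorem Tri.HH_WS (q : Tri gr k es fs hs c) {y : G} (hy : y ∈ HH hs c) {x : G} (hx : x ∈ WS es) :
    ⁅y, x⁆ ∈ WS es := by
  induction hy using Submodule.span_induction with
  | mem y hy =>
    rcases hy with ⟨i, n, rfl⟩ | ⟨i, rfl⟩
    · exact q.hs_WS i n hx
    · rw [(q.loop i).cz]; exact zero_mem _
  | zero => simp
  | add x y _ _ h1 h2 => rw [add_lie]; exact add_mem h1 h2
  | smul a x _ h => rw [smul_lie]; exact Submodule.smul_mem _ _ h

theorem Tri.f_es (q : Tri gr k es fs hs c) (i j : I) (n m : ℤ) (hn : n = 0 ∨ n = -1) :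
    ⁅fs i n, es j m⁆ ∈ HH hs c := by
  rw [← lie_skew, Submodule.neg_mem_iff]
  by_cases h : i = j
  · subst h
    rcases hn with rfl | rfl
    · rw [(q.loop i).ef0]; exact Submodule.subset_span (Or.inl ⟨_, _, rfl⟩)
    · rw [(q.loop i).ef1]
      refine add_mem (Submodule.subset_span (Or.inl ⟨_, _, rfl⟩)) ?_
      split_ifs
      · exact Submodule.subset_span (Or.inr ⟨_, rfl⟩)
      · exact zero_mem _
  · rw [(q.ok i j h).fe]; exact zero_mem _

theorem Tri.f_WS (q : Tri gr k es fs hs c) (i : I) (n : ℤ) (hn : n = 0 ∨ n = -1) {x : G} (hx : x ∈ WS es) :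
    ⁅fs i n, x⁆ ∈ HH hs c ⊔ WS es := by
  induction hx using Submodule.span_induction with
  | mem x h =>
    induction h with
    | base j m => exact Submodule.mem_sup_left (q.f_es i j n m hn)
    | step j m h ih =>
      rw [leibniz_lie]
      refine add_mem (Submodule.mem_sup_right (q.HH_WS (q.f_es i j n m hn) (Submodule.subset_span h))) ?_
      obtain ⟨y, hy, z, hz, e⟩ := Submodule.mem_sup.1 ih
      rw [← e, lie_add]
      refine Submodule.mem_sup_right (add_mem ?_ (WS.es_lie _ _ hz))
      rw [← lie_skew, Submodule.neg_mem_iff]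
      exact q.HH_WS hy (WS.es_mem _ _)
  | zero => simp
  | add x y _ _ h1 h2 => rw [lie_add]; exact add_mem h1 h2
  | smul a x _ h => rw [lie_smul]; exact Submodule.smul_mem _ _ h

theorem HH_inv : HH (fun i n => - hs i (-n)) (fun i => - c i) = HH hs c := by
  apply le_antisymm
  · refine Submodule.span_le.2 ?_
    rintro x (⟨i, n, rfl⟩ | ⟨i, rfl⟩)
    · exact neg_mem (Submodule.subset_span (Or.inl ⟨_, _, rfl⟩))
    · exact neg_mem (Submodule.subset_span (Or.inr ⟨_, rfl⟩))
  · refine Submodule.span_le.2 ?_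
    rintro x (⟨i, n, rfl⟩ | ⟨i, rfl⟩)
    · rw [← neg_neg (hs i n)]
      exact neg_mem (Submodule.subset_span (Or.inl ⟨i, -n, by simp⟩))
    · rw [← neg_neg (c i)]
      exact neg_mem (Submodule.subset_span (Or.inr ⟨_, rfl⟩))

theorem Words_inv {x : G} (h : Words (fun i n => fs i (-n)) x) : Words fs x := by
  induction h with
  | base i m => exact Words.base i (-m)
  | step i m _ ih => exact Words.step i (-m) ih

theorem WS_inv : WS (fun i n => fs i (-n)) = WS fs := by
  unfold WS
  congr 1
  ext x
  refine ⟨Words_inv, fun h => ?_⟩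
  have : fs = fun i n => (fun i n => fs i (-n)) i (-n) := by funext i n; simp
  rw [this] at h
  exact Words_inv h

theorem Tri.top (q : Tri gr k es fs hs c) : WS fs ⊔ (HH hs c ⊔ WS es) = ⊤ := by
  have f_HH : ∀ i n y, y ∈ HH hs c → ⁅fs i n, y⁆ ∈ WS fs := by
    intro i n y hy
    rw [← HH_inv] at hy
    have := q.inv.HH_WS hy (WS.es_mem i (-n))
    rw [WS_inv, neg_neg] at this
    rw [← lie_skew]; exact neg_mem this
  have e_HH : ∀ i n y, y ∈ HH hs c → ⁅es i n, y⁆ ∈ WS es := by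
    intro i n y hy
    rw [← lie_skew]; exact neg_mem (q.HH_WS hy (WS.es_mem i n))
  have e_WS : ∀ i n, (n = 0 ∨ n = 1) → ∀ y ∈ WS fs, ⁅es i n, y⁆ ∈ HH hs c ⊔ WS fs := by
    intro i n hn y hy
    rw [← WS_inv] at hy
    have := q.inv.f_WS i (-n) (by omega) hy
    rw [HH_inv, WS_inv, neg_neg] at this
    exact this
  refine gen_top q.gen ?_ ?_
  · rintro x ⟨i, rfl | rfl | rfl | rfl⟩
    · exact Submodule.mem_sup_right (Submodule.mem_sup_right (WS.es_mem _ _))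
    · exact Submodule.mem_sup_right (Submodule.mem_sup_right (WS.es_mem _ _))
    · exact Submodule.mem_sup_left (WS.es_mem _ _)
    · exact Submodule.mem_sup_left (WS.es_mem _ _)
  · have A : ∀ i n, (n = 0 ∨ n = 1) → ∀ y ∈ WS fs ⊔ (HH hs c ⊔ WS es), ⁅es i n, y⁆ ∈ WS fs ⊔ (HH hs c ⊔ WS es) := by
      intro i n hn y hy
      obtain ⟨u, hu, v', hv', rfl⟩ := Submodule.mem_sup.1 hy
      obtain ⟨v, hv, w, hw, rfl⟩ := Submodule.mem_sup.1 hv'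
      rw [lie_add, lie_add]
      refine add_mem ?_ (add_mem ?_ ?_)
      · exact (sup_le (le_sup_of_le_right le_sup_left) le_sup_left : HH hs c ⊔ WS fs ≤ _) (e_WS i n hn u hu)
      · exact Submodule.mem_sup_right (Submodule.mem_sup_right (e_HH i n v hv))
      · exact Submodule.mem_sup_right (Submodule.mem_sup_right (WS.es_lie i n hw))
    have B : ∀ i n, (n = 0 ∨ n = -1) → ∀ y ∈ WS fs ⊔ (HH hs c ⊔ WS es), ⁅fs i n, y⁆ ∈ WS fs ⊔ (HH hs c ⊔ WS es) := by
      intro i n hn y hy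
      obtain ⟨u, hu, v', hv', rfl⟩ := Submodule.mem_sup.1 hy
      obtain ⟨v, hv, w, hw, rfl⟩ := Submodule.mem_sup.1 hv'
      rw [lie_add, lie_add]
      refine add_mem ?_ (add_mem ?_ ?_)
      · exact Submodule.mem_sup_left (WS.es_lie i n hu)
      · exact Submodule.mem_sup_left (f_HH i n v hv)
      · exact Submodule.mem_sup_right (q.f_WS i n hn hw)
    rintro x ⟨i, rfl | rfl | rfl | rfl⟩
    · exact A i 0 (Or.inl rfl)
    · exact A i 1 (Or.inr rfl)
    · exact B i 0 (Or.inl rfl)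
    · exact B i (-1) (Or.inr rfl)

/-- homogeneous spanning set -/
theorem Tri.span (q : Tri gr k es fs hs c) (d : (I → ℤ) × ℤ) :
    gr d ≤ Submodule.span ℂ {x | x ∈ gr d ∧ (Words fs x ∨ Words es x ∨ x ∈ gr (0, d.2) )} := by
  have hWe : ∀ x, Words es x → ∃ d, x ∈ gr d := by
    intro x h
    induction h with
    | base i m => exact ⟨_, q.es_deg i m⟩
    | step i m h ih => obtain ⟨d, hd⟩ := ih; exact ⟨_, q.mul _ _ _ (q.es_deg i m) _ hd⟩
  have hWf : ∀ x, Words fs x → ∃ d, x ∈ gr d := by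
    intro x h
    induction h with
    | base i m => exact ⟨_, q.fs_deg i m⟩
    | step i m h ih => obtain ⟨d, hd⟩ := ih; exact ⟨_, q.mul _ _ _ (q.fs_deg i m) _ hd⟩
  refine iSupIndep_extract q.ind (A := fun d => Submodule.span ℂ {x | x ∈ gr d ∧ (Words fs x ∨ Words es x ∨ x ∈ gr (0, d.2) )}) ?_ ?_ d
  · intro d; exact Submodule.span_le.2 fun x hx => hx.1
  · rw [eq_top_iff, ← q.top]
    refine sup_le ?_ (sup_le ?_ ?_)
    · refine Submodule.span_le.2 fun x hx => ?_
      obtain ⟨d, hd⟩ := hWf x hx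
      exact Submodule.mem_iSup_of_mem d (Submodule.subset_span ⟨hd, Or.inl hx⟩)
    · refine Submodule.span_le.2 ?_
      rintro x (⟨i, n, rfl⟩ | ⟨i, rfl⟩)
      · exact Submodule.mem_iSup_of_mem _ (Submodule.subset_span ⟨q.hs_deg i n, Or.inr (Or.inr (q.hs_deg i n))⟩)
      · exact Submodule.mem_iSup_of_mem 0 (Submodule.subset_span ⟨q.cg i, Or.inr (Or.inr (q.cg i))⟩)
    · refine Submodule.span_le.2 fun x hx => ?_
      obtain ⟨d, hd⟩ := hWe x hx
      exact Submodule.mem_iSup_of_mem d (Submodule.subset_span ⟨hd, Or.inr (Or.inl hx)⟩)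

theorem Tri.words (q : Tri gr k es fs hs c) {x : G} (h : Words es x) :
    x = 0 ∨ (∃ i m, x = es i m) ∨
    (∃ d, x ∈ gr d ∧ (∀ i, 0 ≤ d.1 i) ∧ ∃ i j, i ≠ j ∧ 0 < d.1 i ∧ 0 < d.1 j) := by
  induction h with
  | base i m => exact Or.inr (Or.inl ⟨i, m, rfl⟩)
  | @step i m x h ih =>
    rcases ih with rfl | ⟨j, n, rfl⟩ | ⟨d, hd, h1, j, j', hj, h2, h3⟩
    · left; simp
    · by_cases hij : i = j
      · left; subst hij; exact (q.loop i).ee _ _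
      · refine Or.inr (Or.inr ⟨_, q.mul _ _ _ (q.es_deg i m) _ (q.es_deg j n), ?_, i, j, hij, ?_, ?_⟩)
        · intro t
          simp only [Prod.fst_add, Pi.add_apply, Pi.single_apply]; split_ifs <;> norm_num
        · simp [hij]
        · simp [Ne.symm hij]
    · have hs : ∀ t, 0 ≤ (Pi.single i 1 : I → ℤ) t := by
        intro t; rw [Pi.single_apply]; split_ifs <;> norm_num
      refine Or.inr (Or.inr ⟨_, q.mul _ _ _ (q.es_deg i m) _ hd, ?_, j, j', hj, ?_, ?_⟩)
      · intro t; exact add_nonneg (hs t) (h1 t)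
      · exact add_pos_of_nonneg_of_pos (hs j) h2
      · exact add_pos_of_nonneg_of_pos (hs j') h3

theorem Tri.words_nonneg (q : Tri gr k es fs hs c) {x : G} (h : Words es x) {d} (hd : x ∈ gr d) (hx : x ≠ 0) :
    ∀ i, 0 ≤ d.1 i := by
  rcases q.words h with h | ⟨i, m, rfl⟩ | ⟨d', hd', h, -⟩
  · exact absurd h hx
  · rw [← iSupIndep_uniq q.ind (q.es_deg i m) hd hx]
    intro t; simp only [Pi.single_apply]; split_ifs <;> norm_num
  · rw [← iSupIndep_uniq q.ind hd' hd hx]; exact h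

theorem Tri.words_nonpos (q : Tri gr k es fs hs c) {x : G} (h : Words fs x) {d} (hd : x ∈ gr d) (hx : x ≠ 0) :
    ∀ i, d.1 i ≤ 0 := by
  have h' : Words (fun i n => fs i (-n)) x := by
    apply Words_inv (fs := fun i n => fs i (-n)); simpa using h
  have := q.inv.words_nonneg h' (d := -d) (by simpa using hd) hx
  simpa using this

theorem Tri.mixed (q : Tri gr k es fs hs c) {d : (I → ℤ) × ℤ} {i j : I} (hi : 0 < d.1 i) (hj : d.1 j < 0) 
    {x : G} (hx : x ∈ gr d) : x = 0 := by
  have h := q.span d hx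
  have : Submodule.span ℂ {x | x ∈ gr d ∧ (Words fs x ∨ Words es x ∨ x ∈ gr (0, d.2) )} ≤ ⊥ := by
    refine Submodule.span_le.2 ?_
    rintro y ⟨hy, h⟩
    by_contra hne
    have hne : y ≠ 0 := hne
    rcases h with h | h | h
    · exact absurd (q.words_nonpos h hy hne i) (by omega)
    · exact absurd (q.words_nonneg h hy hne j) (by omega)
    · have := iSupIndep_uniq q.ind hy h hne
      rw [this] at hi; simp at hi
  simpa using this h

theorem Tri.simple (q : Tri gr k es fs hs c) (hk : ∀ i, k i ≠ 0) {i : I} {n r : ℤ} (hn : 0 < n)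
    {x : G} (hx : x ∈ gr (Pi.single i n, r)) : x = 0 ∨ (n = 1 ∧ ∃ m, r = k i * m ∧ ∃ t : ℂ, x = t • es i m) := by
  set d : (I → ℤ) × ℤ := (Pi.single i n, r) with hdef
  have h := q.span d hx
  have key : ∀ y, y ∈ gr d → y ≠ 0 → (Words fs y ∨ Words es y ∨ y ∈ gr (0, d.2)) → n = 1 ∧ ∃ m, r = k i * m ∧ y = es i m := by
    intro y hy hne h
    rcases h with h | h | h
    · have := q.words_nonpos h hy hne i
      simp [hdef] at this; omega
    · rcases q.words h with h | ⟨j, m, rfl⟩ | ⟨d', hd', h1, j, j', hj, h2, h3⟩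
      · exact absurd h hne
      · have := iSupIndep_uniq q.ind (q.es_deg j m) hy hne
        rw [hdef, Prod.mk.injEq] at this
        obtain ⟨h1, h2⟩ := this
        have hij : j = i := by
          by_contra hne
          have := congrFun h1 i
          simp [Pi.single_apply, Ne.symm hne] at this; omega
        subst hij
        have := congrFun h1 j
        simp at this
        exact ⟨this.symm, m, h2.symm, rfl⟩
      · have := iSupIndep_uniq q.ind hd' hy hne
        rw [this] at h2 h3
        simp only [hdef, Pi.single_apply] at h2 h3
        split_ifs at h2 h3 <;> first | omega | (exfalso; apply hj; simp_all)
    · have := iSupIndep_uniq q.ind hy h hne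
      have := congrFun (congrArg Prod.fst this) i
      simp [hdef] at this; omega
  by_cases hz : n = 1 ∧ ∃ m, r = k i * m
  · obtain ⟨h1, m, hm⟩ := hz
    right
    refine ⟨h1, m, hm, ?_⟩
    have : Submodule.span ℂ {x | x ∈ gr d ∧ (Words fs x ∨ Words es x ∨ x ∈ gr (0, d.2) )} ≤ Submodule.span ℂ {es i m} := by
      refine Submodule.span_le.2 ?_
      rintro y ⟨hy, h⟩
      by_cases hne : y = 0
      · rw [hne]; exact zero_mem _
      obtain ⟨-, m', hm', rfl⟩ := key y hy hne h
      have : m = m' := mul_left_cancel₀ (hk i) (hm.symm.trans hm')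
      rw [this]; exact Submodule.mem_span_singleton_self _
    obtain ⟨t, ht⟩ := Submodule.mem_span_singleton.1 (this h)
    exact ⟨t, ht.symm⟩
  · left
    have : Submodule.span ℂ {x | x ∈ gr d ∧ (Words fs x ∨ Words es x ∨ x ∈ gr (0, d.2) )} ≤ ⊥ := by
      refine Submodule.span_le.2 ?_
      rintro y ⟨hy, h⟩
      by_contra hne
      obtain ⟨a, m', b, -⟩ := key y hy hne h
      exact hz ⟨a, m', b⟩
    simpa using this h

end TriS
end Ell

namespace Ell
set_option linter.unusedSectionVars false
set_option linter.unusedSimpArgs false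

/-- central extension of the commutator algebra of `A` by the cocycle `T (x * D y)` -/
@[ext] structure Ext (A : Type*) [Ring A] [Algebra ℂ A] (D : A →ₗ[ℂ] A) (T : A →ₗ[ℂ] ℂ) where
  fst : A
  snd : ℂ

namespace Ext
variable {A : Type*} [Ring A] [Algebra ℂ A] {D : A →ₗ[ℂ] A} {T : A →ₗ[ℂ] ℂ}

/-- underlying equivalence -/
def eqv : Ext A D T ≃ A × ℂ where
  toFun x := (x.1, x.2)
  invFun x := ⟨x.1, x.2⟩
  left_inv _ := rfl
  right_inv _ := rfl

instance : AddCommGroup (Ext A D T) := eqv.addCommGroup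
instance : Module ℂ (Ext A D T) := eqv.module ℂ

@[simp] theorem add_fst (x y : Ext A D T) : (x + y).fst = x.fst + y.fst := rfl
@[simp] theorem add_snd (x y : Ext A D T) : (x + y).snd = x.snd + y.snd := rfl
@[simp] theorem neg_fst (x : Ext A D T) : (-x).fst = -x.fst := rfl
@[simp] theorem neg_snd (x : Ext A D T) : (-x).snd = -x.snd := rfl
@[simp] theorem sub_fst (x y : Ext A D T) : (x - y).fst = x.fst - y.fst := rfl
@[simp] theorem sub_snd (x y : Ext A D T) : (x - y).snd = x.snd - y.snd := rfl
@[simp] theorem zero_fst : (0 : Ext A D T).fst = 0 := rfl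
@[simp] theorem zero_snd : (0 : Ext A D T).snd = 0 := rfl
@[simp] theorem smul_fst (c : ℂ) (x : Ext A D T) : (c • x).fst = c • x.fst := rfl
@[simp] theorem smul_snd (c : ℂ) (x : Ext A D T) : (c • x).snd = c * x.snd := rfl

instance : Bracket (Ext A D T) (Ext A D T) := ⟨fun x y => ⟨x.1 * y.1 - y.1 * x.1, T (x.1 * D y.1)⟩⟩
@[simp] theorem lie_fst (x y : Ext A D T) : (⁅x, y⁆).fst = x.fst * y.fst - y.fst * x.fst := rfl
@[simp] theorem lie_snd (x y : Ext A D T) : (⁅x, y⁆).snd = T (x.fst * D y.fst) := rfl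

/-- conditions on derivation and trace -/
class Good (D : A →ₗ[ℂ] A) (T : A →ₗ[ℂ] ℂ) : Prop where
  der : ∀ x y, D (x * y) = x * D y + D x * y
  tr : ∀ x y, T (x * y) = T (y * x)
  inv : ∀ x, T (D x) = 0

theorem skew [Good D T] (x y : A) : T (x * D y) = - T (y * D x) := by
  have h := Good.inv (D := D) (T := T) (x * y)
  rw [Good.der (T := T), map_add, Good.tr (D := D) (D x) y] at h
  linear_combination h

instance [Good D T] : LieRing (Ext A D T) where
  add_lie x y z := by ext <;> simp [add_mul, mul_add] <;> abel
  lie_add x y z := by ext <;> simp [add_mul, mul_add] <;> abel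
  lie_self x := by
    ext
    · simp
    · have := skew (D := D) (T := T) x.fst x.fst
      simp only [lie_snd, zero_snd]; linear_combination (1/2) * this
  leibniz_lie x y z := by
    ext
    · simp; noncomm_ring
    · simp only [lie_snd, add_snd, lie_fst, map_sub, Good.der (D := D) (T := T), sub_mul, mul_sub, mul_add, map_add]
      have c := fun u v => Good.tr (D := D) (T := T) u v
      have i1 := Good.inv (D := D) (T := T) (x.fst * (y.fst * z.fst))
      have i2 := Good.inv (D := D) (T := T) (y.fst * (x.fst * z.fst))
      simp only [Good.der (D := D) (T := T), map_add, mul_add] at i1 i2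
      have h1 := c (x.fst * D z.fst) y.fst
      have h2 := c (y.fst * D z.fst) x.fst
      have h3 := c (D x.fst) (y.fst * z.fst)
      have h4 := c (D y.fst) (x.fst * z.fst)
      simp only [mul_assoc] at *
      linear_combination -h1 + i1 - i2 + h2 - h3 + h4

instance [Good D T] : LieAlgebra ℂ (Ext A D T) where
  lie_smul c x y := by ext <;> simp [smul_sub]

end Ext
end Ell

namespace Ell
set_option linter.unusedSectionVars false
set_option linter.unusedSimpArgs false

section Model
variable {ι : Type*} [Fintype ι] [DecidableEq ι]

/-- symplectic pairing on the lattice -/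
def sy (s m : ℤ × ℤ) : ℂ := (m.1 : ℂ) * s.2 - m.2 * s.1

theorem sy_add (s m n : ℤ × ℤ) : sy s (m + n) = sy s m + sy s n := by
  simp [sy]; ring
theorem sy_self (s : ℤ × ℤ) : sy s s = 0 := by simp [sy]; ring

/-- Laurent polynomial matrices -/
abbrev LM (ι : Type*) [Fintype ι] [DecidableEq ι] := AddMonoidAlgebra (Matrix ι ι ℂ) (ℤ × ℤ)

/-- degree derivation -/
noncomputable def LM.D (s : ℤ × ℤ) : LM ι →ₗ[ℂ] LM ι where
  toFun x := .ofCoeff (x.coeff.sum fun m X => Finsupp.single m (sy s m • X))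
  map_add' x y := by
    rw [AddMonoidAlgebra.coeff_add, Finsupp.sum_add_index', AddMonoidAlgebra.ofCoeff_add]
    · simp
    · simp
  map_smul' c x := by
    rw [RingHom.id_apply, AddMonoidAlgebra.coeff_smul, Finsupp.sum_smul_index', ← AddMonoidAlgebra.ofCoeff_smul, Finsupp.smul_sum]
    · congr 2
      funext m X
      rw [Finsupp.smul_single, smul_comm]
    · simp

theorem LM.D_single (s m : ℤ × ℤ) (X : Matrix ι ι ℂ) : LM.D s (AddMonoidAlgebra.single m X) = sy s m • AddMonoidAlgebra.single m X := by
  simp [LM.D]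

/-- residue trace -/
noncomputable def LM.T (s : ℤ × ℤ) : LM ι →ₗ[ℂ] ℂ where
  toFun x := (x.coeff s).trace
  map_add' x y := by simp
  map_smul' c x := by simp

theorem LM.T_single (s m : ℤ × ℤ) (X : Matrix ι ι ℂ) : LM.T s (AddMonoidAlgebra.single m X) = if m = s then X.trace else 0 := by
  simp [LM.T, Finsupp.single_apply]
  split_ifs <;> simp

theorem LM.ind {p : LM ι → Prop} (h : ∀ m X, p (AddMonoidAlgebra.single m X)) (h0 : p 0) (ha : ∀ x y, p x → p y → p (x + y)) (x : LM ι) : p x := by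
  obtain ⟨x⟩ := x
  induction x using Finsupp.induction_linear with
  | zero => exact h0
  | add f g hf hg => exact ha _ _ hf hg
  | single m X => exact h m X

instance (s : ℤ × ℤ) : Ext.Good (LM.D s : LM ι →ₗ[ℂ] LM ι) (LM.T s) where
  der x y := by
    induction x using LM.ind with
    | h0 => simp
    | ha x x' h h' => rw [add_mul, map_add, h, h', map_add]; noncomm_ring
    | h m X =>
      induction y using LM.ind with
      | h0 => simp
      | ha x x' h h' => rw [mul_add, map_add, h, h', map_add]; noncomm_ring
      | h n Y =>
        simp only [AddMonoidAlgebra.single_mul_single, LM.D_single, sy_add, mul_smul_comm, smul_mul_assoc]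
        module
  tr x y := by
    induction x using LM.ind with
    | h0 => simp
    | ha x x' h h' => rw [add_mul, map_add, h, h', mul_add, map_add]
    | h m X =>
      induction y using LM.ind with
      | h0 => simp
      | ha x x' h h' => rw [mul_add, map_add, h, h', add_mul, map_add]
      | h n Y =>
        simp only [AddMonoidAlgebra.single_mul_single, LM.T_single, add_comm m n, Matrix.trace_mul_comm X Y]
  inv x := by
    induction x using LM.ind with
    | h0 => simp
    | ha x x' h h' => rw [map_add, map_add, h, h', add_zero]
    | h m X =>
      simp only [LM.D_single, map_smul, LM.T_single]
      split_ifs with h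
      · rw [h, sy_self, zero_smul]
      · simp

/-- the model Lie algebra -/
abbrev LL (ι : Type*) [Fintype ι] [DecidableEq ι] (s : ℤ × ℤ) := Ext (LM ι) (LM.D s) (LM.T s)

/-- basic matrices -/
def Fm (bar : ι → ι) (i j : ι) : Matrix ι ι ℂ := Matrix.single i (bar j) 1 - Matrix.single j (bar i) 1

/-- basic elements -/
noncomputable def FF (s : ℤ × ℤ) (bar : ι → ι) (i j : ι) (m : ℤ × ℤ) : LL ι s :=
  ⟨AddMonoidAlgebra.single m (Fm bar i j), 0⟩

/-- central element -/
noncomputable def ZZ (ι : Type*) [Fintype ι] [DecidableEq ι] (s : ℤ × ℤ) : LL ι s := ⟨0, 1⟩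

theorem FF_swap (s : ℤ × ℤ) (bar : ι → ι) (i j : ι) (m : ℤ × ℤ) : FF s bar i j m = - FF s bar j i m := by
  ext1
  · simp only [FF, Fm, Ext.neg_fst, ← AddMonoidAlgebra.single_neg, neg_sub]
  · simp [FF]

theorem FF_self (s : ℤ × ℤ) (bar : ι → ι) (i : ι) (m : ℤ × ℤ) : FF s bar i i m = 0 := by
  ext1
  · simp [FF, Fm]
  · simp [FF]

theorem ZZ_lie (s : ℤ × ℤ) (x : LL ι s) : ⁅ZZ ι s, x⁆ = 0 := by ext1 <;> simp [ZZ]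
theorem lie_ZZ (s : ℤ × ℤ) (x : LL ι s) : ⁅x, ZZ ι s⁆ = 0 := by ext1 <;> simp [ZZ]

theorem FF_lie (s : ℤ × ℤ) {bar : ι → ι} (hb : ∀ i, bar (bar i) = i) (i j k l : ι) (m n : ℤ × ℤ) :
    ⁅FF s bar i j m, FF s bar k l n⁆ =
      (if k = bar j then FF s bar i l (m + n) else 0) - (if l = bar j then FF s bar i k (m + n) else 0)
      - (if k = bar i then FF s bar j l (m + n) else 0) + (if l = bar i then FF s bar j k (m + n) else 0)
      + (if m + n = s ∧ k = bar j ∧ l = bar i then (2 * sy s n) • ZZ ι s else 0)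
      - (if m + n = s ∧ l = bar j ∧ k = bar i then (2 * sy s n) • ZZ ι s else 0) := by
  have ms : ∀ a b c d : ι, (Matrix.single a b (1:ℂ)) * Matrix.single c d 1 = if b = c then Matrix.single a d 1 else 0 := by
    intro a b c d
    split_ifs with h
    · subst h; simp
    · simp [h]
  have e1 : (bar j = k) = (k = bar j) := propext ⟨fun h => h.symm, fun h => h.symm⟩
  have e2 : (bar j = l) = (l = bar j) := propext ⟨fun h => h.symm, fun h => h.symm⟩
  have e3 : (bar i = k) = (k = bar i) := propext ⟨fun h => h.symm, fun h => h.symm⟩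
  have e4 : (bar i = l) = (l = bar i) := propext ⟨fun h => h.symm, fun h => h.symm⟩
  have e5 : (bar k = i) = (k = bar i) := propext ⟨fun h => by rw [← h, hb], fun h => by rw [h, hb]⟩
  have e6 : (bar k = j) = (k = bar j) := propext ⟨fun h => by rw [← h, hb], fun h => by rw [h, hb]⟩
  have e7 : (bar l = i) = (l = bar i) := propext ⟨fun h => by rw [← h, hb], fun h => by rw [h, hb]⟩
  have e8 : (bar l = j) = (l = bar j) := propext ⟨fun h => by rw [← h, hb], fun h => by rw [h, hb]⟩
  have e9 : (i = bar k) = (k = bar i) := propext ⟨fun h => by rw [h, hb], fun h => by rw [h, hb]⟩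
  have e10 : (j = bar k) = (k = bar j) := propext ⟨fun h => by rw [h, hb], fun h => by rw [h, hb]⟩
  have e11 : (i = bar l) = (l = bar i) := propext ⟨fun h => by rw [h, hb], fun h => by rw [h, hb]⟩
  have e12 : (j = bar l) = (l = bar j) := propext ⟨fun h => by rw [h, hb], fun h => by rw [h, hb]⟩
  have fi : ∀ (p : Prop) [Decidable p] (x : LL ι s), (if p then x else 0).fst = if p then x.fst else 0 := by
    intro p _ x; split_ifs <;> rfl
  have si : ∀ (p : Prop) [Decidable p] (x : LL ι s), (if p then x else 0).snd = if p then x.snd else 0 := by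
    intro p _ x; split_ifs <;> rfl
  have key : Fm bar i j * Fm bar k l - Fm bar k l * Fm bar i j = 
    (if k = bar j then Fm bar i l else 0) - (if l = bar j then Fm bar i k else 0)
      - (if k = bar i then Fm bar j l else 0) + (if l = bar i then Fm bar j k else 0) := by
    simp only [Fm, mul_sub, sub_mul, ms, e1, e2, e3, e4, e5, e6, e7, e8]
    split_ifs <;> abel
  ext1
  · simp only [Ext.lie_fst, Ext.add_fst, Ext.sub_fst, fi, FF, AddMonoidAlgebra.single_mul_single, ZZ, Ext.smul_fst, smul_zero, ite_self, add_zero, sub_zero,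
      add_comm n m, ← AddMonoidAlgebra.single_sub, key]
    simp only [AddMonoidAlgebra.single_sub, AddMonoidAlgebra.single_add]
    congr 1; congr 1; congr 1
    all_goals split_ifs <;> simp
  · simp only [Ext.lie_snd, Ext.add_snd, Ext.sub_snd, si, FF, ite_self, sub_zero, add_zero, zero_add, ZZ, Ext.smul_snd, LM.D_single, mul_smul_comm, map_smul, AddMonoidAlgebra.single_mul_single, LM.T_single]
    by_cases h : m + n = s
    · simp only [h, if_true, true_and, Fm, mul_sub, sub_mul, ms, Matrix.trace_sub, e1, e2, e3, e4]
      have t : ∀ (p : Prop) [Decidable p] (x : Matrix ι ι ℂ), (if p then x else 0).trace = if p then x.trace else 0 := by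
        intro p _ x; split_ifs <;> simp
      have t2 : ∀ a b : ι, (Matrix.single a b (1:ℂ)).trace = if a = b then 1 else 0 := by
        intro a b
        split_ifs with h
        · subst h; simp
        · simp [Matrix.trace_single_eq_of_ne _ _ _ h]
      simp only [t, t2, e9, e10, e11, e12, smul_eq_mul]
      simp only [ite_and]
      split_ifs <;> ring
    · simp [h]

end Model
end Ell

namespace Ell
set_option linter.unusedSectionVars false
set_option linter.unusedSimpArgs false

section InjS
variable {G : Type*} [LieRing G] [LieAlgebra ℂ G]
variable {I : Type*} [DecidableEq I] [Fintype I]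
variable {gr : (I → ℤ) × ℤ → Submodule ℂ G} {k : I → ℤ} {es fs hs : I → ℤ → G} {c : I → G}

/-- weight data -/
structure WD (gr : (I → ℤ) × ℤ → Submodule ℂ G) (es fs hs : I → ℤ → G)
    (ba : I → (I → ℤ) →+ ℤ) (cc : I → ℤ) : Prop where
  ccpos : ∀ i, 0 < cc i
  cc2 : ∀ i, cc i * ba i (Pi.single i 1) = 2
  pos : ∀ n : I → ℤ, (∃ i, ba i n ≠ 0) → 0 < ∑ i, n i * ba i n
  wt : ∀ i d, ∀ x ∈ gr d, ⁅hs i 0, x⁆ = ((cc i * ba i d.1 : ℤ) : ℂ) • x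
  lne : ∀ i, LN (es i 0)
  lnf : ∀ i, LN (fs i 0)

theorem WD.inv {ba : I → (I → ℤ) →+ ℤ} {cc : I → ℤ} (w : WD gr es fs hs ba cc) :
    WD (fun d => gr (-d)) (fun i n => fs i (-n)) (fun i n => es i (-n)) (fun i n => - hs i (-n)) ba cc where
  ccpos := w.ccpos
  cc2 := w.cc2
  pos := w.pos
  wt i d x hx := by
    have := w.wt i _ x hx
    rw [neg_zero, neg_lie, this, Prod.fst_neg, map_neg, mul_neg]
    push_cast
    module
  lne i := by simpa using w.lnf i
  lnf i := by simpa using w.lne i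

theorem Tri.ad_pow (q : Tri gr k es fs hs c) (i : I) {d} {x : G} (hx : x ∈ gr d) (w : ℕ) :
    (LieAlgebra.ad ℂ G (fs i 0) ^ w) x ∈ gr (d - ((w:ℤ) • Pi.single i 1, 0)) := by
  induction w with
  | zero =>
    have e : d - (((0:ℕ):ℤ) • (Pi.single i 1 : I → ℤ), (0:ℤ)) = d := by ext1 <;> simp
    rw [e]; simpa using hx
  | succ n ih =>
    rw [pow_succ', Module.End.mul_apply, LieAlgebra.ad_apply]
    have := q.mul _ _ _ (q.f0 i) _ ih
    convert this using 2
    ext1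
    · funext t; simp; ring
    · simp

theorem map_ad_pow {L : Type*} [LieRing L] [LieAlgebra ℂ L] (Φ : G →ₗ⁅ℂ⁆ L) (e x : G) (w : ℕ) :
    Φ ((LieAlgebra.ad ℂ G e ^ w) x) = (LieAlgebra.ad ℂ L (Φ e) ^ w) (Φ x) := by
  induction w with
  | zero => simp
  | succ n ih => rw [pow_succ', pow_succ', Module.End.mul_apply, Module.End.mul_apply, LieAlgebra.ad_apply, LieHom.map_lie, ih, LieAlgebra.ad_apply]

theorem Tri.inj_pos {L : Type*} [LieRing L] [LieAlgebra ℂ L] (Φ : G →ₗ⁅ℂ⁆ L)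
    (q : Tri gr k es fs hs c) (hk : ∀ i, k i ≠ 0) {ba : I → (I → ℤ) →+ ℤ} {cc : I → ℤ} (w : WD gr es fs hs ba cc)
    (hΦ : ∀ i, Φ (es i 0) ≠ 0) (N : ℕ) : ∀ (n : I → ℤ) (r : ℤ), (∀ i, 0 ≤ n i) → (∑ i, n i ≤ N) → (∃ i, ba i n ≠ 0) →
    ∀ x ∈ gr (n, r), Φ x = 0 → x = 0 := by
  induction N with
  | zero =>
    intro n r h0 hN ⟨i, hi⟩
    exfalso
    have : n = 0 := by
      funext j
      have := Finset.single_le_sum (fun i _ => h0 i) (Finset.mem_univ j)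
      have := h0 j
      push_cast at hN; simp only [Pi.zero_apply]; omega
    rw [this, map_zero] at hi; exact hi rfl
  | succ N ih =>
    intro n r h0 hN hne x hx hx0
    have hp := w.pos n hne
    obtain ⟨i, -, hi⟩ := Finset.exists_lt_of_sum_lt (s := Finset.univ) (f := fun _ : I => (0:ℤ)) (g := fun i => n i * ba i n) (by simpa using hp)
    have hni : 0 < n i := by
      rcases (h0 i).lt_or_eq with h | h
      · exact h
      · rw [← h, zero_mul] at hi; exact absurd hi (lt_irrefl _)
    have hbi : 0 < ba i n := pos_of_mul_pos_right hi hni.le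
    by_cases hs1 : n = Pi.single i (n i)
    · rw [hs1] at hx
      rcases q.simple hk hni hx with h | ⟨-, m, -, t, rfl⟩
      · exact h
      · rw [map_smul] at hx0
        rcases smul_eq_zero.1 hx0 with h | h
        · rw [h, zero_smul]
        · exfalso
          have h2 := (q.loop i).he (-m) m
          have h3 := congrArg Φ h2
          rw [LieHom.map_lie, h, lie_zero, neg_add_cancel, map_smul] at h3
          exact hΦ i (by simpa using h3.symm)
    · have hcb : 0 < cc i * ba i n := mul_pos (w.ccpos i) hbi
      obtain ⟨W, hW⟩ := Int.eq_ofNat_of_zero_le hcb.le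
      obtain ⟨M, hM⟩ := w.lne i x
      refine (q.loop i).sl2_0.eq_zero (w := W) (N := M) ?_ hM ?_
      · have := w.wt i _ x hx
        rw [this]; simp only [hW]; simp
      · have hd := q.ad_pow i hx W
        have hz : Φ ((LieAlgebra.ad ℂ G (fs i 0) ^ W) x) = 0 := by
          rw [map_ad_pow, hx0, map_zero]
        rw [Prod.mk_sub_mk] at hd
        by_cases hneg : n i - W < 0
        · obtain ⟨j, hj⟩ : ∃ j, n j ≠ (Pi.single i (n i) : I → ℤ) j := by
            by_contra hcon; push Not at hcon; exact hs1 (funext hcon)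
          have hji : j ≠ i := by rintro rfl; simp at hj
          refine q.mixed (i := j) (j := i) ?_ ?_ hd
          · simp only [Pi.sub_apply, Pi.smul_apply, Pi.single_apply, hji, if_false, smul_zero, sub_zero]
            rw [Pi.single_apply, if_neg hji] at hj
            have := h0 j; omega
          · simpa using hneg
        · refine ih _ _ ?_ ?_ ⟨i, ?_⟩ _ hd hz
          · intro j
            by_cases hji : j = i
            · subst hji; simp; omega
            · simp [Pi.single_apply, hji, h0 j]
          · simp only [Pi.sub_apply, Finset.sum_sub_distrib, Pi.smul_apply, ← Finset.smul_sum]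
            rw [Finset.sum_pi_single' i 1 Finset.univ]
            simp
            push_cast at hN
            omega
          · have h1 : ba i (n - (W:ℤ) • Pi.single i 1) = - ba i n := by
              rw [map_sub, map_zsmul, smul_eq_mul]
              have h2 := w.cc2 i
              have h3 : (W:ℤ) = cc i * ba i n := hW.symm
              rw [h3]
              linear_combination (- ba i n) * h2
            rw [h1]; omega

/-- injectivity on anisotropic degrees -/
theorem Tri.inj {L : Type*} [LieRing L] [LieAlgebra ℂ L] (Φ : G →ₗ⁅ℂ⁆ L)
    (q : Tri gr k es fs hs c) (hk : ∀ i, k i ≠ 0) {ba : I → (I → ℤ) →+ ℤ} {cc : I → ℤ} (w : WD gr es fs hs ba cc)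
    (hΦ : ∀ i, Φ (es i 0) ≠ 0) (hΦ' : ∀ i, Φ (fs i 0) ≠ 0) (d : (I → ℤ) × ℤ) (hne : ∃ i, ba i d.1 ≠ 0)
    (x : G) (hx : x ∈ gr d) (hx0 : Φ x = 0) : x = 0 := by
  by_cases h1 : ∀ i, 0 ≤ d.1 i
  · exact q.inj_pos Φ hk w hΦ (∑ i, d.1 i).toNat d.1 d.2 h1 (Int.self_le_toNat _) hne x hx hx0
  · push Not at h1
    obtain ⟨j, hj⟩ := h1
    by_cases h2 : ∀ i, d.1 i ≤ 0
    · refine q.inv.inj_pos Φ hk w.inv (by simpa using hΦ') (∑ i, (-d.1) i).toNat (-d.1) (-d.2) (by simpa using h2) (Int.self_le_toNat _) ?_ x ?_ hx0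
      · obtain ⟨i, hi⟩ := hne; exact ⟨i, by simpa using hi⟩
      · simpa using hx
    · push Not at h2
      obtain ⟨i, hi⟩ := h2
      exact q.mixed hi hj hx
end InjS
end Ell

namespace Ell
set_option linter.unusedSectionVars false
set_option linter.unusedSimpArgs false

/-- signed indices -/
abbrev Sg (L : ℕ) := Fin (L+2) ⊕ Fin (L+2)
/-- matrix index set -/
abbrev Ix (L : ℕ) := Sg L ⊕ Fin 3
/-- degrees -/
abbrev Dg (L : ℕ) := (Fin (L+2) → ℤ) × (ℤ × ℤ)

variable {L : ℕ}

/-- the involution -/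
def br : Ix L → Ix L := Sum.map Sum.swap id

@[simp] theorem br_br (i : Ix L) : br (br i) = i := by
  rcases i with (p | p) | c <;> rfl
@[simp] theorem br_inl (x : Sg L) : br (Sum.inl x : Ix L) = Sum.inl x.swap := rfl
@[simp] theorem br_inr (c : Fin 3) : br (Sum.inr c : Ix L) = Sum.inr c := rfl

/-- weights of signed indices -/
def wtS : Sg L → Fin (L+2) → ℤ := Sum.elim (fun p => Pi.single p 1) (fun p => -Pi.single p 1)
/-- weights -/
def wt : Ix L → Fin (L+2) → ℤ := Sum.elim wtS (fun _ => 0)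
/-- parity class representatives -/
def cl : Fin 3 → ℤ × ℤ := ![(0,0), (1,0), (0,1)]
/-- parity classes -/
def cls : Ix L → ℤ × ℤ := Sum.elim (fun _ => 0) cl

@[simp] theorem wt_inl (x : Sg L) : wt (Sum.inl x : Ix L) = wtS x := rfl
@[simp] theorem wt_inr (c : Fin 3) : wt (Sum.inr c : Ix L) = 0 := rfl
@[simp] theorem cls_inl (x : Sg L) : cls (Sum.inl x : Ix L) = 0 := rfl
@[simp] theorem cls_inr (c : Fin 3) : cls (Sum.inr c : Ix L) = cl c := rfl
@[simp] theorem wtS_swap (x : Sg L) : wtS x.swap = - wtS x := by rcases x with p | p <;> simp [wtS]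
@[simp] theorem wt_br (i : Ix L) : wt (br i) = - wt i := by rcases i with x | c <;> simp
@[simp] theorem cls_br (i : Ix L) : cls (br i) = cls i := by rcases i with x | c <;> simp

/-- valid parity -/
def Vd (i j : Ix L) (m : ℤ × ℤ) : Prop := Even (m + cls i + cls j)

theorem even2 (m : ℤ × ℤ) : Even m ↔ Even m.1 ∧ Even m.2 := by
  constructor
  · rintro ⟨t, rfl⟩; exact ⟨⟨t.1, rfl⟩, ⟨t.2, rfl⟩⟩
  · rintro ⟨⟨a, ha⟩, ⟨b, hb⟩⟩; exact ⟨(a, b), Prod.ext ha hb⟩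

/-- basic element of the model -/
noncomputable abbrev F (s : ℤ × ℤ) (i j : Ix L) (m : ℤ × ℤ) : LL (Ix L) s := FF s br i j m

/-- graded pieces of the model -/
noncomputable def Ld (s : ℤ × ℤ) (d : Dg L) : Submodule ℂ (LL (Ix L) s) :=
  Submodule.span ℂ {x | (∃ i j, Vd i j d.2 ∧ wt i + wt j = d.1 ∧ x = F s i j d.2) ∨ (d = (0, s) ∧ x = ZZ _ s)}

theorem F_mem {s : ℤ × ℤ} {i j : Ix L} {m : ℤ × ℤ} (h : Vd i j m) : F s i j m ∈ Ld s (wt i + wt j, m) :=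
  Submodule.subset_span (Or.inl ⟨i, j, h, rfl, rfl⟩)

theorem F_mem' {s : ℤ × ℤ} {i j : Ix L} {m : ℤ × ℤ} {d : Dg L} (h : Vd i j m) (hd : d = (wt i + wt j, m)) : F s i j m ∈ Ld s d := by
  rw [hd]; exact F_mem h

theorem ev_aux {m n a b c : ℤ × ℤ} (h1 : Even (m + a + b)) (h2 : Even (n + b + c)) : Even (m + n + a + c) := by
  obtain ⟨u, hu⟩ := h1
  obtain ⟨v, hv⟩ := h2
  refine ⟨u + v - b, ?_⟩
  have : m + n + a + c = (m + a + b) + (n + b + c) - b - b := by abel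
  rw [this, hu, hv]; abel

theorem Vd.swap {i j : Ix L} {m : ℤ × ℤ} (h : Vd i j m) : Vd j i m := by
  unfold Vd at *; convert h using 1; abel

theorem F_lie_mem {s : ℤ × ℤ} {i j k l : Ix L} {m n : ℤ × ℤ} (h : Vd i j m) (h' : Vd k l n) :
    ⁅F s i j m, F s k l n⁆ ∈ Ld s (wt i + wt j + (wt k + wt l), m + n) := by
  rw [FF_lie s br_br]
  have z : (0 : LL (Ix L) s) ∈ Ld s (wt i + wt j + (wt k + wt l), m + n) := zero_mem _
  refine sub_mem (add_mem (add_mem (sub_mem (sub_mem ?_ ?_) ?_) ?_) ?_) ?_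
  · split_ifs with e
    · subst e
      exact F_mem' (ev_aux h (by simpa [Vd] using h')) (by simp)
    · exact z
  · split_ifs with e
    · subst e
      exact F_mem' (ev_aux h (by simpa [Vd] using h'.swap)) (by simp; abel)
    · exact z
  · split_ifs with e
    · subst e
      exact F_mem' (ev_aux h.swap (by simpa [Vd] using h')) (by simp; abel)
    · exact z
  · split_ifs with e
    · subst e
      exact F_mem' (ev_aux h.swap (by simpa [Vd] using h'.swap)) (by simp; abel)
    · exact z
  · split_ifs with e
    · obtain ⟨e1, rfl, rfl⟩ := e
      exact Submodule.smul_mem _ _ (Submodule.subset_span (Or.inr ⟨by simp [e1], rfl⟩))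
    · exact z
  · split_ifs with e
    · obtain ⟨e1, rfl, rfl⟩ := e
      exact Submodule.smul_mem _ _ (Submodule.subset_span (Or.inr ⟨by simp [e1]; abel, rfl⟩))
    · exact z

theorem Ld_lie {s : ℤ × ℤ} {d d' : Dg L} {x y : LL (Ix L) s} (hx : x ∈ Ld s d) (hy : y ∈ Ld s d') :
    ⁅x, y⁆ ∈ Ld s (d + d') := by
  induction hx using Submodule.span_induction with
  | zero => simp
  | add x y _ _ h1 h2 => rw [add_lie]; exact add_mem h1 h2
  | smul a x _ h => rw [smul_lie]; exact Submodule.smul_mem _ _ h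
  | mem x h =>
    induction hy using Submodule.span_induction with
    | zero => simp
    | add x y _ _ h1 h2 => rw [lie_add]; exact add_mem h1 h2
    | smul a x _ h => rw [lie_smul]; exact Submodule.smul_mem _ _ h
    | mem y h' =>
      rcases h with ⟨i, j, hv, hw, rfl⟩ | ⟨-, rfl⟩
      · rcases h' with ⟨i', j', hv', hw', rfl⟩ | ⟨-, rfl⟩
        · have := F_lie_mem (s := s) hv hv'
          rw [hw, hw'] at this; exact this
        · rw [lie_ZZ]; exact zero_mem _
      · rw [ZZ_lie]; exact zero_mem _

theorem wtS_inj {x z : Sg L} (h : wtS x = wtS z) : x = z := by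
  by_contra hxz
  rcases x with p | p <;> rcases z with q | q <;> have h1 := congrFun h p
  · have : p ≠ q := fun e => hxz (by rw [e])
    simp [wtS, Pi.single_apply, this] at h1
  · simp [wtS, Pi.single_apply] at h1; split_ifs at h1 <;> omega
  · simp [wtS, Pi.single_apply] at h1; split_ifs at h1 <;> omega
  · have : p ≠ q := fun e => hxz (by rw [e])
    simp [wtS, Pi.single_apply, this] at h1

theorem wtS_ne (x : Sg L) : wtS x ≠ 0 := by
  rcases x with p | p <;> intro h <;> have h1 := congrFun h p <;> simp [wtS] at h1

theorem cl_inj {c c' : Fin 3} (h : Even (cl c + cl c')) : c = c' := by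
  rw [even2] at h
  fin_cases c <;> fin_cases c' <;> simp [cl] at h ⊢

theorem wt_cls_inj {i j : Ix L} (h : wt i = wt j) (h' : Even (cls i + cls j)) : i = j := by
  rcases i with x | c <;> rcases j with z | c'
  · rw [wtS_inj h]
  · exact absurd h (wtS_ne x)
  · exact absurd h.symm (wtS_ne z)
  · rw [cl_inj h']

theorem wt_one {k : Ix L} {p : Fin (L+2)} (h : 1 ≤ wt k p) : k = Sum.inl (Sum.inl p) := by
  rcases k with (q | q) | c
  · by_cases hq : p = q
    · rw [hq]
    · simp [wtS, Pi.single_apply, hq] at h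
  · simp [wtS, Pi.single_apply] at h; split_ifs at h <;> simp at h
  · simp at h

theorem wt_nonneg {k : Ix L} {p : Fin (L+2)} (h : k ≠ Sum.inl (Sum.inr p)) : 0 ≤ wt k p := by
  rcases k with (q | q) | c
  · simp [wtS, Pi.single_apply]; split_ifs <;> norm_num
  · by_cases hq : p = q
    · exact absurd (by rw [hq]) h
    · simp [wtS, Pi.single_apply, hq]
  · simp

theorem wt_sum {x : Sg L} {j k l : Ix L} (hj : j ≠ Sum.inl x.swap) (h : wt k + wt l = wtS x + wt j) :
    (k = Sum.inl x ∧ wt l = wt j) ∨ (l = Sum.inl x ∧ wt k = wt j) := by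
  suffices H : k = Sum.inl x ∨ l = Sum.inl x by
    rcases H with rfl | rfl
    · left; refine ⟨rfl, ?_⟩; simpa using h
    · right; refine ⟨rfl, ?_⟩; rw [add_comm (wt k)] at h; simpa using h
  have A : ∀ (p : Fin (L+2)) (j k l : Ix L), j ≠ Sum.inl (Sum.inr p) → wt k + wt l = wtS (Sum.inl p) + wt j →
      k = Sum.inl (Sum.inl p) ∨ l = Sum.inl (Sum.inl p) := by
    intro p j k l hj h
    have h1 := congrFun h p
    have h2 := wt_nonneg hj
    simp [wtS] at h1
    by_contra hcon
    push Not at hcon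
    have h3 : ¬ 1 ≤ wt k p := fun h => hcon.1 (wt_one h)
    have h4 : ¬ 1 ≤ wt l p := fun h => hcon.2 (wt_one h)
    omega
  rcases x with p | p
  · exact A p j k l hj h
  · have := A p (br j) (br k) (br l) (fun e => hj (by rw [← br_br j, e]; rfl)) (by
      simp only [wt_br]
      have h2 : wtS (Sum.inr p : Sg L) = - wtS (Sum.inl p) := by simp [wtS]
      rw [h2] at h
      rw [← neg_add, h]; abel)
    rcases this with e | e
    · left; rw [← br_br k, e]; rfl
    · right; rw [← br_br l, e]; rfl

theorem Ld_le {s : ℤ × ℤ} {x : Sg L} {j : Ix L} (hj : j ≠ Sum.inl x.swap) (m : ℤ × ℤ) :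
    Ld s (wtS x + wt j, m) ≤ Submodule.span ℂ {y | ∃ j', wt j' = wt j ∧ Vd (Sum.inl x) j' m ∧ y = F s (Sum.inl x) j' m} := by
  refine Submodule.span_le.2 ?_
  rintro y (⟨k, l, hv, hw, rfl⟩ | ⟨h, rfl⟩)
  · rcases wt_sum hj hw with ⟨rfl, h⟩ | ⟨rfl, h⟩
    · exact Submodule.subset_span ⟨l, h, hv, rfl⟩
    · rw [SetLike.mem_coe, F, FF_swap]
      exact neg_mem (Submodule.subset_span ⟨k, h, hv.swap, rfl⟩)
  · exfalso
    rw [Prod.mk.injEq] at h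
    have h0 : wt (Sum.inr 0 : Ix L) + wt (Sum.inr 0 : Ix L) = wtS x + wt j := by rw [h.1]; simp
    rcases wt_sum hj h0 with ⟨h, -⟩ | ⟨h, -⟩ <;> simp at h

theorem Ld_big {s : ℤ × ℤ} {d : Dg L} (h : 2 < ∑ p, d.1 p ^ 2) : Ld s d = ⊥ := by
  rw [eq_bot_iff]
  refine Submodule.span_le.2 ?_
  have h1 : ∀ x : Sg L, ∑ p, wtS x p ^ 2 = 1 := by
    intro x
    rcases x with p | p <;> simp [wtS, Pi.single_apply]
  have h2 : ∀ x z : Sg L, x ≠ z → 0 ≤ - ∑ p, wtS x p * wtS z p := by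
    intro x z hxz
    rcases x with p | p <;> rcases z with q | q <;> simp [wtS, Pi.single_apply] <;> (try split_ifs) <;> simp_all
  rintro y (⟨k, l, hv, hw, rfl⟩ | ⟨rfl, rfl⟩)
  · by_cases hkl : k = l
    · subst hkl; simp [F, FF_self]
    · exfalso
      rw [← hw] at h
      have e : ∑ p, (wt k + wt l) p ^ 2 = ∑ p, wt k p ^ 2 + ∑ p, wt l p ^ 2 + 2 * ∑ p, wt k p * wt l p := by
        rw [← Finset.sum_add_distrib, Finset.mul_sum, ← Finset.sum_add_distrib]
        exact Finset.sum_congr rfl fun p _ => by simp; ring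
      rw [e] at h
      rcases k with x | c <;> rcases l with z | c'
      · have := h2 x z (by simpa using hkl)
        simp [h1] at h; omega
      · simp [h1] at h
      · simp [h1] at h
      · simp [h1] at h
  · simp at h

theorem F_ne {s : ℤ × ℤ} {i j : Ix L} {m : ℤ × ℤ} (h : i ≠ j) : F s i j m ≠ 0 := by
  intro h0
  have h1 := congrArg (fun x => (Ext.fst x).coeff m i (br j)) h0
  simp [F, FF, Fm, Matrix.single_apply, h, Ne.symm h] at h1

end Ell

namespace Ell
set_option linter.unusedSectionVars false
set_option linter.unusedSimpArgs false

variable {L : ℕ}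

/-- index of the simple root containing minus the given coordinate -/
def nx (p : Fin (L+2)) : Fin (L+3) := Fin.lastCases 0 (fun q => q.succ.succ) p
@[simp] theorem nx_last : nx (Fin.last (L+1)) = 0 := by simp [nx]
@[simp] theorem nx_cast (q : Fin (L+1)) : nx q.castSucc = q.succ.succ := by simp [nx]

/-- coordinates of the finite part -/
def bb (p : Fin (L+2)) : (Fin (L+3) → ℤ) →+ ℤ := Pi.evalAddMonoidHom (fun _ => ℤ) p.succ - Pi.evalAddMonoidHom (fun _ => ℤ) (nx p)
theorem bb_apply (p : Fin (L+2)) (n : Fin (L+3) → ℤ) : bb p n = n p.succ - n (nx p) := rfl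

/-- change of degree -/
def toD (d : (Fin (L+3) → ℤ) × ℤ) : Dg L := (fun p => bb p d.1, (d.1 0, d.2))

theorem toD_add (d d' : (Fin (L+3) → ℤ) × ℤ) : toD (d + d') = toD d + toD d' := by
  ext <;> simp [toD]
theorem toD_neg (d : (Fin (L+3) → ℤ) × ℤ) : toD (-d) = - toD d := by
  ext <;> simp [toD]

theorem toD_inj : Function.Injective (toD (L := L)) := by
  suffices H : ∀ d : (Fin (L+3) → ℤ) × ℤ, toD d = 0 → d = 0 by
    intro d d' h
    have := H (d + -d') (by rw [toD_add, toD_neg, h]; simp)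
    rwa [← sub_eq_add_neg, sub_eq_zero] at this
  intro d hd
  simp only [toD, Prod.mk_eq_zero] at hd
  obtain ⟨h1, h2, h3⟩ := hd
  have h4 : ∀ p, d.1 (Fin.succ p) = 0 := by
    intro p
    induction p using Fin.reverseInduction with
    | last => have := congrFun h1 (Fin.last _); simpa [bb_apply, h2] using this
    | cast q ih => have := congrFun h1 q.castSucc; simpa [bb_apply, ih] using this
  ext i
  · induction i using Fin.cases with
    | zero => exact h2
    | succ p => exact h4 p
  · exact h3

theorem toD_surj : Function.Surjective (toD (L := L)) := by
  rintro ⟨b, m, r⟩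
  refine ⟨(Fin.cases m (fun q => m + ∑ p, if q ≤ p then b p else 0), r), ?_⟩
  ext p
  · induction p using Fin.lastCases with
    | last => simp [toD, bb_apply, Fin.last_le_iff]
    | cast q =>
      simp only [toD, bb_apply, nx_cast, Fin.cases_succ, add_sub_add_left_eq_sub]
      rw [← Finset.sum_sub_distrib]
      have : ∀ p : Fin (L+2), ((if q.castSucc ≤ p then b p else 0) - if q.succ ≤ p then b p else 0) =
          if p = q.castSucc then b p else 0 := by
        intro p
        simp only [Fin.le_def, Fin.ext_iff, Fin.val_castSucc, Fin.val_succ]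
        split_ifs <;> first | omega | simp
      simp [this]
  · rfl
  · rfl

/-- first index -/
def nu (i : Fin (L+3)) : Sg L := Fin.cases (Sum.inr (Fin.last _)) (fun p => Sum.inl p) i
/-- second index -/
def nv (i : Fin (L+3)) : Ix L := Fin.cases (Sum.inr 1) (fun p => Fin.cases (Sum.inr 0) (fun q : Fin (L+1) => Sum.inl (Sum.inr q.castSucc)) p) i
/-- second index, star -/
def nw (i : Fin (L+3)) : Ix L := Fin.cases (Sum.inr 1) (fun p => Fin.cases (Sum.inr 2) (fun q : Fin (L+1) => Sum.inl (Sum.inr q.castSucc)) p) i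
/-- degree -/
def lam (i : Fin (L+3)) : ℤ × ℤ := Fin.cases (1,0) (fun _ => 0) i
/-- the map k -/
def kk (i : Fin (L+3)) : ℤ := Fin.cases 2 (fun p => Fin.cases 1 (fun _ => 2) p) i
/-- degree, star -/
def lamw (i : Fin (L+3)) : ℤ × ℤ := lam i + (0, kk i)
/-- two over square length -/
def cc (i : Fin (L+3)) : ℤ := Fin.cases 2 (fun p => Fin.cases 2 (fun _ => 1) p) i

theorem fc3 {P : Fin (L+3) → Prop} (h0 : P 0) (h1 : P 1) (h2 : ∀ q : Fin (L+1), P q.succ.succ) (i) : P i := by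
  induction i using Fin.cases with
  | zero => exact h0
  | succ p =>
    induction p using Fin.cases with
    | zero => exact h1
    | succ q => exact h2 q

@[simp] theorem nu0 : nu (0 : Fin (L+3)) = Sum.inr (Fin.last _) := rfl
@[simp] theorem nu1 : nu (1 : Fin (L+3)) = Sum.inl 0 := rfl
@[simp] theorem nu2 (q : Fin (L+1)) : nu q.succ.succ = Sum.inl q.succ := rfl
@[simp] theorem nv0 : nv (0 : Fin (L+3)) = Sum.inr 1 := rfl
@[simp] theorem nv1 : nv (1 : Fin (L+3)) = Sum.inr 0 := rfl
@[simp] theorem nv2 (q : Fin (L+1)) : nv q.succ.succ = Sum.inl (Sum.inr q.castSucc) := rfl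
@[simp] theorem nw0 : nw (0 : Fin (L+3)) = Sum.inr 1 := rfl
@[simp] theorem nw1 : nw (1 : Fin (L+3)) = Sum.inr 2 := rfl
@[simp] theorem nw2 (q : Fin (L+1)) : nw q.succ.succ = Sum.inl (Sum.inr q.castSucc) := rfl
@[simp] theorem lam0 : lam (0 : Fin (L+3)) = (1,0) := rfl
@[simp] theorem lam1 : lam (1 : Fin (L+3)) = 0 := rfl
@[simp] theorem lam2 (q : Fin (L+1)) : lam q.succ.succ = 0 := rfl
@[simp] theorem kk0 : kk (0 : Fin (L+3)) = 2 := rfl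
@[simp] theorem kk1 : kk (1 : Fin (L+3)) = 1 := rfl
@[simp] theorem kk2 (q : Fin (L+1)) : kk q.succ.succ = 2 := rfl
@[simp] theorem cc0 : cc (0 : Fin (L+3)) = 2 := rfl
@[simp] theorem cc1 : cc (1 : Fin (L+3)) = 2 := rfl
@[simp] theorem cc2 (q : Fin (L+1)) : cc q.succ.succ = 1 := rfl

theorem kk_ne (i : Fin (L+3)) : kk i ≠ 0 := by
  induction i using fc3 <;> simp
theorem cc_pos (i : Fin (L+3)) : 0 < cc i := by
  induction i using fc3 <;> simp

theorem nv_ne (i : Fin (L+3)) : (Sum.inl (nu i) : Ix L) ≠ nv i := by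
  induction i using fc3 <;> simp
theorem nw_ne (i : Fin (L+3)) : (Sum.inl (nu i) : Ix L) ≠ nw i := by
  induction i using fc3 <;> simp
theorem nv_bne (i : Fin (L+3)) : nv i ≠ br (Sum.inl (nu i)) := by
  induction i using fc3 <;> simp [Fin.ext_iff]
theorem nw_bne (i : Fin (L+3)) : nw i ≠ br (Sum.inl (nu i)) := by
  induction i using fc3 <;> simp [Fin.ext_iff]
theorem wt_nw (i : Fin (L+3)) : wt (nw i) = wt (nv i) := by
  induction i using fc3 <;> simp 

theorem nv_vd (i : Fin (L+3)) : Vd (Sum.inl (nu i)) (nv i) (lam i) := by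
  induction i using fc3 <;> simp [Vd, even2, cl]
theorem nw_vd (i : Fin (L+3)) : Vd (Sum.inl (nu i)) (nw i) (lamw i) := by
  induction i using fc3 <;> simp [Vd, even2, cl, lamw]

theorem toD_single (i : Fin (L+3)) (r : ℤ) : toD (Pi.single i 1, r) = (wtS (nu i) + wt (nv i), lam i + (0, r)) := by
  refine Prod.ext ?_ ?_
  · funext p
    simp only [toD, bb_apply, Pi.single_apply]
    induction i using fc3 with
    | h0 => 
      induction p using Fin.lastCases with
      | last => simp [wtS, Fin.succ_ne_zero]
      | cast q => simp [wtS, Fin.succ_ne_zero, Pi.single_apply, Fin.castSucc_ne_last]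
    | h1 => 
      have e : (1 : Fin (L+3)) = Fin.succ 0 := rfl
      induction p using Fin.lastCases with
      | last =>
        simp only [nu1, nv1, nx_last, wtS, Pi.single_apply, e, Fin.succ_inj]; simp [Pi.single_apply]
      | cast q =>
        simp only [nu1, nv1, nx_cast, wtS, Pi.single_apply, e, Fin.succ_inj]; simp [Pi.single_apply, Fin.succ_ne_zero]
    | h2 t =>
      induction p using Fin.lastCases with
      | last => simp [wtS, Pi.single_apply, (Fin.castSucc_ne_last _).symm]; simp only [← Fin.succ_last, Fin.succ_inj, (Fin.succ_ne_zero _).symm, if_false, sub_zero]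
      | cast q => 
        simp [wtS, Pi.single_apply, Fin.succ_inj, Fin.succ_ne_zero, Fin.castSucc_inj, sub_eq_add_neg]
  · simp only [toD]
    induction i using fc3 <;> simp [Fin.succ_ne_zero]

/-- pairing with simple roots -/
def ba (i : Fin (L+3)) : (Fin (L+3) → ℤ) →+ ℤ :=
  ∑ p, ((if p.succ = i then bb p else 0) - (if nx p = i then bb p else 0))

theorem ba_apply (i : Fin (L+3)) (n : Fin (L+3) → ℤ) : ba i n = ∑ p, bb p n * bb p (Pi.single i 1) := by
  rw [ba, AddMonoidHom.finsetSum_apply]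
  refine Finset.sum_congr rfl fun p _ => ?_
  simp only [AddMonoidHom.sub_apply, bb_apply p (Pi.single i 1), Pi.single_apply]
  split_ifs <;> simp

theorem sum_ba (n n' : Fin (L+3) → ℤ) : ∑ i, n i * ba i n' = ∑ p, bb p n * bb p n' := by
  simp only [ba_apply, Finset.mul_sum]
  rw [Finset.sum_comm]
  refine Finset.sum_congr rfl fun p _ => ?_
  have : n = ∑ i, n i • (Pi.single i 1 : Fin (L+3) → ℤ) := by
    funext j; simp [Finset.sum_apply, Pi.single_apply]
  conv_rhs => rw [this, map_sum, Finset.sum_mul]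
  refine Finset.sum_congr rfl fun i _ => ?_
  rw [map_zsmul]; simp; ring

theorem ba_pos (n : Fin (L+3) → ℤ) (h : ∃ i, ba i n ≠ 0) : 0 < ∑ i, n i * ba i n := by
  rw [sum_ba]
  by_contra hcon
  have h1 : ∑ p, bb p n * bb p n = 0 := le_antisymm (not_lt.1 hcon) (Finset.sum_nonneg fun p _ => mul_self_nonneg _)
  rw [Finset.sum_eq_zero_iff_of_nonneg (fun p _ => mul_self_nonneg _)] at h1
  obtain ⟨i, hi⟩ := h
  apply hi
  rw [ba_apply]
  exact Finset.sum_eq_zero fun p hp => by rw [mul_self_eq_zero.1 (h1 p hp), zero_mul]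

theorem ba_ne (d : (Fin (L+3) → ℤ) × ℤ) (h : (toD d).1 ≠ 0) : ∃ i, ba i d.1 ≠ 0 := by
  by_contra hcon
  push Not at hcon
  have h0 : ∑ i, d.1 i * ba i d.1 = 0 := by simp [hcon]
  rw [sum_ba, Finset.sum_eq_zero_iff_of_nonneg (fun p _ => mul_self_nonneg _)] at h0
  apply h
  funext p
  exact mul_self_eq_zero.1 (h0 p (Finset.mem_univ _))

theorem sum_wtS (x : Sg L) : ∑ p, wtS x p * wtS x p = 1 := by
  rcases x with p | p <;> simp [wtS, Pi.single_apply]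

theorem ba_cc (i : Fin (L+3)) : cc i * ba i (Pi.single i 1) = 2 := by
  rw [ba_apply]
  have : ∀ p, bb p (Pi.single i 1) = wtS (nu i) p + wt (nv i) p := by
    intro p
    exact congrFun (congrArg Prod.fst (toD_single i 0)) p
  simp only [this]
  induction i using fc3 with
  | h0 => simp [sum_wtS]
  | h1 => simp [sum_wtS]
  | h2 q =>
    simp [wtS, Pi.single_apply, mul_add, add_mul, Finset.sum_add_distrib]
    simp [Fin.ext_iff]

end Ell

namespace Ell
set_option linter.unusedSectionVars false
set_option linter.unusedSimpArgs false

section DatS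
variable {L : ℕ} {G : Type*} [LieRing G] [LieAlgebra ℂ G]

/-- full data -/
structure Dat (s : ℤ × ℤ) (gD : Dg L → Submodule ℂ G) (es fs hs : Fin (L+3) → ℤ → G) (c : Fin (L+3) → G)
    (Φ : G →ₗ⁅ℂ⁆ LL (Ix L) s) : Prop where
  ind : iSupIndep gD
  mul : ∀ d d', ∀ x ∈ gD d, ∀ y ∈ gD d', ⁅x, y⁆ ∈ gD (d + d')
  tri : Tri (fun d => gD (toD d)) kk es fs hs c
  wd : WD (fun d => gD (toD d)) es fs hs ba cc
  pe0 : ∀ i, Φ (es i 0) = F s (Sum.inl (nu i)) (nv i) (lam i)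
  pe1 : ∀ i, Φ (es i 1) = F s (Sum.inl (nu i)) (nw i) (lamw i)
  pf0 : ∀ i, Φ (fs i 0) = (-(cc i : ℂ)) • F s (br (Sum.inl (nu i))) (br (nv i)) (-lam i)
  pf1 : ∀ i, Φ (fs i (-1)) = (-(cc i : ℂ)) • F s (br (Sum.inl (nu i))) (br (nw i)) (-lamw i)

variable {s : ℤ × ℤ} {gD : Dg L → Submodule ℂ G} {es fs hs : Fin (L+3) → ℤ → G} {c : Fin (L+3) → G}
    {Φ : G →ₗ⁅ℂ⁆ LL (Ix L) s}

theorem Dat.de0 (q : Dat s gD es fs hs c Φ) (i) : es i 0 ∈ gD (wt (Sum.inl (nu i)) + wt (nv i), lam i) := by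
  have := q.tri.e0 i
  rw [toD_single, show ((0:ℤ),(0:ℤ)) = 0 from rfl, add_zero] at this; exact this
theorem Dat.de1 (q : Dat s gD es fs hs c Φ) (i) : es i 1 ∈ gD (wt (Sum.inl (nu i)) + wt (nw i), lamw i) := by
  have := q.tri.e1 i
  rw [toD_single] at this; simpa [wt_nw, lamw] using this
theorem Dat.df0 (q : Dat s gD es fs hs c Φ) (i) : fs i 0 ∈ gD (wt (br (Sum.inl (nu i))) + wt (br (nv i)), -lam i) := by
  have := q.tri.f0 i
  have e : ((-Pi.single i 1, 0) : (Fin (L+3) → ℤ) × ℤ) = -(Pi.single i 1, 0) := by simp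
  rw [e, toD_neg, toD_single] at this
  convert this using 2
  simp; abel
theorem Dat.df1 (q : Dat s gD es fs hs c Φ) (i) : fs i (-1) ∈ gD (wt (br (Sum.inl (nu i))) + wt (br (nw i)), -lamw i) := by
  have := q.tri.f1 i
  have e : ((-Pi.single i 1, -kk i) : (Fin (L+3) → ℤ) × ℤ) = -(Pi.single i 1, kk i) := by simp
  rw [e, toD_neg, toD_single] at this
  convert this using 2
  simp [wt_nw, lamw]; abel

theorem Vd_br {i j : Ix L} {m : ℤ × ℤ} (h : Vd i j m) : Vd (br i) (br j) (-m) := by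
  unfold Vd at *
  obtain ⟨t, ht⟩ := h
  refine ⟨t - m, ?_⟩
  rw [cls_br, cls_br]
  have : -m + cls i + cls j = (m + cls i + cls j) - m - m := by abel
  rw [this, ht]; abel

theorem Dat.img (q : Dat s gD es fs hs c Φ) (d : Dg L) : gD d ≤ (Ld s d).comap (Φ : G →ₗ[ℂ] LL (Ix L) s) := by
  have key := iSupIndep_extract (A := fun d => gD d ⊓ (Ld s d).comap (Φ : G →ₗ[ℂ] LL (Ix L) s)) q.ind (fun d => inf_le_left) ?_ d
  · exact key.trans inf_le_right
  have hom : ∀ x : G, (∃ i, x = es i 0 ∨ x = es i 1 ∨ x = fs i 0 ∨ x = fs i (-1)) →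
      ∃ d, x ∈ gD d ⊓ (Ld s d).comap (Φ : G →ₗ[ℂ] LL (Ix L) s) := by
    rintro x ⟨i, rfl | rfl | rfl | rfl⟩
    · refine ⟨_, q.de0 i, ?_⟩
      change Φ _ ∈ Ld s _; rw [q.pe0]; exact F_mem (nv_vd i)
    · refine ⟨_, q.de1 i, ?_⟩
      change Φ _ ∈ Ld s _; rw [q.pe1]; exact F_mem (nw_vd i)
    · refine ⟨_, q.df0 i, ?_⟩
      change Φ _ ∈ Ld s _; rw [q.pf0]; exact Submodule.smul_mem _ _ (F_mem (Vd_br (nv_vd i)))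
    · refine ⟨_, q.df1 i, ?_⟩
      change Φ _ ∈ Ld s _; rw [q.pf1]; exact Submodule.smul_mem _ _ (F_mem (Vd_br (nw_vd i)))
  refine gen_top q.tri.gen ?_ ?_
  · intro x hx
    obtain ⟨d, hd⟩ := hom x hx
    exact Submodule.mem_iSup_of_mem d hd
  · intro x hx y hy
    obtain ⟨d, hd, hd'⟩ := hom x hx
    induction hy using Submodule.iSup_induction' with
    | mem d' y hy =>
      refine Submodule.mem_iSup_of_mem (d + d') ⟨q.mul _ _ _ hd _ hy.1, ?_⟩
      change Φ _ ∈ Ld s _; rw [LieHom.map_lie]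
      exact Ld_lie hd' hy.2
    | zero => rw [lie_zero]; exact zero_mem _
    | add y z _ _ h1 h2 => rw [lie_add]; exact add_mem h1 h2

theorem br_ne {i j : Ix L} (h : i ≠ j) : br i ≠ br j := fun e => h (by rw [← br_br i, e, br_br])

theorem Dat.inj (q : Dat s gD es fs hs c Φ) {d : Dg L} (hd : d.1 ≠ 0) {x y : G} (hx : x ∈ gD d) (hy : y ∈ gD d)
    (h : Φ x = Φ y) : x = y := by
  obtain ⟨d', rfl⟩ := toD_surj d
  refine sub_eq_zero.1 (q.tri.inj Φ kk_ne q.wd ?_ ?_ d' (ba_ne d' hd) (x - y) (sub_mem hx hy) (by rw [map_sub, h, sub_self]))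
  · intro i; rw [q.pe0]; exact F_ne (nv_ne i)
  · intro i; rw [q.pf0]
    refine smul_ne_zero ?_ (F_ne (br_ne (nv_ne i)))
    rw [neg_ne_zero]; exact_mod_cast (cc_pos i).ne'

def Lf (gD : Dg L → Submodule ℂ G) (Φ : G →ₗ⁅ℂ⁆ LL (Ix L) s) (i j : Ix L) (m : ℤ × ℤ) : Prop :=
  ∃ x ∈ gD (wt i + wt j, m), Φ x = F s i j m

theorem Lf.swap {i j : Ix L} {m : ℤ × ℤ} (h : Lf gD Φ i j m) : Lf gD Φ j i m := by
  obtain ⟨x, hx, h⟩ := h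
  exact ⟨-x, by rw [add_comm (wt j)]; exact neg_mem hx, by rw [map_neg, h, F, FF_swap, neg_neg]⟩

theorem F_lie1 {i j l : Ix L} (m n : ℤ × ℤ) (h1 : i ≠ j) (h2 : l ≠ br i) (h3 : l ≠ br j) :
    ⁅F s i j m, F s (br j) l n⁆ = F s i l (m + n) := by
  rw [FF_lie s br_br]
  simp [h2, h3, (br_ne h1).symm]

theorem Lf.tr (q : Dat s gD es fs hs c Φ) {i j k l : Ix L} {m n : ℤ × ℤ} (h : Lf gD Φ i j m) (h' : Lf gD Φ k l n)
    (hk : k = br j) (h1 : i ≠ j) (h2 : l ≠ br i) (h3 : l ≠ br j) : Lf gD Φ i l (m + n) := by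
  subst hk
  obtain ⟨x, hx, h⟩ := h
  obtain ⟨y, hy, h'⟩ := h'
  refine ⟨⁅x, y⁆, ?_, by rw [LieHom.map_lie, h, h', F_lie1 m n h1 h2 h3]⟩
  convert q.mul _ _ _ hx _ hy using 2
  simp

theorem Dat.le0 (q : Dat s gD es fs hs c Φ) (i) : Lf gD Φ (Sum.inl (nu i)) (nv i) (lam i) := ⟨_, q.de0 i, q.pe0 i⟩
theorem Dat.le1 (q : Dat s gD es fs hs c Φ) (i) : Lf gD Φ (Sum.inl (nu i)) (nw i) (lamw i) := ⟨_, q.de1 i, q.pe1 i⟩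
theorem cc_inv (i : Fin (L+3)) : (-(cc i : ℂ))⁻¹ * (-(cc i : ℂ)) = 1 := by
  have : (cc i : ℂ) ≠ 0 := by exact_mod_cast (cc_pos i).ne'
  field_simp
theorem Dat.lf0 (q : Dat s gD es fs hs c Φ) (i) : Lf gD Φ (br (Sum.inl (nu i))) (br (nv i)) (-lam i) := 
  ⟨(-(cc i : ℂ))⁻¹ • fs i 0, Submodule.smul_mem _ _ (q.df0 i), by
    rw [map_smul, q.pf0 i, smul_smul, cc_inv, one_smul]⟩
theorem Dat.lf1 (q : Dat s gD es fs hs c Φ) (i) : Lf gD Φ (br (Sum.inl (nu i))) (br (nw i)) (-lamw i) := 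
  ⟨(-(cc i : ℂ))⁻¹ • fs i (-1), Submodule.smul_mem _ _ (q.df1 i), by
    rw [map_smul, q.pf1 i, smul_smul, cc_inv, one_smul]⟩

theorem swap_ne {x z : Sg L} (h : x ≠ z) : x.swap ≠ z.swap := fun e => h (by rw [← Sum.swap_swap x, e, Sum.swap_swap])
theorem swap_ne_self (x : Sg L) : x.swap ≠ x := by rcases x with p | p <;> simp

theorem third (x : Sg L) : ∃ w : Sg L, w ≠ x ∧ w ≠ x.swap := by
  rcases x with p | p
  · obtain ⟨r, hr⟩ := exists_ne p
    exact ⟨Sum.inl r, by simpa using hr, by simp⟩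
  · obtain ⟨r, hr⟩ := exists_ne p
    exact ⟨Sum.inr r, by simpa using hr, by simp⟩

/-- short lifts -/
def SS (gD : Dg L → Submodule ℂ G) (Φ : G →ₗ⁅ℂ⁆ LL (Ix L) s) (a : Fin 3) (m : ℤ × ℤ) : Prop :=
  ∀ x : Sg L, Lf gD Φ (Sum.inl x) (Sum.inr a) m
/-- long lifts -/
def TT (gD : Dg L → Submodule ℂ G) (Φ : G →ₗ⁅ℂ⁆ LL (Ix L) s) (m : ℤ × ℤ) : Prop :=
  ∀ x z : Sg L, z ≠ x.swap → Lf gD Φ (Sum.inl x) (Sum.inl z) m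

theorem Dat.ss00 (q : Dat s gD es fs hs c Φ) : SS gD Φ 0 0 := by
  have A : ∀ p : Fin (L+2), Lf gD Φ (Sum.inl (Sum.inl p)) (Sum.inr 0) 0 ∧ Lf gD Φ (Sum.inl (Sum.inr p)) (Sum.inr 0) 0 := by
    intro p
    induction p using Fin.induction with
    | zero =>
      have h1 := q.le0 1
      have h2 := q.lf0 1
      simp at h1 h2
      exact ⟨h1, h2⟩
    | succ t ih =>
      have h1 := q.le0 t.succ.succ
      have h2 := q.lf0 t.succ.succ
      simp at h1 h2
      have h1' := h1.tr q ih.1 rfl (by simp) (by simp) (by simp)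
      have h2' := h2.tr q ih.2 rfl (by simp) (by simp) (by simp)
      rw [add_zero] at h1' h2'
      exact ⟨h1', h2'⟩
  rintro (p | p)
  exacts [(A p).1, (A p).2]

theorem Dat.ss_tt (q : Dat s gD es fs hs c Φ) {a : Fin 3} {m n : ℤ × ℤ} (h : SS gD Φ a m) (h' : SS gD Φ a n) : TT gD Φ (m + n) := by
  intro x z hz
  exact (h x).tr q (h' z).swap rfl (by simp) (by simpa using hz) (by simp)

theorem Dat.tt0 (q : Dat s gD es fs hs c Φ) : TT gD Φ 0 := by
  have := q.ss_tt q.ss00 q.ss00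
  rwa [add_zero] at this

theorem Dat.tr_st (q : Dat s gD es fs hs c Φ) {x z : Sg L} {a : Fin 3} {m n : ℤ × ℤ} (h : Lf gD Φ (Sum.inl x) (Sum.inr a) m)
    (h' : TT gD Φ n) (h1 : z ≠ x) (h2 : z ≠ x.swap) : Lf gD Φ (Sum.inl z) (Sum.inr a) (m + n) := by
  rw [add_comm]
  exact (h' z x.swap (swap_ne h1).symm).tr q h (by simp) (by simpa using h2) (by simp) (by simp)

theorem Dat.move (q : Dat s gD es fs hs c Φ) {x : Sg L} {a : Fin 3} {m n : ℤ × ℤ} (h : Lf gD Φ (Sum.inl x) (Sum.inr a) m)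
    (h' : TT gD Φ n) : SS gD Φ a (m + n) := by
  intro z
  by_cases h1 : z = x ∨ z = x.swap
  · obtain ⟨w, hw1, hw2⟩ := third x
    have := (q.tr_st (q.tr_st h h' hw1 hw2) q.tt0 (z := z))
    rw [add_zero] at this
    refine this ?_ ?_
    · rintro rfl; tauto
    · intro e
      rcases h1 with rfl | rfl
      · exact hw2 (by rw [e]; simp)
      · exact swap_ne hw1.symm e
  · push Not at h1
    exact q.tr_st h h' h1.1 h1.2

theorem Dat.shift (q : Dat s gD es fs hs c Φ) {n : ℤ × ℤ} (hn : Even n) {a : Fin 3} {m : ℤ × ℤ} (h : SS gD Φ a m) : SS gD Φ a (m + n) := by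
  let Sh (n : ℤ × ℤ) : Prop := ∀ a m, SS gD Φ a m → SS gD Φ a (m + n)
  have hadd : ∀ n n', Sh n → Sh n' → Sh (n + n') := by
    intro n n' h h' a m hm
    rw [← add_assoc]; exact h' _ _ (h _ _ hm)
  have h0 : Sh 0 := by intro a m hm; rwa [add_zero]
  have htt : ∀ n, TT gD Φ n → Sh n := fun n hn a m hm => q.move (hm (Sum.inl 0)) hn
  have hz : ∀ n, Sh n → Sh (-n) → ∀ t : ℤ, Sh (t • n) := by
    intro n h h' t
    induction t using Int.induction_on with
    | zero => rw [zero_smul]; exact h0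
    | succ t ih => rw [add_smul, one_smul]; exact hadd _ _ ih h
    | pred t ih => rw [sub_smul, one_smul, sub_eq_add_neg]; exact hadd _ _ ih h'
  have m1 : ∀ {x : Sg L} {a : Fin 3} {m : ℤ × ℤ}, Lf gD Φ (Sum.inl x) (Sum.inr a) m → SS gD Φ a m := by
    intro x a m h
    have := q.move h q.tt0
    rwa [add_zero] at this
  have a1 : SS gD Φ 1 (1,0) := by have := q.le0 0; simp at this; exact m1 this
  have a2 : SS gD Φ 1 (-1,0) := by have := q.lf0 0; simp at this; exact m1 this
  have a3 : SS gD Φ 2 (0,1) := by have := q.le1 1; simp [lamw] at this; exact m1 this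
  have a4 : SS gD Φ 2 (0,-1) := by have := q.lf1 1; simp [lamw] at this; exact m1 this
  have b1 := hz _ (htt _ (q.ss_tt a1 a1)) (htt _ (by have := q.ss_tt a2 a2; simpa using this))
  have b2 := hz _ (htt _ (q.ss_tt a3 a3)) (htt _ (by have := q.ss_tt a4 a4; simpa using this))
  obtain ⟨t, rfl⟩ := hn
  have : t + t = t.1 • ((1, 0) + (1, 0)) + t.2 • ((0, 1) + (0, 1)) := by
    ext <;> simp <;> ring
  rw [this]
  exact hadd _ _ (b1 _) (b2 _) _ _ h

theorem Dat.ss (q : Dat s gD es fs hs c Φ) {a : Fin 3} {m : ℤ × ℤ} (h : Even (m + cl a)) : SS gD Φ a m := by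
  have m1 : ∀ {x : Sg L} {a : Fin 3} {m : ℤ × ℤ}, Lf gD Φ (Sum.inl x) (Sum.inr a) m → SS gD Φ a m := by
    intro x a m h
    have := q.move h q.tt0
    rwa [add_zero] at this
  have A : SS gD Φ a (cl a) := by
    fin_cases a
    · exact q.ss00
    · have := q.le0 0; simp at this; exact m1 this
    · have := q.le1 1; simp [lamw] at this; exact m1 this
  have := q.shift (n := m - cl a) (by
    obtain ⟨t, ht⟩ := h
    refine ⟨t - cl a, ?_⟩
    have : m - cl a = (m + cl a) - cl a - cl a := by abel
    rw [this, ht]; abel) A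
  rwa [add_sub_cancel] at this

theorem Dat.tt (q : Dat s gD es fs hs c Φ) {m : ℤ × ℤ} (h : Even m) : TT gD Φ m := by
  have := q.ss_tt q.ss00 (q.ss (a := 0) (m := m) (by simpa [cl, show ((0:ℤ),(0:ℤ)) = 0 from rfl] using h))
  rwa [zero_add] at this

end DatS
end Ell

namespace Ell
set_option linter.unusedSectionVars false
set_option linter.unusedSimpArgs false

/-- short parity -/
def Ev (a : Fin 3) (n : ℤ × ℤ) : Prop := Even (n + cl a)
theorem cl_zero : cl 0 = 0 := rfl
theorem Ev.zero {n : ℤ × ℤ} (h : Even n) : Ev 0 n := by rw [Ev, cl_zero, add_zero]; exact h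
theorem Ev.even {n : ℤ × ℤ} (h : Ev 0 n) : Even n := by rwa [Ev, cl_zero, add_zero] at h
theorem Ev.add {a : Fin 3} {n m : ℤ × ℤ} (h : Ev a n) (hm : Even m) : Ev a (n + m) := by
  rw [Ev, add_right_comm]; exact Even.add h hm
theorem Ev.add' {a : Fin 3} {n m : ℤ × ℤ} (h : Ev a n) (hm : Even m) : Ev a (m + n) := by
  rw [add_comm]; exact h.add hm
theorem Ev.clm (a : Fin 3) : Ev a (Ell.cl a) := ⟨_, rfl⟩
theorem Ev.sub {a : Fin 3} {n m : ℤ × ℤ} (h : Ev a n) (hm : Ev a m) : Even (n - m) := by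
  have := Even.sub h hm
  rwa [add_sub_add_right_eq_sub] at this
theorem Ev.sum {a : Fin 3} {n m : ℤ × ℤ} (h : Ev a n) (hm : Ev a m) : Even (n + m) := by
  have h1 : n + m = (n - m) + (m + m) := by abel
  rw [h1]; exact (h.sub hm).add ⟨_, rfl⟩
theorem Ev.refl {a : Fin 3} {s n : ℤ × ℤ} (h : Ev a n) (hs : Even s) : Ev a (s - n) := by
  obtain ⟨t, rfl⟩ := hs
  obtain ⟨r, hr⟩ := h
  refine ⟨t + cl a - r, ?_⟩
  have : t + t - n + cl a = t + t - (n + cl a) + cl a + cl a := by abel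
  rw [this, hr]; abel
theorem even0 : Even (0 : ℤ × ℤ) := ⟨0, rfl⟩

section DatS
variable {L : ℕ} {G : Type*} [LieRing G] [LieAlgebra ℂ G]

/-- chosen lifts -/
structure LD (s : ℤ × ℤ) (gD : Dg L → Submodule ℂ G) (Φ : G →ₗ⁅ℂ⁆ LL (Ix L) s)
    (S : Sg L → Fin 3 → ℤ × ℤ → G) (T : Sg L → Sg L → ℤ × ℤ → G) : Prop where
  sg : ∀ x a n, Ev a n → S x a n ∈ gD (wtS x, n)
  sp : ∀ x a n, Ev a n → Φ (S x a n) = F s (Sum.inl x) (Sum.inr a) n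
  tg : ∀ x z n, z ≠ x.swap → Even n → T x z n ∈ gD (wtS x + wtS z, n)
  tp : ∀ x z n, z ≠ x.swap → Even n → Φ (T x z n) = F s (Sum.inl x) (Sum.inl z) n

variable {s : ℤ × ℤ} {gD : Dg L → Submodule ℂ G} {es fs hs : Fin (L+3) → ℤ → G} {c : Fin (L+3) → G}
    {Φ : G →ₗ⁅ℂ⁆ LL (Ix L) s} {S : Sg L → Fin 3 → ℤ × ℤ → G} {T : Sg L → Sg L → ℤ × ℤ → G}

theorem Dat.exLD (q : Dat s gD es fs hs c Φ) : ∃ S T, LD s gD Φ S T := by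
  have h1 : ∀ (x : Sg L) (a : Fin 3) (n : ℤ × ℤ), ∃ t : G, Ev a n → t ∈ gD (wtS x, n) ∧ Φ t = F s (Sum.inl x) (Sum.inr a) n := by
    intro x a n
    by_cases h : Ev a n
    · obtain ⟨t, h1, h2⟩ := q.ss h x
      exact ⟨t, fun _ => ⟨by simpa using h1, h2⟩⟩
    · exact ⟨0, fun h' => absurd h' h⟩
  have h2 : ∀ (x z : Sg L) (n : ℤ × ℤ), ∃ t : G, z ≠ x.swap → Even n → t ∈ gD (wtS x + wtS z, n) ∧ Φ t = F s (Sum.inl x) (Sum.inl z) n := by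
    intro x z n
    by_cases h : z ≠ x.swap ∧ Even n
    · obtain ⟨t, h1, h2⟩ := q.tt h.2 x z h.1
      exact ⟨t, fun _ _ => ⟨by simpa using h1, h2⟩⟩
    · exact ⟨0, fun h1 h2 => absurd ⟨h1, h2⟩ h⟩
  choose S hS using h1
  choose T hT using h2
  exact ⟨S, T, fun x a n h => (hS x a n h).1, fun x a n h => (hS x a n h).2,
    fun x z n h h' => (hT x z n h h').1, fun x z n h h' => (hT x z n h h').2⟩

theorem wtS_add_ne {x z : Sg L} (h : z ≠ x.swap) : wtS x + wtS z ≠ 0 := by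
  intro h0
  apply h
  apply wtS_inj
  rw [wtS_swap, eq_neg_iff_add_eq_zero, add_comm (wtS z), h0]

variable (q : Dat s gD es fs hs c Φ) (r : LD s gD Φ S T)
include q r

theorem LD.mg {x : Sg L} {a b : Fin 3} {n n' : ℤ × ℤ} {z : Sg L} (ha : Ev a n) (hb : Ev b n') :
    ⁅S x a n, S z b n'⁆ ∈ gD (wtS x + wtS z, n + n') := q.mul _ _ _ (r.sg _ _ _ ha) _ (r.sg _ _ _ hb)

theorem LD.r1 {x z w : Sg L} {a : Fin 3} {m n : ℤ × ℤ} (hw : w = z.swap) (h1 : z ≠ x) (h2 : z ≠ x.swap) (hm : Even m) (hn : Ev a n) :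
    ⁅T x z m, S w a n⁆ = S x a (m + n) := by
  subst hw
  refine q.inj (d := (wtS x, m + n)) (wtS_ne x) ?_ (r.sg _ _ _ (hn.add' hm)) ?_
  · convert q.mul _ _ _ (r.tg x z m h2 hm) _ (r.sg z.swap a n hn) using 2
    simp
  · rw [LieHom.map_lie, r.tp x z m h2 hm, r.sp _ _ _ hn, r.sp _ _ _ (hn.add' hm)]
    exact F_lie1 m n (by simpa using h1.symm) (by simp) (by simp)

theorem LD.r2 {x z w : Sg L} {a : Fin 3} {m n : ℤ × ℤ} (hw : w = x.swap) (h1 : z ≠ x) (h2 : z ≠ x.swap) (hm : Even m) (hn : Ev a n) :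
    ⁅T x z m, S w a n⁆ = - S z a (m + n) := by
  subst hw
  refine q.inj (d := (wtS z, m + n)) (wtS_ne z) ?_ (neg_mem (r.sg _ _ _ (hn.add' hm))) ?_
  · convert q.mul _ _ _ (r.tg x z m h2 hm) _ (r.sg x.swap a n hn) using 2
    simp
  · rw [LieHom.map_lie, map_neg, r.tp x z m h2 hm, r.sp _ _ _ hn, r.sp _ _ _ (hn.add' hm), F, FF_swap, neg_lie]
    congr 1
    exact F_lie1 m n (by simpa using h1) (by simp) (by simp)

theorem LD.r3 {x z : Sg L} {a : Fin 3} {m n : ℤ × ℤ} (h1 : z ≠ x) (h2 : z ≠ x.swap) (hm : Ev a m) (hn : Ev a n) :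
    ⁅S x a m, S z a n⁆ = - T x z (m + n) := by
  refine q.inj (d := (wtS x + wtS z, m + n)) (wtS_add_ne h2) (r.mg q hm hn) (neg_mem (r.tg _ _ _ h2 (hm.sum hn))) ?_
  rw [LieHom.map_lie, map_neg, r.tp x z _ h2 (hm.sum hn), r.sp _ _ _ hn, r.sp _ _ _ hm, FF_lie s br_br]
  simp [h1, h2]

theorem LD.r3' {x z : Sg L} {a b : Fin 3} {m n : ℤ × ℤ} (hab : a ≠ b) (h1 : z ≠ x) (h2 : z ≠ x.swap) (hm : Ev a m) (hn : Ev b n) :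
    ⁅S x a m, S z b n⁆ = 0 := by
  refine q.inj (d := (wtS x + wtS z, m + n)) (wtS_add_ne h2) (r.mg q hm hn) (zero_mem _) ?_
  rw [LieHom.map_lie, map_zero, r.sp _ _ _ hn, r.sp _ _ _ hm, FF_lie s br_br]
  simp [h1, h2, hab.symm]

/-- the basic Jacobi identity -/
theorem LD.jac {x w : Sg L} {a b : Fin 3} {m n n' : ℤ × ℤ} (h1 : w ≠ x) (h2 : w ≠ x.swap) (hm : Even m) (hn : Ev a n) (hn' : Ev b n') :
    ⁅T x w.swap m, ⁅S w a n, S x.swap b n'⁆⁆ = ⁅S x a (m + n), S x.swap b n'⁆ - ⁅S w a n, S w.swap b (m + n')⁆ := by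
  have e1 : w.swap ≠ x := fun e => h2 (by rw [← e, Sum.swap_swap])
  rw [leibniz_lie, r.r1 q (by simp) e1 (swap_ne h1) hm hn, r.r2 q rfl e1 (swap_ne h1) hm hn', lie_neg, sub_eq_add_neg]

theorem LD.lift_span {d : Dg L} (hd : d.1 ≠ 0) {A : Set G} (hA : A ⊆ gD d) {y : G} (hy : y ∈ gD d)
    (h : Φ y ∈ Submodule.span ℂ (Φ '' A)) : y ∈ Submodule.span ℂ A := by
  have h1 : Submodule.span ℂ (Φ '' A) = (Submodule.span ℂ A).map (Φ : G →ₗ[ℂ] LL (Ix L) s) := by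
    rw [Submodule.map_span]; rfl
  rw [h1] at h
  obtain ⟨t, ht, h⟩ := h
  have : y = t := q.inj hd hy (Submodule.span_le.2 hA ht) h.symm
  rwa [this]

theorem LD.span_s (x : Sg L) (n : ℤ × ℤ) : gD (wtS x, n) ≤ Submodule.span ℂ {t | ∃ a, Ev a n ∧ t = S x a n} := by
  intro y hy
  refine r.lift_span q (d := (wtS x, n)) (wtS_ne x) ?_ hy ?_
  · rintro t ⟨a, h, rfl⟩; exact r.sg _ _ _ h
  · have h1 : Φ y ∈ Ld s (wtS x + wt (Sum.inr 0 : Ix L), n) := by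
      have := q.img _ hy
      simpa using this
    refine Submodule.span_le.2 ?_ (Ld_le (by simp) n h1)
    rintro t ⟨j, hj, hv, rfl⟩
    rcases j with z | a
    · exact absurd hj (wtS_ne z)
    · have ha : Ev a n := by simpa [Vd, Ev] using hv
      exact Submodule.subset_span ⟨_, ⟨a, ha, rfl⟩, r.sp _ _ _ ha⟩

theorem LD.span_t {x z : Sg L} (h1 : z ≠ x.swap) (n : ℤ × ℤ) :
    gD (wtS x + wtS z, n) ≤ Submodule.span ℂ {t | Even n ∧ t = T x z n} := by
  intro y hy
  refine r.lift_span q (d := (wtS x + wtS z, n)) (wtS_add_ne h1) ?_ hy ?_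
  · rintro t ⟨h, rfl⟩; exact r.tg _ _ _ h1 h
  · have h2 : Φ y ∈ Ld s (wtS x + wt (Sum.inl z : Ix L), n) := q.img _ hy
    refine Submodule.span_le.2 ?_ (Ld_le (by simpa using h1) n h2)
    rintro t ⟨j, hj, hv, rfl⟩
    rcases j with z' | a
    · have : z' = z := wtS_inj hj
      subst this
      have ha : Even n := by simpa [Vd] using hv
      exact Submodule.subset_span ⟨_, ⟨ha, rfl⟩, r.tp _ _ _ h1 ha⟩
    · exact absurd hj.symm (wtS_ne z)

omit q r in
/-- span of basic null elements -/
def PP (s : ℤ × ℤ) (S : Sg L → Fin 3 → ℤ × ℤ → G) : Submodule ℂ G :=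
  Submodule.span ℂ {t | ∃ x a b n, Ev a n ∧ Ev b (s - n) ∧ t = ⁅S x a n, S x.swap b (s - n)⁆}

omit q r in
theorem lie_span2 {A B : Set G} {U : Submodule ℂ G} (h : ∀ a ∈ A, ∀ b ∈ B, ⁅a, b⁆ ∈ U) {x y : G}
    (hx : x ∈ Submodule.span ℂ A) (hy : y ∈ Submodule.span ℂ B) : ⁅x, y⁆ ∈ U := by
  induction hx using Submodule.span_induction with
  | zero => simp
  | add x y _ _ h1 h2 => rw [add_lie]; exact add_mem h1 h2
  | smul a x _ h => rw [smul_lie]; exact Submodule.smul_mem _ _ h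
  | mem x hx =>
    induction hy using Submodule.span_induction with
    | zero => simp
    | add x y _ _ h1 h2 => rw [lie_add]; exact add_mem h1 h2
    | smul a x _ h => rw [lie_smul]; exact Submodule.smul_mem _ _ h
    | mem y hy => exact h x hx y hy

theorem LD.pp_s (x : Sg L) (n : ℤ × ℤ) {u v : G} (hu : u ∈ gD (wtS x, n)) (hv : v ∈ gD (wtS x.swap, s - n)) :
    ⁅u, v⁆ ∈ PP s S := by
  refine lie_span2 ?_ (r.span_s q x n hu) (r.span_s q x.swap _ hv)
  rintro _ ⟨a, ha, rfl⟩ _ ⟨b, hb, rfl⟩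
  exact Submodule.subset_span ⟨x, a, b, n, ha, hb, rfl⟩

theorem LD.pp_t {x z : Sg L} (h1 : z ≠ x) (h2 : z ≠ x.swap) (n : ℤ × ℤ) {u v : G} (hu : u ∈ gD (wtS x + wtS z, n))
    (hv : v ∈ gD (wtS x.swap + wtS z.swap, s - n)) : ⁅u, v⁆ ∈ PP s S := by
  refine lie_span2 ?_ (r.span_t q h2 n hu) (r.span_t q (swap_ne h2) _ hv)
  rintro _ ⟨ha, rfl⟩ _ ⟨hb, rfl⟩
  have h3 : T x.swap z.swap (s - n) = - ⁅S x.swap 0 0, S z.swap 0 (s - n)⁆ := by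
    rw [r.r3 q (swap_ne h1) (swap_ne h2) (Ev.zero even0) (Ev.zero hb), neg_neg, zero_add]
  rw [h3, lie_neg]
  refine neg_mem ?_
  have h4 := r.mg q (x := x.swap) (z := x) (Ev.zero even0) (Ev.zero (ha.add hb))
  rw [leibniz_lie, r.r2 q rfl h1 h2 ha (Ev.zero even0), r.r1 q rfl h1 h2 ha (Ev.zero hb), neg_lie, add_zero, add_sub_cancel]
  refine add_mem (neg_mem (Submodule.subset_span ⟨z, 0, 0, n, Ev.zero ha, Ev.zero hb, rfl⟩)) ?_
  have hs : Even s := by have := ha.add hb; rwa [add_sub_cancel] at this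
  refine Submodule.subset_span ⟨x.swap, 0, 0, 0, Ev.zero even0, Ev.zero ?_, ?_⟩
  · rwa [sub_zero]
  · rw [sub_zero, Sum.swap_swap]

theorem LD.pp_ix (x : Sg L) (j : Ix L) (h1 : (Sum.inl x : Ix L) ≠ j) (h2 : j ≠ br (Sum.inl x)) (n : ℤ × ℤ) {d : Dg L} {u v : G}
    (hu : u ∈ gD (wt (Sum.inl x : Ix L) + wt j, n)) (hd : (wt (Sum.inl x : Ix L) + wt j, n) + d = (0, s)) (hv : v ∈ gD d) : ⁅u, v⁆ ∈ PP s S := by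
  have hd' : d = (wtS x.swap + wt (br j), s - n) := by
    rw [← eq_sub_iff_add_eq'] at hd
    rw [hd]
    simp
    abel
  subst hd'
  rcases j with z | a
  · exact r.pp_t q (by simpa using h1.symm) (by simpa using h2) n hu hv
  · exact r.pp_s q x n (by simpa using hu) (by simpa using hv)

theorem LD.pp_le : PP s S ≤ gD (0, s) := by
  refine Submodule.span_le.2 ?_
  rintro t ⟨x, a, b, n, ha, hb, rfl⟩
  have := r.mg q (x := x) (z := x.swap) ha hb
  simpa using this

theorem LD.pp : gD (0, s) = PP s S := by
  refine le_antisymm ?_ (r.pp_le q)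
  have key := iSupIndep_extract (A := fun d => if d = (0, s) then PP s S else gD d) q.ind ?_ ?_ (0, s)
  · simpa using key
  · intro d
    show (if d = (0, s) then PP s S else gD d) ≤ gD d
    split_ifs with h
    · rw [h]; exact r.pp_le q
    · exact le_rfl
  have le : ∀ d, (if d = (0, s) then PP s S else gD d) ≤ gD d := by
    intro d
    split_ifs with h
    · rw [h]; exact r.pp_le q
    · exact le_rfl
  have wne : ∀ i, wt (Sum.inl (nu i) : Ix L) + wt (nv i) ≠ 0 := by
    intro i h
    have := ba_cc i
    rw [ba_apply] at this
    have hb : ∀ p, bb p (Pi.single i 1) = 0 := by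
      intro p
      have := congrFun (congrArg Prod.fst (toD_single i 0)) p
      simp only [toD] at this
      rw [this]; exact congrFun h p
    simp [hb] at this
  have hom : ∀ x : G, (∃ i, x = es i 0 ∨ x = es i 1 ∨ x = fs i 0 ∨ x = fs i (-1)) →
      ∃ z j n, x ∈ gD (wt (Sum.inl z : Ix L) + wt j, n) ∧ (Sum.inl z : Ix L) ≠ j ∧ j ≠ br (Sum.inl z : Ix L) ∧ wt (Sum.inl z : Ix L) + wt j ≠ 0 := by
    rintro x ⟨i, rfl | rfl | rfl | rfl⟩
    · exact ⟨_, _, _, q.de0 i, nv_ne i, nv_bne i, wne i⟩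
    · exact ⟨_, _, _, q.de1 i, nw_ne i, nw_bne i, by rw [wt_nw]; exact wne i⟩
    · exact ⟨_, _, _, q.df0 i, br_ne (nv_ne i), br_ne (nv_bne i), by
        have := wne i
        rw [← neg_ne_zero] at this
        convert this using 1
        simp; abel⟩
    · exact ⟨_, _, _, q.df1 i, br_ne (nw_ne i), br_ne (nw_bne i), by
        have := wne i
        rw [← neg_ne_zero] at this
        convert this using 1
        simp [wt_nw]; abel⟩
  refine gen_top q.tri.gen ?_ ?_
  · intro x hx
    obtain ⟨z, j, n, hd, h1, h2, h3⟩ := hom x hx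
    refine Submodule.mem_iSup_of_mem _ (?_ : x ∈ if (wt (Sum.inl z : Ix L) + wt j, n) = (0, s) then PP s S else gD (wt (Sum.inl z : Ix L) + wt j, n))
    rw [if_neg]
    · exact hd
    · intro e; exact h3 (congrArg Prod.fst e)
  · intro x hx y hy
    obtain ⟨z, j, n, hd, h1, h2, h3⟩ := hom x hx
    induction hy using Submodule.iSup_induction' with
    | mem d' y hy =>
      refine Submodule.mem_iSup_of_mem ((wt (Sum.inl z : Ix L) + wt j, n) + d') ?_
      split_ifs with e
      · exact r.pp_ix q z j h1 h2 n hd e (le d' hy)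
      · exact q.mul _ _ _ hd _ (le d' hy)
    | zero => rw [lie_zero]; exact zero_mem _
    | add y z _ _ h1 h2 => rw [lie_add]; exact add_mem h1 h2

end DatS
end Ell

namespace Ell
set_option linter.unusedSectionVars false
set_option linter.unusedSimpArgs false
set_option linter.unusedVariables false

section DatS
variable {L : ℕ} {G : Type*} [LieRing G] [LieAlgebra ℂ G]
variable {s : ℤ × ℤ} {gD : Dg L → Submodule ℂ G} {es fs hs : Fin (L+3) → ℤ → G} {c : Fin (L+3) → G}
    {Φ : G →ₗ⁅ℂ⁆ LL (Ix L) s} {S : Sg L → Fin 3 → ℤ × ℤ → G} {T : Sg L → Sg L → ℤ × ℤ → G}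

theorem ev_zs {m : ℤ × ℤ} (hm : Even m) (t : ℤ) : Even (t • m) := by
  obtain ⟨u, rfl⟩ := hm
  exact ⟨t • u, smul_add _ _ _⟩

theorem Ev.par {a b : Fin 3} {n : ℤ × ℤ} (ha : Ev a n) (hb : Ev b (s - n)) : Even (s + cl a + cl b) := by
  have := Even.add ha hb
  rwa [show n + cl a + (s - n + cl b) = s + cl a + cl b by abel] at this

theorem Ev.ne {a b : Fin 3} {n : ℤ × ℤ} (hs : ¬ Even s) (ha : Ev a n) (hb : Ev b (s - n)) : a ≠ b := by
  rintro rfl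
  have := ha.sum hb
  rw [add_sub_cancel] at this
  exact hs this

theorem Ev.eq {a b : Fin 3} {n : ℤ × ℤ} (hs : Even s) (ha : Ev a n) (hb : Ev b (s - n)) : a = b := by
  apply cl_inj
  have := (ha.par hb).sub hs
  rwa [show s + cl a + cl b - s = cl a + cl b by abel] at this

theorem pair_uniq : ∀ a b a' b' : Fin 3, a ≠ b → a' ≠ b' →
    (Even (cl a + cl b - (cl a' + cl b')).1 ∧ Even (cl a + cl b - (cl a' + cl b')).2) → (a' = a ∧ b' = b) ∨ (a' = b ∧ b' = a) := by
  decide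

theorem pair_ex (s : ℤ × ℤ) : ∃ a b : Fin 3, Even (s + cl a + cl b) := by
  obtain ⟨m, n⟩ := s
  simp only [even2]
  rcases Int.even_or_odd m with h1 | h1 <;> rcases Int.even_or_odd n with h2 | h2
  · exact ⟨0, 0, by simpa [cl] using ⟨h1, h2⟩⟩
  · exact ⟨0, 2, by refine ⟨?_, ?_⟩ <;> simp [cl, *, parity_simps]⟩
  · exact ⟨0, 1, by refine ⟨?_, ?_⟩ <;> simp [cl, *, parity_simps]⟩
  · exact ⟨1, 2, by refine ⟨?_, ?_⟩ <;> simp [cl, *, parity_simps]⟩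

variable (q : Dat s gD es fs hs c Φ) (r : LD s gD Φ S T)
include q r

theorem ne_swap {x w : Sg L} (h : w ≠ x.swap) : w.swap ≠ x := fun e => h (by rw [← e, Sum.swap_swap])

theorem LD.odd1 {x w : Sg L} {a b : Fin 3} {u v : ℤ × ℤ} (h1 : w ≠ x) (h2 : w ≠ x.swap) (hab : a ≠ b) (hu : Ev a u) (hv : Ev a v)
    (hu' : Ev b (s - u)) : ⁅S x a u, S x.swap b (s - u)⁆ = ⁅S w a v, S w.swap b (s - v)⁆ := by
  have h := r.jac q (m := u - v) (n := v) (n' := s - u) h1 h2 (hu.sub hv) hv hu'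
  rw [r.r3' q hab h2.symm (swap_ne h1).symm hv hu', lie_zero, sub_add_cancel, show u - v + (s - u) = s - v by abel] at h
  exact sub_eq_zero.1 h.symm

theorem third2 (x z : Sg L) : (z ≠ x ∧ z ≠ x.swap) ∨ ∃ w : Sg L, (w ≠ x ∧ w ≠ x.swap) ∧ (z ≠ w ∧ z ≠ w.swap) := by
  by_cases h1 : z = x ∨ z = x.swap
  · obtain ⟨w, hw1, hw2⟩ := third x
    right
    refine ⟨w, ⟨hw1, hw2⟩, ?_, ?_⟩
    · rintro rfl; tauto
    · intro e
      rcases h1 with rfl | rfl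
      · exact hw2 (by rw [e]; simp)
      · exact swap_ne hw1.symm e
  · push Not at h1; exact Or.inl h1

theorem LD.odd2 {x z : Sg L} {a b : Fin 3} {u v : ℤ × ℤ} (hab : a ≠ b) (hu : Ev a u) (hv : Ev a v)
    (hu' : Ev b (s - u)) (hv' : Ev b (s - v)) : ⁅S x a u, S x.swap b (s - u)⁆ = ⁅S z a v, S z.swap b (s - v)⁆ := by
  rcases third2 q r x z with h | ⟨w, h1, h2⟩
  · exact r.odd1 q h.1 h.2 hab hu hv hu'
  · rw [r.odd1 q h1.1 h1.2 hab hu hv hu']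
    exact r.odd1 q h2.1 h2.2 hab hv hv hv'

theorem LD.odd (hs : ¬ Even s) : Module.finrank ℂ (gD (0, s)) = 1 := by
  obtain ⟨a, b, hab⟩ := pair_ex s
  have ha : Ev a (cl a) := Ev.clm a
  have hb : Ev b (s - cl a) := by
    obtain ⟨t, ht⟩ := hab
    refine ⟨t - cl a, ?_⟩
    have : s - cl a + cl b = s + cl a + cl b - cl a - cl a := by abel
    rw [this, ht]; abel
  have hne := ha.ne hs hb
  have hsp : gD (0, s) = Submodule.span ℂ {⁅S (Sum.inl 0) a (cl a), S (Sum.inl 0 : Sg L).swap b (s - cl a)⁆} := by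
    rw [r.pp q]
    apply le_antisymm
    · refine Submodule.span_le.2 ?_
      rintro t ⟨x, a', b', n, ha', hb', rfl⟩
      have h0 := (hab.sub (ha'.par hb'))
      rw [show s + cl a + cl b - (s + cl a' + cl b') = cl a + cl b - (cl a' + cl b') by abel] at h0
      rcases pair_uniq a b a' b' hne (ha'.ne hs hb') ((even2 _).1 h0) with ⟨rfl, rfl⟩ | ⟨rfl, rfl⟩
      · rw [r.odd2 q hne ha' ha hb' hb]
        exact Submodule.mem_span_singleton_self _
      · rw [← lie_skew (S x a' n), SetLike.mem_coe, neg_mem_iff]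
        have h3 : Ev a' (s - (s - n)) := by rwa [sub_sub_cancel]
        have := r.odd2 q (x := x.swap) (z := Sum.inl 0) hne hb' ha h3 hb
        rw [sub_sub_cancel, Sum.swap_swap] at this
        rw [this]
        exact Submodule.mem_span_singleton_self _
    · refine Submodule.span_le.2 ?_
      rintro t rfl
      exact Submodule.subset_span ⟨_, a, b, _, ha, hb, rfl⟩
  rw [hsp, finrank_span_singleton]
  intro h0
  have := congrArg Φ h0
  rw [LieHom.map_lie, r.sp _ _ _ ha, r.sp _ _ _ hb, map_zero, FF_lie s br_br] at this
  simp [hne.symm] at this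
  exact F_ne (by simpa using hne) this

omit q r in
/-- the basic null elements, even case -/
def f0 (s : ℤ × ℤ) (S : Sg L → Fin 3 → ℤ × ℤ → G) (x : Sg L) (a : Fin 3) (u : ℤ × ℤ) : G := ⁅S x a u, S x.swap a (s - u)⁆

omit q r in
theorem f0_swap (x : Sg L) (a : Fin 3) (u : ℤ × ℤ) : f0 s S x.swap a u = - f0 s S x a (s - u) := by
  rw [f0, f0, sub_sub_cancel, Sum.swap_swap, lie_skew]

theorem LD.evA (hs : Even s) {x w : Sg L} {a b : Fin 3} {m u v : ℤ × ℤ} (h1 : w ≠ x) (h2 : w ≠ x.swap) (hm : Even m) (hu : Ev a u) (hv : Ev b v) :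
    f0 s S x a (u + m) - f0 s S w a u = f0 s S x b (v + m) - f0 s S w b v := by
  have key : ∀ {a : Fin 3} {u : ℤ × ℤ}, Ev a u → f0 s S x a (u + m) - f0 s S w a u = - ⁅T x w.swap m, T w x.swap (s - m)⁆ := by
    intro a u hu
    have h := r.jac q (m := m) (n := u) (n' := s - (u + m)) h1 h2 hm hu ((hu.add hm).refl hs)
    rw [r.r3 q h2.symm (swap_ne h1).symm hu ((hu.add hm).refl hs), lie_neg, show u + (s - (u + m)) = s - m by abel,
      show m + (s - (u + m)) = s - u by abel, add_comm m] at h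
    rw [f0, f0, h]
  rw [key hu, key hv]

theorem LD.evB (hs : Even s) {x : Sg L} {a b : Fin 3} {m u v : ℤ × ℤ} (hm : Even m) (hu : Ev a u) (hv : Ev b v) :
    f0 s S x a (u + m) - f0 s S x a u = f0 s S x b (v + m) - f0 s S x b v := by
  obtain ⟨w, h1, h2⟩ := third x
  have e1 := r.evA q hs h1 h2 hm hu hv
  have e2 := r.evA q hs h1 h2 even0 hu hv
  rw [add_zero, add_zero] at e2
  linear_combination (norm := module) e1 - e2

theorem LD.evC1 (hs : Even s) {x w : Sg L} (h1 : w ≠ x) (h2 : w ≠ x.swap) {a b : Fin 3} {u v : ℤ × ℤ} (hu : Ev a u) (hv : Ev b v) :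
    f0 s S x a u - f0 s S x b v = f0 s S w a u - f0 s S w b v := by
  have e2 := r.evA q hs h1 h2 even0 hu hv
  rw [add_zero, add_zero] at e2
  linear_combination (norm := module) e2

theorem LD.evC (hs : Even s) {x z : Sg L} {a b : Fin 3} {u v : ℤ × ℤ} (hu : Ev a u) (hv : Ev b v) :
    f0 s S x a u - f0 s S x b v = f0 s S z a u - f0 s S z b v := by
  rcases third2 q r x z with h | ⟨w, h1, h2⟩
  · exact r.evC1 q hs h.1 h.2 hu hv
  · rw [r.evC1 q hs h1.1 h1.2 hu hv, r.evC1 q hs h2.1 h2.2 hu hv]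

omit q r in
/-- the additive part -/
def ph (s : ℤ × ℤ) (S : Sg L → Fin 3 → ℤ × ℤ → G) (m : ℤ × ℤ) : G := f0 s S (Sum.inl 0) 0 m - f0 s S (Sum.inl 0) 0 0

theorem LD.f_add (hs : Even s) (x : Sg L) {a : Fin 3} {u m : ℤ × ℤ} (hu : Ev a u) (hm : Even m) :
    f0 s S x a (u + m) = f0 s S x a u + ph s S m := by
  have e1 := r.evB q hs (x := x) hm hu (Ev.zero even0)
  have e2 := r.evC q hs (x := x) (z := Sum.inl 0) (Ev.zero hm) (Ev.zero even0)
  rw [zero_add] at e1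
  rw [ph, ← e2, ← e1]; abel

theorem LD.ph_add (hs : Even s) {m n : ℤ × ℤ} (hm : Even m) (hn : Even n) : ph s S (m + n) = ph s S m + ph s S n := by
  have := r.f_add q hs (Sum.inl 0) (Ev.zero hm) hn
  rw [ph, this, ph, ph]; abel

theorem LD.ph_E (hs : Even s) (x : Sg L) (a : Fin 3) : (2:ℂ) • (f0 s S x a (cl a) - f0 s S x 0 0) = ph s S (cl a + cl a) := by
  have h2 : Even (cl a + cl a) := ⟨_, rfl⟩
  have e1 := r.evC q hs (x := x) (z := x.swap) (Ev.clm a) (Ev.zero even0)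
  rw [f0_swap, f0_swap, sub_zero] at e1
  have e2 := r.f_add q hs x (Ev.clm a) (m := s - (cl a + cl a)) (hs.sub h2)
  have e3 := r.f_add q hs x (Ev.zero even0) (m := s) hs
  have e4 := r.ph_add q hs h2 (hs.sub h2)
  rw [add_sub_cancel] at e4
  rw [show cl a + (s - (cl a + cl a)) = s - cl a by abel] at e2
  rw [zero_add] at e3
  rw [e2, e3] at e1
  linear_combination (norm := module) e1 + e4

theorem LD.ph_s (hse : Even s) : ph s S s = 0 := by
  have z0 : Ev 0 (0 : ℤ × ℤ) := Ev.zero even0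
  have zs : Ev 0 s := Ev.zero hse
  set x : Sg L := Sum.inl 0 with hx
  set f := f0 s S x 0 0 with hf
  have hfg : f ∈ gD (0, s) := by
    have := r.mg q (x := x) (z := x.swap) z0 (z0.refl hse)
    simpa [hf, f0] using this
  have hΦ : Φ f = - F s (Sum.inl x) (Sum.inl x.swap) s := by
    rw [hf, f0, LieHom.map_lie, r.sp _ _ _ z0, r.sp _ _ _ (z0.refl hse), FF_lie s br_br]
    simp [FF_self, sy_self]
  have r1 : ⁅f, S x 0 0⁆ = - S x 0 s := by
    refine q.inj (d := (wtS x, s)) (wtS_ne x) ?_ (neg_mem (r.sg _ _ _ zs)) ?_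
    · have := q.mul _ _ _ hfg _ (r.sg x 0 0 z0); simpa using this
    · rw [LieHom.map_lie, hΦ, r.sp _ _ _ z0, map_neg, r.sp _ _ _ zs, neg_lie, FF_lie s br_br]
      simp [hx]
  have r2 : ⁅f, S x.swap 0 0⁆ = S x.swap 0 s := by
    refine q.inj (d := (wtS x.swap, s)) (wtS_ne x.swap) ?_ (r.sg _ _ _ zs) ?_
    · have := q.mul _ _ _ hfg _ (r.sg x.swap 0 0 z0); simpa using this
    · rw [LieHom.map_lie, hΦ, r.sp _ _ _ z0, r.sp _ _ _ zs, neg_lie, FF_lie s br_br]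
      simp [hx]
  have e0 : es 1 0 = S x 0 0 := by
    refine q.inj (d := (wtS x, 0)) (wtS_ne x) ?_ (r.sg _ _ _ z0) ?_
    · have := q.de0 1; simpa using this
    · rw [q.pe0, r.sp _ _ _ z0]; simp [hx]
  have e1 : fs 1 0 = (-2:ℂ) • S x.swap 0 0 := by
    refine q.inj (d := (wtS x.swap, 0)) (wtS_ne x.swap) ?_ (Submodule.smul_mem _ _ (r.sg _ _ _ z0)) ?_
    · have := q.df0 1; simpa [hx] using this
    · rw [q.pf0, map_smul, r.sp _ _ _ z0]; simp [hx]
  have e2 : ⁅hs 1 0, f⁆ = 0 := by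
    obtain ⟨d, hd⟩ := toD_surj (0, s)
    have hfg' : f ∈ gD (toD d) := by rw [hd]; exact hfg
    have h0 : ∀ p, bb p d.1 = 0 := fun p => congrFun (congrArg Prod.fst hd) p
    rw [q.wd.wt 1 d f hfg', ba_apply]
    simp [h0]
  rw [← (q.tri.loop 1).ef0 0, e0, e1, lie_smul, smul_lie, smul_eq_zero] at e2
  have e3 : ⁅f, ⁅S x 0 0, S x.swap 0 0⁆⁆ = 0 := sk0 (e2.resolve_left (by norm_num))
  rw [leibniz_lie, r1, r2, neg_lie] at e3
  rw [ph, ← hx, f0, f0, sub_self, sub_zero]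
  linear_combination (norm := module) (-1:ℂ) • e3

omit q r in
theorem f0_img (r : LD s gD Φ S T) (hse : Even s) (x : Sg L) {a : Fin 3} {u : ℤ × ℤ} (hu : Ev a u) :
    Φ (f0 s S x a u) = - F s (Sum.inl x) (Sum.inl x.swap) s + (2 * sy s u) • ZZ _ s := by
  rw [f0, LieHom.map_lie, r.sp _ _ _ hu, r.sp _ _ _ (hu.refl hse), FF_lie s br_br]
  have : sy s (s - u) = - sy s u := by
    have := sy_add s (s - u) u
    rw [sub_add_cancel, sy_self] at this
    linear_combination -this
  simp [FF_self, this]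

/-- additive map on even vectors -/
theorem LD.ph_zsmul (hse : Even s) {m : ℤ × ℤ} (hm : Even m) (t : ℤ) : ph s S (t • m) = (t : ℂ) • ph s S m := by
  let f : ℤ →+ G := AddMonoidHom.mk' (fun t => ph s S (t • m)) (by
    intro a b
    rw [add_smul]
    exact r.ph_add q hse (ev_zs hm a) (ev_zs hm b))
  have h : f t = t • f 1 := by
    rw [← map_zsmul]; simp
  simp only [f, AddMonoidHom.mk'_apply, one_smul] at h
  rw [h, Int.cast_smul_eq_zsmul]

theorem LD.ph_one (hse : Even s) (hs0 : s ≠ 0) : ∃ l0 : ℤ × ℤ, Even l0 ∧ sy s l0 ≠ 0 ∧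
    ∀ m, Even m → ph s S m ∈ Submodule.span ℂ {ph s S l0} := by
  obtain ⟨⟨s1, s2⟩, rfl⟩ := hse
  have h1 : Even ((2, 0) : ℤ × ℤ) := ⟨(1, 0), rfl⟩
  have h2 : Even ((0, 2) : ℤ × ℤ) := ⟨(0, 1), rfl⟩
  have key : ∀ a b : ℤ, ph ((s1, s2) + (s1, s2)) S ((a, b) + (a, b)) = (a : ℂ) • ph ((s1, s2) + (s1, s2)) S (2, 0) + (b : ℂ) • ph ((s1, s2) + (s1, s2)) S (0, 2) := by
    intro a b
    rw [← r.ph_zsmul q ⟨_, rfl⟩ h1, ← r.ph_zsmul q ⟨_, rfl⟩ h2, ← r.ph_add q ⟨_, rfl⟩ (ev_zs h1 _) (ev_zs h2 _)]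
    congr 1
    ext <;> simp <;> ring
  have k0 := key s1 s2
  rw [r.ph_s q ⟨_, rfl⟩] at k0
  by_cases hs2 : s2 = 0
  · have hs1 : s1 ≠ 0 := by
      rintro rfl; subst hs2; exact hs0 rfl
    have hs1' : (s1 : ℂ) ≠ 0 := by exact_mod_cast hs1
    refine ⟨(0, 2), h2, by simpa [sy, ← two_mul] using hs1, ?_⟩
    rintro _ ⟨⟨a, b⟩, rfl⟩
    rw [key]
    refine Submodule.mem_span_singleton.2 ⟨b, ?_⟩
    subst hs2
    have : ph ((s1, 0) + (s1, 0)) S (2, 0) = 0 := by simpa [hs1] using k0.symm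
    rw [this]; simp
  · have hs2' : (s2 : ℂ) ≠ 0 := by exact_mod_cast hs2
    refine ⟨(2, 0), h1, by simpa [sy, ← two_mul] using hs2, ?_⟩
    rintro _ ⟨⟨a, b⟩, rfl⟩
    rw [key]
    refine Submodule.mem_span_singleton.2 ⟨a - b * s1 / s2, ?_⟩
    have : ph ((s1, s2) + (s1, s2)) S (0, 2) = (-(s1 : ℂ) / s2) • ph ((s1, s2) + (s1, s2)) S (2, 0) := by
      have h3 : (s2 : ℂ) • ph ((s1, s2) + (s1, s2)) S (0, 2) = (-(s1 : ℂ)) • ph ((s1, s2) + (s1, s2)) S (2, 0) := by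
        linear_combination (norm := module) (-1 : ℂ) • k0
      rw [div_eq_inv_mul, mul_smul, ← h3, smul_smul, inv_mul_cancel₀ hs2', one_smul]
    rw [this, smul_smul, ← add_smul]
    congr 1
    field_simp
    ring

omit q r in
/-- basis family -/
def bas (s : ℤ × ℤ) (S : Sg L → Fin 3 → ℤ × ℤ → G) (l0 : ℤ × ℤ) : Option (Fin (L+2)) → G
  | none => ph s S l0
  | some p => f0 s S (Sum.inl p) 0 0

omit q r in
theorem ph_img (r : LD s gD Φ S T) (hse : Even s) {m : ℤ × ℤ} (hm : Even m) : Φ (ph s S m) = (2 * sy s m) • ZZ _ s := by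
  have s0 : sy s 0 = 0 := by simp [sy]
  rw [ph, map_sub, f0_img r hse _ (Ev.zero hm), f0_img r hse _ (Ev.zero even0), s0]
  module

theorem LD.bas_li (hse : Even s) {l0 : ℤ × ℤ} (hl : Even l0) (h0 : sy s l0 ≠ 0) : LinearIndependent ℂ (bas s S l0) := by
  refine LinearIndependent.of_comp (Φ : G →ₗ[ℂ] LL (Ix L) s) ?_
  rw [Fintype.linearIndependent_iff]
  intro g hg
  have s0 : sy s 0 = 0 := by simp [sy]
  have hn : Φ (bas s S l0 none) = (2 * sy s l0) • ZZ _ s := ph_img r hse hl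
  have hp : ∀ p, Φ (bas s S l0 (some p)) = - F s (Sum.inl (Sum.inl p)) (Sum.inl (Sum.inr p)) s := by
    intro p
    have := f0_img r hse (Sum.inl p) (Ev.zero even0)
    rw [s0] at this
    change Φ (f0 s S (Sum.inl p) 0 0) = _
    simpa using this
  rw [Fintype.sum_option] at hg
  simp only [Function.comp_apply, LieHom.coe_toLinearMap, hn, hp] at hg
  let e1 : Fin (L+2) → LL (Ix L) s →ₗ[ℂ] ℂ := fun p =>
    { toFun := fun x => x.fst.coeff s (Sum.inl (Sum.inl p)) (Sum.inl (Sum.inl p))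
      map_add' := fun x y => by simp
      map_smul' := fun c x => by simp }
  let e2 : LL (Ix L) s →ₗ[ℂ] ℂ :=
    { toFun := fun x => x.snd
      map_add' := fun x y => by simp
      map_smul' := fun c x => by simp }
  have a1 : ∀ p, e1 p (ZZ _ s) = 0 := fun p => by
    change (ZZ (Ix L) s).fst.coeff s _ _ = 0
    simp [ZZ]
  have a2 : ∀ p p', e1 p (F s (Sum.inl (Sum.inl p')) (Sum.inl (Sum.inr p')) s) = if p' = p then 1 else 0 := fun p p' => by
    change (F s _ _ s).fst.coeff s _ _ = _
    simp [F, FF, Fm, Matrix.single_apply]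
  have a3 : e2 (ZZ _ s) = 1 := by
    change (ZZ (Ix L) s).snd = 1
    simp [ZZ]
  have a4 : ∀ p', e2 (F s (Sum.inl (Sum.inl p')) (Sum.inl (Sum.inr p')) s) = 0 := fun p' => by
    change (F s (Sum.inl (Sum.inl p') : Ix L) (Sum.inl (Sum.inr p')) s).snd = _
    simp [F, FF]
  rintro (_ | p)
  · have := congrArg e2 hg
    simpa [map_add, map_sum, a3, a4, h0] using this
  · have := congrArg (e1 p) hg
    simpa [map_add, map_sum, a1, a2] using this

theorem LD.even (hse : Even s) (hs0 : s ≠ 0) : Module.finrank ℂ (gD (0, s)) = L + 3 := by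
  obtain ⟨l0, hl, h0, hall⟩ := r.ph_one q hse hs0
  have hsp : gD (0, s) = Submodule.span ℂ (Set.range (bas s S l0)) := by
    rw [r.pp q]
    have z0 : Ev 0 (0 : ℤ × ℤ) := Ev.zero even0
    have memf : ∀ x a u, Ev a u → f0 s S x a u ∈ PP s S := fun x a u hu =>
      Submodule.subset_span ⟨x, a, a, u, hu, hu.refl hse, rfl⟩
    apply le_antisymm
    · refine Submodule.span_le.2 ?_
      have hph : ∀ m, Even m → ph s S m ∈ Submodule.span ℂ (Set.range (bas s S l0)) := fun m hm =>
        Submodule.span_mono (by rintro _ rfl; exact ⟨none, rfl⟩) (hall m hm)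
      have key : ∀ p a u, Ev a u → f0 s S (Sum.inl p) a u ∈ Submodule.span ℂ (Set.range (bas s S l0)) := by
        intro p a u hu
        have e1 := r.f_add q hse (Sum.inl p) (Ev.clm a) (hu.sub (Ev.clm a))
        have e2 := r.ph_E q hse (Sum.inl p) a
        rw [add_sub_cancel] at e1
        have : f0 s S (Sum.inl p) a u = f0 s S (Sum.inl p) 0 0 + (1/2 : ℂ) • ph s S (cl a + cl a) + ph s S (u - cl a) := by
          rw [e1]
          linear_combination (norm := module) (1/2 : ℂ) • e2
        rw [this]
        exact add_mem (add_mem (Submodule.subset_span ⟨some p, rfl⟩) (Submodule.smul_mem _ _ (hph _ ⟨_, rfl⟩))) (hph _ (hu.sub (Ev.clm a)))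
      rintro t ⟨x, a, b, n, ha, hb, rfl⟩
      obtain rfl := ha.eq hse hb
      change f0 s S x a n ∈ Submodule.span ℂ _
      rcases x with p | p
      · exact key p a n ha
      · have := f0_swap (s := s) (S := S) (Sum.inl p) a n
        rw [Sum.swap_inl] at this
        rw [this]
        exact neg_mem (key p a _ (ha.refl hse))
    · refine Submodule.span_le.2 ?_
      rintro t ⟨_ | p, rfl⟩
      · exact sub_mem (memf _ _ _ (Ev.zero hl)) (memf _ _ _ z0)
      · exact memf _ _ _ z0
  rw [hsp, finrank_span_eq_card (r.bas_li q hse hl h0)]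
  simp
end DatS

theorem Dat.dims {L : ℕ} {G : Type*} [LieRing G] [LieAlgebra ℂ G]
    {s : ℤ × ℤ} {gD : Dg L → Submodule ℂ G} {es fs hs : Fin (L+3) → ℤ → G} {c : Fin (L+3) → G}
    {Φ : G →ₗ⁅ℂ⁆ LL (Ix L) s} (q : Dat s gD es fs hs c Φ) :
    (¬ Even s → Module.finrank ℂ (gD (0, s)) = 1) ∧ (Even s → s ≠ 0 → Module.finrank ℂ (gD (0, s)) = L + 3) := by
  obtain ⟨S, T, r⟩ := q.exLD
  exact ⟨r.odd q, r.even q⟩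
end Ell

namespace Ell
set_option linter.unusedSectionVars false
set_option linter.unusedSimpArgs false

variable {L : ℕ}

/-- coordinates of simple roots -/
def ww (i : Fin (L+3)) (p : Fin (L+2)) : ℤ := bb p (Pi.single i 1)

theorem ww_eq (i : Fin (L+3)) : ww i = wtS (nu i) + wt (nv i) := congrArg Prod.fst (toD_single i 0)

/-- Gram matrix -/
def gm (i j : Fin (L+3)) : ℤ := ba i (Pi.single j 1)

theorem gm_apply (i j : Fin (L+3)) : gm i j = ∑ p, ww i p * ww j p := by
  rw [gm, ba_apply]; exact Finset.sum_congr rfl fun p _ => mul_comm _ _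

theorem gm_symm (i j : Fin (L+3)) : gm i j = gm j i := by
  rw [gm_apply, gm_apply]; exact Finset.sum_congr rfl fun p _ => mul_comm _ _

theorem cc_gm (i : Fin (L+3)) : cc i * gm i i = 2 := ba_cc i

@[simp] theorem gm00 : gm (0 : Fin (L+3)) 0 = 1 := by have := cc_gm (0 : Fin (L+3)); simp at this; omega
@[simp] theorem gm11 : gm (1 : Fin (L+3)) 1 = 1 := by have := cc_gm (1 : Fin (L+3)); simp at this; omega
@[simp] theorem gm22 (q : Fin (L+1)) : gm q.succ.succ q.succ.succ = 2 := by have := cc_gm q.succ.succ; simpa using this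

theorem ww0 : ww (0 : Fin (L+3)) = - Pi.single (Fin.last _) 1 := by rw [ww_eq]; simp [wtS]
theorem ww1 : ww (1 : Fin (L+3)) = Pi.single 0 1 := by rw [ww_eq]; simp [wtS]
theorem ww2 (q : Fin (L+1)) : ww q.succ.succ = Pi.single q.succ 1 - Pi.single q.castSucc 1 := by rw [ww_eq]; simp [wtS, sub_eq_add_neg]

theorem gm_dot (i j : Fin (L+3)) : gm i j = ww i ⬝ᵥ ww j := gm_apply i j

@[simp] theorem gm01 : gm (0 : Fin (L+3)) 1 = 0 := by
  rw [gm_dot, ww0, ww1, neg_dotProduct, single_dotProduct, Pi.single_eq_of_ne (Fin.last_pos).ne']; simp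
@[simp] theorem gm10 : gm (1 : Fin (L+3)) 0 = 0 := by rw [gm_symm, gm01]
theorem gm02 (q : Fin (L+1)) : gm 0 q.succ.succ = if q = Fin.last _ then -1 else 0 := by
  rw [gm_dot, ww0, ww2, neg_dotProduct, single_dotProduct, Pi.sub_apply, Pi.single_eq_of_ne (Fin.castSucc_ne_last _).symm]
  split_ifs with h
  · subst h; simp
  · rw [Pi.single_eq_of_ne]
    · simp
    · rw [← Fin.succ_last]; exact fun e => h (Fin.succ_injective _ e).symm
theorem gm12 (q : Fin (L+1)) : gm 1 q.succ.succ = if q = 0 then -1 else 0 := by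
  rw [gm_dot, ww1, ww2, single_dotProduct, Pi.sub_apply, Pi.single_eq_of_ne (Fin.succ_ne_zero _).symm]
  split_ifs with h
  · subst h; simp
  · rw [Pi.single_eq_of_ne]
    · simp
    · exact fun e => h (Fin.castSucc_injective (L+1) (a₁ := 0) (a₂ := q) e).symm
theorem gm2 (p q : Fin (L+1)) : gm p.succ.succ q.succ.succ = if p = q then 2 else if p.val + 1 = q.val ∨ q.val + 1 = p.val then -1 else 0 := by
  rw [gm_dot, ww2, ww2, sub_dotProduct, single_dotProduct, single_dotProduct, Pi.sub_apply, Pi.sub_apply]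
  simp only [Pi.single_apply, Fin.ext_iff, Fin.val_succ, Fin.val_castSucc]
  split_ifs <;> first | rfl | omega

/-- sign -/
def sg (ε : Bool) : ℤ := if ε then -1 else 1
@[simp] theorem sg_t : sg true = -1 := rfl
@[simp] theorem sg_f : sg false = 1 := rfl
theorem sg_sq (ε : Bool) : sg ε * sg ε = 1 := by cases ε <;> rfl

/-- the presentation -/
structure Prs {G : Type*} [LieRing G] [LieAlgebra ℂ G] (e : Fin (L+3) → Bool → Bool → G) (h : Fin (L+3) → G) (ha : G) : Prop where
  hh : ∀ i j, ⁅h i, h j⁆ = 0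
  hha : ∀ i, ⁅h i, ha⁆ = 0
  he : ∀ j i t ε, ⁅h j, e i t ε⁆ = ((sg ε * gm j i : ℤ) : ℂ) • e i t ε
  hae : ∀ i t ε, ⁅ha, e i t ε⁆ = 0
  ef : ∀ i t, ⁅e i t false, e i t true⁆ = (cc i : ℂ) • (h i + ((if t then kk i else 0 : ℤ) : ℂ) • ha)
  sr5 : ∀ i j t t' ε ε', ¬ (i = j ∧ t = t') →
    (LieAlgebra.ad ℂ G (e i t ε) ^ (1 + (-(cc i * (sg ε * sg ε' * gm i j))).toNat)) (e j t' ε') = 0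
  sr6 : ∀ i j ε, 2 * gm i j = - gm j j →
    (LieAlgebra.ad ℂ G (e i true ε) ^ ((kk j).toNat / (kk i).toNat)) (e j false ε) =
    (LieAlgebra.ad ℂ G (e i false ε) ^ ((kk j).toNat / (kk i).toNat)) (e j true ε)
  sr8 : ∀ i j ε, 2 * gm i j = - gm j j → ∀ n, 1 ≤ n → n ≤ (kk j).toNat / (kk i).toNat - 1 →
    (LieAlgebra.ad ℂ G (e i false ε) ^ n) ((LieAlgebra.ad ℂ G (e i true ε) ^ ((kk j).toNat / (kk i).toNat - n)) (e j false ε)) = 0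

section model
variable (s : ℤ × ℤ)

/-- second index -/
def vx (i : Fin (L+3)) (t : Bool) : Ix L := if t then nw i else nv i
/-- degree -/
def lx (i : Fin (L+3)) (t : Bool) : ℤ × ℤ := if t then lamw i else lam i

/-- generators of the model -/
noncomputable def eM (i : Fin (L+3)) (t ε : Bool) : LL (Ix L) s :=
  if ε then (-(cc i : ℂ)) • F s (br (Sum.inl (nu i))) (br (vx i t)) (-lx i t) else F s (Sum.inl (nu i)) (vx i t) (lx i t)

/-- Cartan elements of the model -/
noncomputable def hM (i : Fin (L+3)) : LL (Ix L) s :=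
  F s (Sum.inl (nu i)) (br (Sum.inl (nu i))) 0 + F s (nv i) (br (nv i)) 0

theorem wt_vx (i : Fin (L+3)) (t) : wt (vx i t) = wt (nv i) := by cases t <;> simp [vx, wt_nw]

theorem vd_lx (i : Fin (L+3)) (t) : Vd (Sum.inl (nu i)) (vx i t) (lx i t) := by
  cases t
  · exact nv_vd i
  · exact nw_vd i

theorem eM_mem (i : Fin (L+3)) (t ε) : eM s i t ε ∈ Ld s (sg ε • ww i, sg ε • lx i t) := by
  cases ε
  · simp only [eM, sg_f, one_smul]
    exact F_mem' (vd_lx i t) (by rw [ww_eq, wt_vx]; rfl)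
  · simp only [eM, sg_t, neg_smul, one_smul, if_true]
    rw [← neg_smul]
    refine Submodule.smul_mem _ _ (F_mem' (Vd_br (vd_lx i t)) ?_)
    rw [wt_br, wt_br, ww_eq, wt_vx]; simp; abel

/-- diagonal action -/
theorem Fpp_lie (p : Fin (L+2)) (i j : Ix L) (m : ℤ × ℤ) :
    ⁅F s (Sum.inl (Sum.inl p)) (Sum.inl (Sum.inr p)) 0, F s i j m⁆ = ((wt i p + wt j p : ℤ) : ℂ) • F s i j m := by
  rw [FF_lie s br_br]
  have z : ∀ P : Prop, ∀ [Decidable P], (if 0 + m = s ∧ P then (2 * sy s m) • ZZ (Ix L) s else 0) = 0 := by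
    intro P _; split_ifs with h
    · rw [zero_add] at h; rw [h.1, sy_self]; simp
    · rfl
  rw [z, z, add_zero, sub_zero, zero_add]
  have key : ∀ k : Ix L, wt k p = (if k = Sum.inl (Sum.inl p) then 1 else 0) - (if k = Sum.inl (Sum.inr p) then 1 else 0) := by
    rintro ((a | a) | c)
    · simp [wtS, Pi.single_apply, eq_comm]
    · simp [wtS, Pi.single_apply, eq_comm]
    · simp
  rw [key i, key j]
  rw [show br (Sum.inl (Sum.inr p)) = (Sum.inl (Sum.inl p) : Ix L) from rfl, show br (Sum.inl (Sum.inl p)) = (Sum.inl (Sum.inr p) : Ix L) from rfl]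
  have e1 : (if i = Sum.inl (Sum.inl p) then FF s br (Sum.inl (Sum.inl p)) j m else 0) = (if i = Sum.inl (Sum.inl p) then (1:ℂ) else 0) • F s i j m := by
    split_ifs with h <;> simp [h]
  have e2 : (if j = Sum.inl (Sum.inl p) then FF s br (Sum.inl (Sum.inl p)) i m else 0) = -((if j = Sum.inl (Sum.inl p) then (1:ℂ) else 0) • F s i j m) := by
    split_ifs with h
    · rw [h, one_smul]; exact FF_swap _ _ _ _ _
    · simp
  have e3 : (if i = Sum.inl (Sum.inr p) then FF s br (Sum.inl (Sum.inr p)) j m else 0) = (if i = Sum.inl (Sum.inr p) then (1:ℂ) else 0) • F s i j m := by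
    split_ifs with h <;> simp [h]
  have e4 : (if j = Sum.inl (Sum.inr p) then FF s br (Sum.inl (Sum.inr p)) i m else 0) = -((if j = Sum.inl (Sum.inr p) then (1:ℂ) else 0) • F s i j m) := by
    split_ifs with h
    · rw [h, one_smul]; exact FF_swap _ _ _ _ _
    · simp
  rw [e1, e2, e3, e4]
  push_cast
  module

theorem F_diag (i : Ix L) : F s i (br i) 0 = ∑ p, ((wt i p : ℤ) : ℂ) • F s (Sum.inl (Sum.inl p)) (Sum.inl (Sum.inr p)) 0 := by
  rcases i with (a | a) | c
  · simp only [wt_inl, wtS, Sum.elim_inl, Pi.single_apply]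
    rw [Finset.sum_eq_single a] <;> simp +contextual
  · simp only [wt_inl, wtS, Sum.elim_inr, Pi.neg_apply, Pi.single_apply]
    rw [Finset.sum_eq_single a] <;> simp +contextual
    exact FF_swap _ _ _ _ _
  · simp; exact FF_self _ _ _ _

theorem hM_eq (i : Fin (L+3)) : hM s i = ∑ p, ((ww i p : ℤ) : ℂ) • F s (Sum.inl (Sum.inl p)) (Sum.inl (Sum.inr p)) 0 := by
  rw [hM, F_diag, F_diag, ← Finset.sum_add_distrib, ww_eq]
  refine Finset.sum_congr rfl fun p _ => ?_
  rw [← add_smul]; simp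

theorem hM_lie (k : Fin (L+3)) (i j : Ix L) (m : ℤ × ℤ) :
    ⁅hM s k, F s i j m⁆ = ((∑ p, ww k p * (wt i p + wt j p) : ℤ) : ℂ) • F s i j m := by
  rw [hM_eq, sum_lie]
  simp only [smul_lie, Fpp_lie]
  rw [Int.cast_sum, Finset.sum_smul]
  refine Finset.sum_congr rfl fun p _ => ?_
  rw [smul_smul]; simp

end model
end Ell

namespace Ell
set_option linter.unusedSectionVars false
set_option linter.unusedSimpArgs false

variable {L : ℕ} (s : ℤ × ℤ)

theorem hM_eM (j i : Fin (L+3)) (t ε) : ⁅hM s j, eM s i t ε⁆ = ((sg ε * gm j i : ℤ) : ℂ) • eM s i t ε := by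
  have e1 : gm j i = ∑ p, ww j p * (wt (Sum.inl (nu i)) p + wt (vx i t) p) := by
    rw [gm_apply]; refine Finset.sum_congr rfl fun p _ => ?_
    rw [ww_eq i, wt_vx]; rfl
  have e2 : - gm j i = ∑ p, ww j p * (wt (br (Sum.inl (nu i))) p + wt (br (vx i t)) p) := by
    rw [e1, ← Finset.sum_neg_distrib]; refine Finset.sum_congr rfl fun p _ => ?_
    rw [wt_br, wt_br]; simp only [Pi.neg_apply]; ring
  cases ε
  · simp only [eM, sg_f, one_mul]
    rw [e1]; exact hM_lie s j _ _ _
  · simp only [eM, sg_t, neg_mul, one_mul, if_true]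
    rw [e2, lie_smul, hM_lie, smul_comm]

theorem hM_hM (i j : Fin (L+3)) : ⁅hM s i, hM s j⁆ = 0 := by
  conv_lhs => rw [hM.eq_1 s j]
  rw [lie_add, hM_lie, hM_lie]
  simp

theorem sy0 (n : ℤ × ℤ) : sy 0 n = 0 := by simp [sy]

theorem FFb_lie {u v : Ix L} (h1 : u ≠ v) (m : ℤ × ℤ) : 
    ⁅F s u v m, F s (br u) (br v) (-m)⁆ = -(F s u (br u) 0 + F s v (br v) 0) := by
  rw [FF_lie s br_br]
  have b : br u ≠ br v := fun e => h1 (by rw [← br_br u, e, br_br])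
  rw [if_neg b, if_pos rfl, if_pos rfl, if_neg b.symm, if_neg (fun h => b h.2.1)]
  have z : (if m + -m = s ∧ br v = br v ∧ br u = br u then (2 * sy s (-m)) • ZZ (Ix L) s else 0) = 0 := by
    split_ifs with h
    · rw [add_neg_cancel] at h; rw [← h.1, sy0]; simp
    · rfl
  rw [z, add_neg_cancel]; abel

theorem eM_ef (i : Fin (L+3)) (t) : ⁅eM s i t false, eM s i t true⁆ = (cc i : ℂ) • hM s i := by
  have h1 : (Sum.inl (nu i) : Ix L) ≠ vx i t := by
    cases t
    · exact nv_ne i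
    · exact nw_ne i
  simp only [eM, if_true, Bool.false_eq_true, if_false, lie_smul]
  rw [FFb_lie s h1, smul_neg, neg_smul, neg_neg, hM, F_diag s (vx i t), F_diag s (nv i), wt_vx]

theorem ad_pow_mem {d d' : Dg L} {x y : LL (Ix L) s} (hx : x ∈ Ld s d) (hy : y ∈ Ld s d') (n : ℕ) :
    (LieAlgebra.ad ℂ _ x ^ n) y ∈ Ld s (n • d + d') := by
  induction n with
  | zero => simpa using hy
  | succ n ih =>
    rw [pow_succ', Module.End.mul_apply, LieAlgebra.ad_apply]
    have := Ld_lie hx ih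
    rwa [show d + (n • d + d') = (n + 1) • d + d' by rw [succ_nsmul]; abel] at this

theorem gm_nonpos {i j : Fin (L+3)} (h : i ≠ j) : gm i j ≤ 0 := by
  induction i using fc3 with
  | h0 => induction j using fc3 with
    | h0 => exact absurd rfl h
    | h1 => simp
    | h2 q => rw [gm02]; split_ifs <;> simp
  | h1 => induction j using fc3 with
    | h0 => simp
    | h1 => exact absurd rfl h
    | h2 q => rw [gm12]; split_ifs <;> simp
  | h2 p => induction j using fc3 with
    | h0 => rw [gm_symm, gm02]; split_ifs <;> simp
    | h1 => rw [gm_symm, gm12]; split_ifs <;> simp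
    | h2 q => rw [gm2, if_neg (fun e => h (by rw [e]))]; split_ifs <;> simp

theorem gmd (i : Fin (L+3)) : (gm i i = 1 ∧ cc i = 2) ∨ (gm i i = 2 ∧ cc i = 1) := by
  induction i using fc3 <;> simp

theorem gm_one {i : Fin (L+3)} (h : gm i i = 1) : i = 0 ∨ i = 1 := by
  induction i using fc3 with
  | h0 => simp
  | h1 => simp
  | h2 q => simp at h

theorem eM01 (t t' ε ε') : ⁅eM s (0 : Fin (L+3)) t ε, eM s (1 : Fin (L+3)) t' ε'⁆ = 0 := by
  have H : ∀ x y : Sg L, x ≠ y → x ≠ y.swap → ∀ c, c ≠ 1 → ∀ m n, ⁅F s (Sum.inl x) (Sum.inr 1) m, F s (Sum.inl y) (Sum.inr c) n⁆ = 0 := by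
    intro x y h h' c hc m n
    have h2 : y ≠ x.swap := fun e => h' (by rw [e, Sum.swap_swap])
    rw [FF_lie s br_br]; simp [hc, h2]
  have V0 : vx (0 : Fin (L+3)) t = Sum.inr 1 := by cases t <;> rfl
  have V1 : ∃ c : Fin 3, c ≠ 1 ∧ vx (1 : Fin (L+3)) t' = Sum.inr c := by
    cases t'
    · exact ⟨0, by decide, rfl⟩
    · exact ⟨2, by decide, rfl⟩
  obtain ⟨c, hc, V1⟩ := V1
  have l0 : (0 : Fin (L+2)) ≠ Fin.last _ := (Fin.last_pos).ne
  simp only [eM, V0, V1, nu0, nu1, br_inl, br_inr]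
  cases ε <;> cases ε' <;> simp only [if_true, Bool.false_eq_true, if_false, lie_smul, smul_lie] <;>
    rw [H _ _ (by simp [l0, l0.symm]) (by simp [l0, l0.symm]) _ hc] <;> simp

theorem eM_sr5 (i j : Fin (L+3)) (t t' ε ε') (h : ¬ (i = j ∧ t = t')) :
    (LieAlgebra.ad ℂ _ (eM s i t ε) ^ (1 + (-(cc i * (sg ε * sg ε' * gm i j))).toNat)) (eM s j t' ε') = 0 := by
  by_cases h01 : (i = 0 ∧ j = 1) ∨ (i = 1 ∧ j = 0)
  · rcases h01 with ⟨rfl, rfl⟩ | ⟨rfl, rfl⟩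
    · simp [eM01]
    · simp [sk0 (eM01 s _ _ _ _)]
  have hm := ad_pow_mem s (eM_mem s i t ε) (eM_mem s j t' ε') (1 + (-(cc i * (sg ε * sg ε' * gm i j))).toNat)
  set x := (1 + (-(cc i * (sg ε * sg ε' * gm i j))).toNat) with hx
  have key : (2:ℤ) < ∑ p, ((x • ((sg ε • ww i, sg ε • lx i t) : Dg L) + (sg ε' • ww j, sg ε' • lx j t')).1 p) ^ 2 := by
    have e : ∑ p, ((x • ((sg ε • ww i, sg ε • lx i t) : Dg L) + (sg ε' • ww j, sg ε' • lx j t')).1 p) ^ 2 =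
      (x:ℤ)^2 * gm i i + 2 * x * (sg ε * sg ε' * gm i j) + gm j j := by
      rw [gm_apply, gm_apply, gm_apply, Finset.mul_sum, Finset.mul_sum, Finset.mul_sum, ← Finset.sum_add_distrib, ← Finset.sum_add_distrib]
      refine Finset.sum_congr rfl fun p _ => ?_
      simp only [Prod.fst_add, Prod.smul_fst, Pi.add_apply, Pi.smul_apply, smul_eq_mul]
      simp only [nsmul_eq_mul]
      have a := sg_sq ε
      have b := sg_sq ε'
      linear_combination (x:ℤ)^2 * ww i p * ww i p * a + ww j p * ww j p * b
    rw [e]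
    set g := sg ε * sg ε' * gm i j with hg
    have hx' : (x:ℤ) = 1 + max (-(cc i * g)) 0 := by rw [hx]; push_cast; rw [Int.toNat_eq_max]
    have hs : g = gm i j ∨ g = - gm i j := by
      cases ε <;> cases ε' <;> simp [hg]
    by_cases hij : i = j
    · subst hij
      rcases gmd i with ⟨h1, h2⟩ | ⟨h1, h2⟩ <;> rw [h1] at hs ⊢ <;> rw [h2] at hx' <;> rcases hs with hs | hs <;> rw [hs] at hx' ⊢ <;> norm_num at hx' <;> rw [hx'] <;> norm_num
    · have g0 : gm i i = 2 ∨ gm j j = 2 ∨ gm i j ≠ 0 := by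
        by_contra hc
        push Not at hc
        rcases gmd i with ⟨h1, -⟩ | ⟨h1, -⟩
        · rcases gmd j with ⟨h2, -⟩ | ⟨h2, -⟩
          · rcases gm_one h1 with rfl | rfl <;> rcases gm_one h2 with rfl | rfl <;> simp at h01 hij
          · omega
        · omega
      have jj : 1 ≤ gm j j := by rcases gmd j with ⟨h1, -⟩ | ⟨h1, -⟩ <;> omega
      have gg : g ≠ 0 ↔ gm i j ≠ 0 := by rcases hs with hs | hs <;> rw [hs] <;> simp
      rw [← gg] at g0
      clear_value x g
      rcases le_or_gt 0 g with hgg | hgg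
      · have : (x:ℤ) = 1 := by
          rw [hx', max_eq_right]
          · ring
          · have := mul_nonneg (cc_pos i).le hgg; omega
        rw [this]
        rcases gmd i with ⟨h1, -⟩ | ⟨h1, -⟩ <;> omega
      · have : (x:ℤ) = 1 - cc i * g := by
          rw [hx', max_eq_left]
          · ring
          · have := mul_neg_of_pos_of_neg (cc_pos i) hgg; omega
        rw [this]
        rcases gmd i with ⟨h1, h2⟩ | ⟨h1, h2⟩ <;> rw [h1, h2] <;> ring_nf <;> nlinarith
  rw [Ld_big key] at hm
  exact (Submodule.mem_bot ℂ).1 hm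

end Ell

namespace Ell
set_option linter.unusedSectionVars false
set_option linter.unusedSimpArgs false

variable {L : ℕ} (s : ℤ × ℤ)

theorem edge {i j : Fin (L+3)} (h : 2 * gm i j = - gm j j) :
    (i = 1 ∧ j = (0 : Fin (L+1)).succ.succ) ∨ (kk i = 2 ∧ kk j = 2 ∧ nw i = nv i ∧ nw j = nv j ∧
      ((i = 0 ∧ j = (Fin.last L).succ.succ) ∨ ∃ p q : Fin (L+1), (p.val + 1 = q.val ∨ q.val + 1 = p.val) ∧ i = p.succ.succ ∧ j = q.succ.succ)) := by
  induction j using fc3 with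
  | h0 => simp at h; omega
  | h1 => simp at h; omega
  | h2 q =>
    induction i using fc3 with
    | h0 =>
      rw [gm02] at h
      split_ifs at h with hq
      · subst hq; right; exact ⟨rfl, rfl, rfl, rfl, Or.inl ⟨rfl, rfl⟩⟩
      · simp at h
    | h1 =>
      rw [gm12] at h
      split_ifs at h with hq
      · subst hq; left; simp
      · simp at h
    | h2 p =>
      rw [gm2] at h
      split_ifs at h with hq hq'
      · simp at h
      · right; exact ⟨rfl, rfl, rfl, rfl, Or.inr ⟨p, q, hq', rfl, rfl⟩⟩
      · simp at h

theorem F_lie_eq {i j k l : Ix L} {m n m' n' : ℤ × ℤ} (hw : wt i + wt j + (wt k + wt l) ≠ 0) (hm : m + n = m' + n') :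
    ⁅F s i j m, F s k l n⁆ = ⁅F s i j m', F s k l n'⁆ := by
  have z1 : ¬ (k = br j ∧ l = br i) := by
    rintro ⟨rfl, rfl⟩; exact hw (by rw [wt_br, wt_br]; abel)
  have z2 : ¬ (l = br j ∧ k = br i) := by
    rintro ⟨rfl, rfl⟩; exact hw (by rw [wt_br, wt_br]; abel)
  simp only [FF_lie s br_br, z1, z2, and_false, if_false, hm]

theorem ww_ne {i j : Fin (L+3)} (h : 2 * gm i j = - gm j j) : ww i + ww j ≠ 0 := by
  intro e
  have e1 : gm i i + gm i j = 0 := by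
    rw [gm_dot, gm_dot, ← dotProduct_add, e, dotProduct_zero]
  have e2 : gm j i + gm j j = 0 := by
    rw [gm_dot, gm_dot, ← dotProduct_add, e, dotProduct_zero]
  have e3 := gm_symm i j
  rcases gmd j with ⟨h1, -⟩ | ⟨h1, -⟩ <;> omega

/-- chain computation at the special edge -/
theorem spc (x y : Sg L) (h : x ≠ y) (h' : y ≠ x.swap) (c : Fin 3) (m n : ℤ × ℤ) :
    ⁅F s (Sum.inl x) (Sum.inr c) m, F s (Sum.inl y) (Sum.inl x.swap) n⁆ = F s (Sum.inr c) (Sum.inl y) (m + n) := by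
  rw [FF_lie s br_br]; simp [h, h']

theorem spc2 (x y : Sg L) (h' : y ≠ x.swap) (c c' : Fin 3) (m n : ℤ × ℤ) :
    ⁅F s (Sum.inl x) (Sum.inr c) m, F s (Sum.inr c') (Sum.inl y) n⁆ = if c' = c then F s (Sum.inl x) (Sum.inl y) (m + n) else 0 := by
  rw [FF_lie s br_br]; simp [h', Ne.symm h']

theorem eM_prs : Prs (eM (L := L) s) (hM s) 0 where
  hh := hM_hM s
  hha := by simp
  he := hM_eM s
  hae := by simp
  ef i t := by rw [eM_ef, smul_zero, add_zero]
  sr5 := eM_sr5 s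
  sr6 i j ε h := by
    rcases edge h with ⟨rfl, rfl⟩ | ⟨h1, h2, h3, h4, -⟩
    · have d1 : (Sum.inl 0 : Sg L) ≠ Sum.inl (Fin.succ 0) := by simp [(Fin.succ_ne_zero _).symm]
      have d2 : (Sum.inr 0 : Sg L) ≠ Sum.inr (Fin.succ 0) := by simp [(Fin.succ_ne_zero _).symm]
      have r : (kk (0 : Fin (L+1)).succ.succ).toNat / (kk (1 : Fin (L+3))).toNat = 2 := by rw [kk1, kk2]; rfl
      rw [r]
      simp only [pow_two, Module.End.mul_apply, LieAlgebra.ad_apply]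
      cases ε
      · simp only [eM, vx, lx, lamw, if_true, Bool.false_eq_true, if_false, nu1, nu2, nv1, nv2, nw1, nw2, lam1, lam2, kk1, kk2, Fin.castSucc_zero]
        have a := spc s (Sum.inl 0 : Sg L) (Sum.inl (Fin.succ 0)) d1 (by simp)
        have b := spc2 s (Sum.inl 0 : Sg L) (Sum.inl (Fin.succ 0)) (by simp)
        simp only [Sum.swap_inl] at a
        rw [a, a, b, b]
        simp
      · simp only [eM, vx, lx, lamw, if_true, Bool.false_eq_true, if_false, nu1, nu2, nv1, nv2, nw1, nw2, lam1, lam2, kk1, kk2, Fin.castSucc_zero, br_inl, br_inr, Sum.swap_inl, Sum.swap_inr, lie_smul, smul_lie]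
        have a := spc s (Sum.inr 0 : Sg L) (Sum.inr (Fin.succ 0)) d2 (by simp)
        have b := spc2 s (Sum.inr 0 : Sg L) (Sum.inr (Fin.succ 0)) (by simp)
        simp only [Sum.swap_inr] at a
        rw [a, a, b, b]
        simp
    · rw [h1, h2, show (2:ℤ).toNat / (2:ℤ).toNat = 1 from rfl, pow_one, pow_one, LieAlgebra.ad_apply, LieAlgebra.ad_apply]
      have hw := ww_ne h
      rw [ww_eq, ww_eq] at hw
      cases ε
      · simp only [eM, vx, lx, lamw, if_true, Bool.false_eq_true, if_false, h3, h4, h1, h2]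
        exact F_lie_eq s hw (by abel)
      · simp only [eM, vx, lx, lamw, if_true, Bool.false_eq_true, if_false, h3, h4, h1, h2, lie_smul, smul_lie]
        congr 2
        refine F_lie_eq s ?_ (by abel)
        rw [wt_br, wt_br, wt_br, wt_br, ← neg_add, ← neg_add, ← neg_add]
        exact neg_ne_zero.2 hw
  sr8 i j ε h n hn hn' := by
    rcases edge h with ⟨rfl, rfl⟩ | ⟨h1, h2, h3, h4, -⟩
    · have d1 : (Sum.inl 0 : Sg L) ≠ Sum.inl (Fin.succ 0) := by simp [(Fin.succ_ne_zero _).symm]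
      have d2 : (Sum.inr 0 : Sg L) ≠ Sum.inr (Fin.succ 0) := by simp [(Fin.succ_ne_zero _).symm]
      have r : (kk (0 : Fin (L+1)).succ.succ).toNat / (kk (1 : Fin (L+3))).toNat = 2 := by rw [kk1, kk2]; rfl
      rw [r] at hn' ⊢
      obtain rfl : n = 1 := by omega
      simp only [pow_one, LieAlgebra.ad_apply, Nat.add_one_sub_one]
      cases ε
      · simp only [eM, vx, lx, lamw, if_true, Bool.false_eq_true, if_false, nu1, nu2, nv1, nv2, nw1, nw2, lam1, lam2, kk1, kk2, Fin.castSucc_zero]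
        have a := spc s (Sum.inl 0 : Sg L) (Sum.inl (Fin.succ 0)) d1 (by simp)
        have b := spc2 s (Sum.inl 0 : Sg L) (Sum.inl (Fin.succ 0)) (by simp)
        simp only [Sum.swap_inl] at a
        rw [a, b]
        simp
      · simp only [eM, vx, lx, lamw, if_true, Bool.false_eq_true, if_false, nu1, nu2, nv1, nv2, nw1, nw2, lam1, lam2, kk1, kk2, Fin.castSucc_zero, br_inl, br_inr, Sum.swap_inl, Sum.swap_inr, lie_smul, smul_lie]
        have a := spc s (Sum.inr 0 : Sg L) (Sum.inr (Fin.succ 0)) d2 (by simp)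
        have b := spc2 s (Sum.inr 0 : Sg L) (Sum.inr (Fin.succ 0)) (by simp)
        simp only [Sum.swap_inr] at a
        rw [a, b]
        simp
    · rw [h1, h2, show (2:ℤ).toNat / (2:ℤ).toNat = 1 from rfl] at hn'
      omega

end Ell

namespace Ell
set_option linter.unusedSectionVars false
set_option linter.unusedSimpArgs false

section prs
variable {L : ℕ} {G : Type*} [LieRing G] [LieAlgebra ℂ G] {e : Fin (L+3) → Bool → Bool → G} {h : Fin (L+3) → G} {ha : G}

theorem Prs.s1 (q : Prs e h ha) {i j : Fin (L+3)} {t t' ε ε' : Bool} (hn : ¬ (i = j ∧ t = t'))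
    (hx : 0 ≤ sg ε * sg ε' * gm i j) : ⁅e i t ε, e j t' ε'⁆ = 0 := by
  have := q.sr5 i j t t' ε ε' hn
  rw [Int.toNat_of_nonpos (by have := mul_nonneg (cc_pos i).le hx; omega)] at this
  simpa using this

theorem Prs.s2 (q : Prs e h ha) {i j : Fin (L+3)} {t t' ε ε' : Bool} (hn : ¬ (i = j ∧ t = t'))
    (hx : cc i * (sg ε * sg ε' * gm i j) = -1) : ⁅e i t ε, ⁅e i t ε, e j t' ε'⁆⁆ = 0 := by
  have := q.sr5 i j t t' ε ε' hn
  rw [hx, show 1 + (- -1 : ℤ).toNat = 2 from rfl] at this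
  simpa [pow_two] using this

theorem Prs.s3 (q : Prs e h ha) {i j : Fin (L+3)} {t t' ε ε' : Bool} (hn : ¬ (i = j ∧ t = t'))
    (hx : cc i * (sg ε * sg ε' * gm i j) = -2) : ⁅e i t ε, ⁅e i t ε, ⁅e i t ε, e j t' ε'⁆⁆⁆ = 0 := by
  have := q.sr5 i j t t' ε ε' hn
  rw [hx, show 1 + (- -2 : ℤ).toNat = 3 from rfl] at this
  simpa [pow_succ'] using this

theorem Prs.opp (q : Prs e h ha) {i j : Fin (L+3)} (hij : i ≠ j) (t t' ε : Bool) : ⁅e i t ε, e j t' (!ε)⁆ = 0 := by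
  refine q.s1 (fun h => hij h.1) ?_
  have := gm_nonpos hij
  cases ε <;> simp <;> omega

/-- generation hypothesis -/
def Gen (e : Fin (L+3) → Bool → Bool → G) : Prop := LieSubalgebra.lieSpan ℂ G {x | ∃ i t ε, x = e i t ε} = ⊤

theorem Prs.cz (q : Prs e h ha) (g : Gen e) (x : G) : ⁅ha, x⁆ = 0 := by
  have := gen_top g (U := LinearMap.ker (LieAlgebra.ad ℂ G ha)) ?_ ?_
  · have hx : x ∈ LinearMap.ker (LieAlgebra.ad ℂ G ha) := this ▸ Submodule.mem_top
    exact hx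
  · rintro _ ⟨i, t, ε, rfl⟩; exact q.hae i t ε
  · rintro _ ⟨i, t, ε, rfl⟩ y hy
    change ⁅ha, y⁆ = 0 at hy
    change ⁅ha, _⁆ = 0
    rw [leibniz_lie, hy, q.hae]; simp

theorem Prs.quad (q : Prs e h ha) (g : Gen e) (i : Fin (L+3)) :
    Quad (e i false false) (e i true false) (e i false true) (e i true true) ((cc i : ℂ) • h i) ((cc i * kk i : ℂ) • ha) where
  ef := by rw [q.ef]; simp
  EF := by rw [q.ef]; simp [smul_smul]
  cz x := by rw [smul_lie, q.cz g, smul_zero]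
  he := by rw [smul_lie, q.he, smul_smul]; norm_cast; rw [sg_f, one_mul, cc_gm, ofNat_zsmul]
  hE := by rw [smul_lie, q.he, smul_smul]; norm_cast; rw [sg_f, one_mul, cc_gm, ofNat_zsmul]
  hf := by rw [smul_lie, q.he, smul_smul]; norm_cast; rw [sg_t, mul_left_comm, cc_gm]; simp
  hF := by rw [smul_lie, q.he, smul_smul]; norm_cast; rw [sg_t, mul_left_comm, cc_gm]; simp
  eE := q.s1 (by simp) (by rcases gmd i with ⟨h1, -⟩ | ⟨h1, -⟩ <;> simp [h1])
  fF := q.s1 (by simp) (by rcases gmd i with ⟨h1, -⟩ | ⟨h1, -⟩ <;> simp [h1])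
  eeeF := q.s3 (by simp) (by simp [cc_gm])
  fffE := q.s3 (by simp) (by simp [cc_gm])
  EEEf := q.s3 (by simp) (by simp [cc_gm])
  FFFe := q.s3 (by simp) (by simp [cc_gm])

theorem Prs.ef' (q : Prs e h ha) (i t ε) : ∃ (a b : ℂ), ⁅e i t ε, e i t (!ε)⁆ = a • h i + b • ha := by
  cases ε
  · exact ⟨_, _, by rw [Bool.not_false, q.ef, smul_add, smul_smul]⟩
  · refine ⟨-(cc i : ℂ), -(cc i : ℂ) * ((if t then kk i else 0 : ℤ) : ℂ), ?_⟩
    rw [Bool.not_true, ← lie_skew, q.ef]; module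

theorem Prs.ln (q : Prs e h ha) (g : Gen e) (i t ε) : LN (e i t ε) := by
  intro v
  have : (⊤ : LieSubalgebra ℂ G) ≤ LieSubalgebra.engel ℂ (e i t ε) := by
    rw [← g, LieSubalgebra.lieSpan_le]
    rintro _ ⟨j, t', ε', rfl⟩
    rw [SetLike.mem_coe, LieSubalgebra.mem_engel_iff]
    by_cases hij : i = j ∧ t = t'
    · obtain ⟨rfl, rfl⟩ := hij
      by_cases hε : ε = ε'
      · subst hε; exact ⟨1, by simp⟩
      · obtain rfl : ε' = !ε := by cases ε <;> cases ε' <;> simp_all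
        obtain ⟨a, b, hab⟩ := q.ef' i t ε
        refine ⟨3, ?_⟩
        have h1 : ⁅e i t ε, h i⁆ = (-((sg ε * gm i i : ℤ) : ℂ)) • e i t ε := by
          rw [← lie_skew, q.he, neg_smul]
        have h2 : ⁅e i t ε, ha⁆ = 0 := sk0 (q.hae _ _ _)
        simp [pow_succ', hab, h1, h2]
    · exact ⟨_, q.sr5 i j t t' ε ε' hij⟩
  have hv := this (LieSubalgebra.mem_top v)
  rwa [LieSubalgebra.mem_engel_iff] at hv

variable {es fs hs : Fin (L+3) → ℤ → G} {c : Fin (L+3) → G}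

/-- families -/
structure Fml (e : Fin (L+3) → Bool → Bool → G) (h : Fin (L+3) → G) (es fs hs : Fin (L+3) → ℤ → G) (c : Fin (L+3) → G) : Prop where
  loop : ∀ i, Loop (es i) (fs i) (hs i) (c i)
  e0 : ∀ i, es i 0 = e i false false
  e1 : ∀ i, es i 1 = e i true false
  f0 : ∀ i, fs i 0 = e i false true
  f1 : ∀ i, fs i (-1) = e i true true
  h0 : ∀ i, hs i 0 = (cc i : ℂ) • h i

theorem Prs.fml (q : Prs e h ha) (g : Gen e) : ∃ es fs hs, Fml e h es fs hs (fun i => ((cc i * kk i : ℂ) • ha)) := by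
  choose es fs hs l e0 e1 f0 f1 using fun i => (q.quad g i).loop
  refine ⟨es, fs, hs, l, e0, e1, f0, f1, fun i => ?_⟩
  rw [← (l i).ef0 0, e0, f0, (q.quad g i).ef]

theorem Fml.cm (m : Fml e h es fs hs c) (q : Prs e h ha) {i j : Fin (L+3)} (hij : i ≠ j) : Comm (es i) (fs i) (es j) (fs j) := by
  constructor <;> simp only [m.e0, m.e1, m.f0, m.f1]
  · exact q.opp hij _ _ false
  · exact q.opp hij _ _ false
  · exact q.opp hij _ _ false
  · exact q.opp hij _ _ false
  · exact q.opp hij.symm _ _ false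
  · exact q.opp hij.symm _ _ false
  · exact q.opp hij.symm _ _ false
  · exact q.opp hij.symm _ _ false

theorem Fml.or (m : Fml e h es fs hs c) (q : Prs e h ha) {i j : Fin (L+3)} (hij : i ≠ j) (h0 : gm i j = 0) :
    PairOK (es i) (fs i) (hs i) (es j) (fs j) (hs j) := by
  have H : ∀ t t' ε ε', ⁅e i t ε, e j t' ε'⁆ = 0 := fun t t' ε ε' => q.s1 (fun h => hij h.1) (by simp [h0])
  apply PairOr.ok (m.loop i) (m.loop j) (m.cm q hij) <;> simp only [m.e0, m.e1, m.f0, m.f1, H]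

theorem Fml.wts (m : Fml e h es fs hs c) (q : Prs e h ha) {i j : Fin (L+3)} {b : ℂ} (hb : ((cc i * gm i j : ℤ) : ℂ) = -b) :
    Wts (hs i 0) (es j) (fs j) b := by
  push_cast at hb
  constructor <;> simp only [m.e0, m.e1, m.f0, m.f1, m.h0, smul_lie, q.he, smul_smul, sg_t, sg_f] <;> push_cast <;> congr 1 <;>
    first | linear_combination hb | linear_combination -hb

theorem Fml.ln (m : Fml e h es fs hs c) (q : Prs e h ha) (g : Gen e) (i : Fin (L+3)) : LN4 (es i) (fs i) := by
  constructor <;> simp only [m.e0, m.e1, m.f0, m.f1] <;> exact q.ln g _ _ _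

theorem edge_gm {i j : Fin (L+3)} (h : 2 * gm i j = - gm j j) : i ≠ j ∧ gm i j = -1 ∧ gm j j = 2 ∧ cc j = 1 := by
  have hne : i ≠ j := by
    rintro rfl; rcases gmd i with ⟨h1, -⟩ | ⟨h1, -⟩ <;> omega
  rcases gmd j with ⟨h1, h2⟩ | ⟨h1, h2⟩
  · omega
  · exact ⟨hne, by omega, h1, h2⟩

theorem Fml.edge (m : Fml e h es fs hs c) (q : Prs e h ha) (g : Gen e) {i j : Fin (L+3)} (hij : 2 * gm i j = - gm j j) :
    PairOK (es j) (fs j) (hs j) (es i) (fs i) (hs i) := by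
  obtain ⟨hne, h1, h2, h3⟩ := edge_gm hij
  have wx : Wts (hs j 0) (es i) (fs i) 1 := m.wts q (by rw [h3, gm_symm, h1]; simp)
  have h6 := q.sr6 i j
  have h8 := q.sr8 i j
  rcases Ell.edge hij with ⟨rfl, rfl⟩ | ⟨k1, k2, -⟩
  · have hr : (kk (L := L) (0 : Fin (L+1)).succ.succ).toNat / (kk (L := L) 1).toNat = 2 := by
      rw [show kk (L := L) (0 : Fin (L+1)).succ.succ = 2 from rfl, show kk (L := L) 1 = 1 from rfl]; rfl
    rw [hr] at h6 h8
    refine (PairSp0.sp ⟨m.loop _, m.loop _, m.cm q hne.symm, wx, m.wts q ?_, ?_, ?_, ?_, ?_, m.ln q g _, ?_, ?_⟩).ok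
    · rw [h1]; simp
    all_goals simp only [m.e0, m.e1, m.f0, m.f1]
    · simpa [pow_two] using h6 false hij
    · simpa [pow_two] using h6 true hij
    · simpa using h8 false hij 1 le_rfl (by norm_num)
    · simpa using h8 true hij 1 le_rfl (by norm_num)
    · exact q.s3 (fun h => hne h.1) (by rw [h1]; simp)
    · exact q.s3 (fun h => hne h.1) (by rw [h1]; simp)
  · have hr : (kk j).toNat / (kk i).toNat = 1 := by rw [k1, k2]; rfl
    rw [hr] at h6
    refine PairEq.ok (cx := c j) (cy := c i) (b := (cc i : ℂ)) ⟨m.loop _, m.loop _, m.cm q hne.symm, wx, m.wts q ?_, ?_, ?_, ?_, ?_, ?_, ?_, m.ln q g _⟩ ?_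
    · rw [h1]; simp
    on_goal 7 => rcases gmd i with ⟨-, h⟩ | ⟨-, h⟩ <;> rw [h] <;> norm_num
    all_goals simp only [m.e0, m.e1, m.f0, m.f1]
    · simpa using h6 false hij
    · simpa using h6 true hij
    all_goals exact q.s2 (fun h => hne h.1.symm) (by rw [gm_symm, h1, h3]; simp)

theorem gm_cases {i j : Fin (L+3)} (hij : i ≠ j) : gm i j = 0 ∨ 2 * gm i j = - gm j j ∨ 2 * gm j i = - gm i i := by
  induction i using fc3 with
  | h0 =>
    induction j using fc3 with
    | h0 => exact absurd rfl hij
    | h1 => simp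
    | h2 q => rw [gm02, gm2]; split_ifs <;> simp_all
  | h1 =>
    induction j using fc3 with
    | h0 => simp
    | h1 => exact absurd rfl hij
    | h2 q => rw [gm12, gm2]; split_ifs <;> simp_all
  | h2 p =>
    induction j using fc3 with
    | h0 => rw [gm_symm, gm02, gm2]; split_ifs <;> simp_all
    | h1 => rw [gm_symm, gm12, gm2]; split_ifs <;> simp_all
    | h2 q =>
      rw [gm2, gm2 q q]
      have : p ≠ q := fun h => hij (by rw [h])
      rw [if_neg this]; split_ifs <;> simp_all

theorem Fml.ok (m : Fml e h es fs hs c) (q : Prs e h ha) (g : Gen e) {i j : Fin (L+3)} (hij : i ≠ j) :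
    PairOK (es i) (fs i) (hs i) (es j) (fs j) (hs j) := by
  rcases gm_cases hij with h0 | h0 | h0
  · exact m.or q hij h0
  · exact (m.edge q g h0).symm
  · exact m.edge q g h0

/-- degree of a generator -/
def dg (i : Fin (L+3)) (t ε : Bool) : (Fin (L+3) → ℤ) × ℤ := sg ε • (Pi.single i 1, if t then kk i else 0)

theorem Prs.wt (q : Prs e h ha) (g : Gen e) {gr : (Fin (L+3) → ℤ) × ℤ → Submodule ℂ G} (ind : iSupIndep gr)
    (mul : ∀ d d', ∀ x ∈ gr d, ∀ y ∈ gr d', ⁅x, y⁆ ∈ gr (d + d')) (deg : ∀ i t ε, e i t ε ∈ gr (dg i t ε))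
    (i) (d) (x) (hx : x ∈ gr d) : ⁅h i, x⁆ = ((ba i d.1 : ℤ) : ℂ) • x := by
  let A : (Fin (L+3) → ℤ) × ℤ → Submodule ℂ G := fun d => gr d ⊓ LinearMap.ker (LieAlgebra.ad ℂ G (h i) - ((ba i d.1 : ℤ) : ℂ) • LinearMap.id)
  have hAm : ∀ d y, y ∈ A d ↔ y ∈ gr d ∧ ⁅h i, y⁆ = ((ba i d.1 : ℤ) : ℂ) • y := by
    intro d y; simp [A, sub_eq_zero]
  have hgA : ∀ j t ε, e j t ε ∈ A (dg j t ε) := by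
    intro j t ε
    rw [hAm]
    refine ⟨deg j t ε, ?_⟩
    rw [q.he, dg, Prod.smul_fst, map_zsmul, smul_eq_mul]; rfl
  have := iSupIndep_extract ind (A := A) (fun d => inf_le_left) (gen_top g ?_ ?_) d hx
  · exact ((hAm _ _).1 this).2
  · rintro _ ⟨j, t, ε, rfl⟩
    exact Submodule.mem_iSup_of_mem _ (hgA j t ε)
  · rintro _ ⟨j, t, ε, rfl⟩ y hy
    induction hy using Submodule.iSup_induction' with
    | mem d y hy =>
      refine Submodule.mem_iSup_of_mem (dg j t ε + d) ?_
      have h1 := (hAm _ _).1 (hgA j t ε)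
      have h2 := (hAm _ _).1 hy
      refine (hAm _ _).2 ⟨mul _ _ _ h1.1 _ h2.1, ?_⟩
      rw [leibniz_lie, h1.2, h2.2, smul_lie, lie_smul, Prod.fst_add, map_add, Int.cast_add, add_smul]
    | zero => simp
    | add y z _ _ hy hz => rw [lie_add]; exact add_mem hy hz

theorem Prs.dat (q : Prs e h ha) (g : Gen e) {gr : (Fin (L+3) → ℤ) × ℤ → Submodule ℂ G} (ind : iSupIndep gr)
    (mul : ∀ d d', ∀ x ∈ gr d, ∀ y ∈ gr d', ⁅x, y⁆ ∈ gr (d + d')) (deg : ∀ i t ε, e i t ε ∈ gr (dg i t ε))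
    (ha0 : ha ∈ gr 0) {s : ℤ × ℤ} {Φ : G →ₗ⁅ℂ⁆ LL (Ix L) s} (hΦ : ∀ i t ε, Φ (e i t ε) = eM s i t ε) :
    ∃ es fs hs c, Dat s (fun d => gr (Function.invFun toD d)) es fs hs c Φ := by
  obtain ⟨es, fs, hs, m⟩ := q.fml g
  have hinv : ∀ d : (Fin (L+3) → ℤ) × ℤ, Function.invFun toD (toD d) = d := Function.leftInverse_invFun toD_inj
  have hadd : ∀ d d' : Dg L, Function.invFun toD (d + d') = Function.invFun toD d + Function.invFun toD d' := by
    intro d d'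
    obtain ⟨x, rfl⟩ := toD_surj d
    obtain ⟨y, rfl⟩ := toD_surj d'
    rw [← toD_add, hinv, hinv, hinv]
  refine ⟨es, fs, hs, fun i => ((cc i * kk i : ℂ) • ha), ⟨ind.comp (Function.rightInverse_invFun toD_surj).injective, ?_, ?_, ?_, ?_, ?_, ?_, ?_⟩⟩
  · intro d d' x hx y hy
    simp only [hadd]
    exact mul _ _ x hx y hy
  · simp only [hinv]
    refine ⟨ind, mul, m.loop, fun i j hij => m.ok q g hij, ?_, ?_, ?_, ?_, fun i => Submodule.smul_mem _ _ ha0, ?_⟩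
    · intro i; rw [m.e0]; simpa [dg] using deg i false false
    · intro i; rw [m.e1]; simpa [dg] using deg i true false
    · intro i; rw [m.f0]; simpa [dg] using deg i false true
    · intro i; rw [m.f1]; simpa [dg] using deg i true true
    · rw [← g]
      congr 1
      ext x
      simp only [m.e0, m.e1, m.f0, m.f1, Set.mem_setOf_eq, Bool.exists_bool]
      refine exists_congr fun i => ?_
      tauto
  · simp only [hinv]
    refine ⟨cc_pos, ba_cc, ba_pos, ?_, fun i => (m.ln q g i).e0, fun i => (m.ln q g i).f0⟩
    intro i d x hx
    rw [m.h0, smul_lie, q.wt g ind mul deg i d x hx, smul_smul]; push_cast; rfl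
  · intro i; rw [m.e0, hΦ]; rfl
  · intro i; rw [m.e1, hΦ]; rfl
  · intro i; rw [m.f0, hΦ]; rfl
  · intro i; rw [m.f1, hΦ]; rfl

theorem toD_const (m r : ℤ) : toD (L := L) (fun _ => m, r) = (0, (m, r)) := by
  ext <;> simp [toD, bb_apply]

theorem Prs.dims (q : Prs e h ha) (g : Gen e) {gr : (Fin (L+3) → ℤ) × ℤ → Submodule ℂ G} (ind : iSupIndep gr)
    (mul : ∀ d d', ∀ x ∈ gr d, ∀ y ∈ gr d', ⁅x, y⁆ ∈ gr (d + d')) (deg : ∀ i t ε, e i t ε ∈ gr (dg i t ε))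
    (ha0 : ha ∈ gr 0) (hΦ : ∀ s, ∃ Φ : G →ₗ⁅ℂ⁆ LL (Ix L) s, ∀ i t ε, Φ (e i t ε) = eM s i t ε) (m r : ℤ) :
    (¬ (Even m ∧ Even r) → Module.finrank ℂ (gr (fun _ => m, r)) = 1) ∧
    ((Even m ∧ Even r) → ¬ (m = 0 ∧ r = 0) → Module.finrank ℂ (gr (fun _ => m, r)) = L + 3) := by
  obtain ⟨Φ, hΦ⟩ := hΦ (m, r)
  obtain ⟨es, fs, hs, c, D⟩ := q.dat g ind mul deg ha0 hΦ
  have hinv : ∀ d : (Fin (L+3) → ℤ) × ℤ, Function.invFun toD (toD d) = d := Function.leftInverse_invFun toD_inj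
  have := D.dims
  have hEv : Even (m, r) ↔ Even m ∧ Even r := by
    constructor
    · rintro ⟨⟨x, y⟩, hxy⟩
      simp at hxy
      exact ⟨⟨x, hxy.1⟩, ⟨y, hxy.2⟩⟩
    · rintro ⟨⟨x, hx⟩, ⟨y, hy⟩⟩
      exact ⟨(x, y), by simp [hx, hy]⟩
  rw [hEv] at this
  rw [show Function.invFun toD ((0, (m, r)) : Dg L) = (fun _ => m, r) by rw [← toD_const, hinv]] at this
  refine ⟨this.1, fun h1 h2 => this.2 h1 ?_⟩
  simpa using h2

end prs
end Ell

namespace Ell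
set_option linter.unusedSectionVars false
set_option linter.unusedSimpArgs false
open TensorProduct

/-- the geometric data -/
structure Geo {L : ℕ} {V : Type*} [AddCommGroup V] [Module ℝ V] (B : LinearMap.BilinForm ℝ V) (a : V) (P : Set V)
    (k : V → ℕ) (g : V → Bool) (α : Fin (L+3) → V) : Prop where
  li : LinearIndependent ℝ (Sum.elim α (fun _ : Unit => a))
  top : ⊤ ≤ Submodule.span ℝ (Set.range (Sum.elim α (fun _ : Unit => a)))
  rg : Set.range α = P
  gram : ∀ i j, B (α i) (α j) = (gm i j : ℝ)
  al : ∀ v, B a v = 0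
  ar : ∀ v, B v a = 0
  hk : ∀ i, (k (α i) : ℤ) = kk i
  hg : ∀ i, g (α i) = false

section geo
variable {L : ℕ} {V : Type*} [AddCommGroup V] [Module ℝ V] {B : LinearMap.BilinForm ℝ V} {a : V} {P : Set V}
    {k : V → ℕ} {g : V → Bool} {α : Fin (L+3) → V}

/-- evaluation of degrees -/
def ev (α : Fin (L+3) → V) (a : V) (d : (Fin (L+3) → ℤ) × ℤ) : V := ∑ i, d.1 i • α i + d.2 • a

theorem ev_add (d d' : (Fin (L+3) → ℤ) × ℤ) : ev α a (d + d') = ev α a d + ev α a d' := by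
  simp only [ev, Prod.fst_add, Prod.snd_add, Pi.add_apply, add_smul, Finset.sum_add_distrib]; abel

theorem ev_zero : ev α a 0 = 0 := by simp [ev]

theorem ev_inj (q : Geo B a P k g α) : Function.Injective (ev α a) := by
  intro d d' h
  have hli := Fintype.linearIndependent_iff.1 q.li
  have := hli (Sum.elim (fun i => ((d.1 i - d'.1 i : ℤ) : ℝ)) (fun _ => ((d.2 - d'.2 : ℤ) : ℝ))) (by
    simp only [Fintype.sum_sum_type, Sum.elim_inl, Sum.elim_inr, Finset.univ_unique, Finset.sum_singleton, Int.cast_smul_eq_zsmul,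
      sub_smul, Finset.sum_sub_distrib]
    simp only [ev] at h
    rw [← sub_eq_zero] at h
    rw [← h]; abel)
  refine Prod.ext ?_ ?_
  · funext i
    have := this (Sum.inl i)
    simp only [Sum.elim_inl, Int.cast_eq_zero] at this
    omega
  · have := this (Sum.inr ())
    simp only [Sum.elim_inr, Int.cast_eq_zero] at this
    omega

/-- the elements of the set B -/
def mu (α : Fin (L+3) → V) (a : V) (i : Fin (L+3)) (t ε : Bool) : V := sg ε • (α i + (if t then kk i else 0) • a)

theorem ev_dg (i : Fin (L+3)) (t ε : Bool) : ev α a (dg i t ε) = mu α a i t ε := by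
  simp only [ev, dg, mu, Prod.smul_fst, Prod.smul_snd, Pi.smul_apply, smul_eq_mul, mul_smul, smul_add]
  simp [Pi.single_apply, ← Finset.smul_sum, ite_smul]

theorem dg_inj {i j : Fin (L+3)} {t t' ε ε' : Bool} (h : dg i t ε = dg j t' ε') : i = j ∧ t = t' ∧ ε = ε' := by
  have h1 := congrFun (congrArg Prod.fst h) i
  have h3 := congrArg Prod.snd h
  simp only [dg, Prod.smul_fst, Prod.smul_snd, Pi.smul_apply, Pi.single_apply, smul_eq_mul, if_true] at h1 h3
  have hs : ∀ b : Bool, sg b = 1 ∨ sg b = -1 := by intro b; cases b <;> simp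
  have hij : i = j := by
    by_contra hne
    rw [if_neg hne] at h1
    rcases hs ε with h | h <;> simp [h] at h1
  subst hij
  have hk := kk_ne i
  cases ε <;> cases ε' <;> simp at h1 <;> cases t <;> cases t' <;> simp at h3 ⊢ <;> omega

theorem mu_inj (q : Geo B a P k g α) {i j : Fin (L+3)} {t t' ε ε' : Bool} (h : mu α a i t ε = mu α a j t' ε') :
    i = j ∧ t = t' ∧ ε = ε' := by
  rw [← ev_dg, ← ev_dg] at h
  exact dg_inj (ev_inj q h)

theorem mu_neg (i : Fin (L+3)) (t ε : Bool) : - mu α a i t ε = mu α a i t (!ε) := by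
  cases ε <;> simp only [mu, sg_t, sg_f, Bool.not_true, Bool.not_false, neg_smul, one_smul, neg_neg]

theorem mu_ff (i : Fin (L+3)) : mu α a i false false = α i := by simp [mu]

theorem Geo.star (q : Geo B a P k g α) (i : Fin (L+3)) : starMap a k g (α i) = mu α a i true false := by
  simp [starMap, cMap, q.hg, q.hk, mu]

theorem Geo.bplus (q : Geo B a P k g α) (v : V) : v ∈ bplus a P k g ↔ ∃ i t, v = mu α a i t false := by
  simp only [_root_.bplus, ← q.rg, Set.mem_union, Set.mem_image, Set.mem_range, exists_exists_eq_and, q.star, Bool.exists_bool, mu_ff]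
  constructor
  · rintro (⟨i, rfl⟩ | ⟨i, rfl⟩)
    · exact ⟨i, Or.inl rfl⟩
    · exact ⟨i, Or.inr rfl⟩
  · rintro ⟨i, rfl | rfl⟩
    · exact Or.inl ⟨i, rfl⟩
    · exact Or.inr ⟨i, rfl⟩

theorem Geo.bfull (q : Geo B a P k g α) (v : V) : v ∈ bfull a P k g ↔ ∃ i t ε, v = mu α a i t ε := by
  rw [_root_.bfull, Set.mem_union, Set.mem_neg, q.bplus, q.bplus]
  constructor
  · rintro (⟨i, t, rfl⟩ | ⟨i, t, h⟩)
    · exact ⟨i, t, _, rfl⟩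
    · exact ⟨i, t, true, by rw [neg_eq_iff_eq_neg, mu_neg] at h; exact h⟩
  · rintro ⟨i, t, ε, rfl⟩
    cases ε
    · exact Or.inl ⟨i, t, rfl⟩
    · exact Or.inr ⟨i, t, by rw [mu_neg]; rfl⟩

theorem Geo.Bmu (q : Geo B a P k g α) (j i : Fin (L+3)) (t ε : Bool) : B (α j) (mu α a i t ε) = ((sg ε * gm j i : ℤ) : ℝ) := by
  rw [mu, map_zsmul, map_add, map_zsmul, q.ar, q.gram]; simp

theorem Geo.Bmm (q : Geo B a P k g α) (i j : Fin (L+3)) (t ε t' ε') :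
    B (mu α a i t ε) (mu α a j t' ε') = ((sg ε * sg ε' * gm i j : ℤ) : ℝ) := by
  rw [mu, map_zsmul, map_add, map_zsmul, LinearMap.smul_apply, LinearMap.add_apply, q.Bmu, LinearMap.smul_apply, q.al]
  simp [mul_assoc]

theorem Geo.xExp (q : Geo B a P k g α) (i j : Fin (L+3)) (t ε t' ε') :
    xExp B (mu α a i t ε) (mu α a j t' ε') = 1 + (-(cc i * (sg ε * sg ε' * gm i j))).toNat := by
  rw [_root_.xExp, q.Bmm, q.Bmm, ← Nat.ceil_intCast (R := ℝ)]
  congr 3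
  have hs : sg ε * sg ε = 1 := by cases ε <;> simp
  rw [hs, one_mul]
  have : (gm i i : ℝ) ≠ 0 := by
    rcases gmd i with ⟨h, -⟩ | ⟨h, -⟩ <;> rw [h] <;> norm_num
  have hc : (cc i : ℝ) * gm i i = 2 := by exact_mod_cast cc_gm i
  push_cast
  rw [← hc]
  field_simp

theorem Geo.vee (q : Geo B a P k g α) (i : Fin (L+3)) (t : Bool) :
    vee B (mu α a i t false) = (cc i : ℝ) • (α i + ((if t then kk i else 0 : ℤ) : ℝ) • a) := by
  rw [_root_.vee, q.Bmm]
  have hc : (cc i : ℝ) * gm i i = 2 := by exact_mod_cast cc_gm i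
  have : (gm i i : ℝ) ≠ 0 := by
    rcases gmd i with ⟨h, -⟩ | ⟨h, -⟩ <;> rw [h] <;> norm_num
  congr 1
  · rw [sg_f, one_mul, one_mul, ← hc]; field_simp
  · simp [mu, Int.cast_smul_eq_zsmul]

theorem Geo.edge (q : Geo B a P k g α) (i j : Fin (L+3)) : 2 * B (α i) (α j) = -(B (α j) (α j)) ↔ 2 * gm i j = - gm j j := by
  rw [q.gram, q.gram]; exact_mod_cast Iff.rfl

theorem Geo.kdiv (q : Geo B a P k g α) (i j : Fin (L+3)) : k (α j) / k (α i) = (kk j).toNat / (kk i).toNat := by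
  rw [← q.hk, ← q.hk]; simp

theorem ad_pow {G G' : Type*} [LieRing G] [LieAlgebra ℂ G] [LieRing G'] [LieAlgebra ℂ G'] (φ : G →ₗ⁅ℂ⁆ G') (x y : G) (n : ℕ) :
    φ ((LieAlgebra.ad ℂ G x ^ n) y) = (LieAlgebra.ad ℂ G' (φ x) ^ n) (φ y) := by
  induction n with
  | zero => simp
  | succ n ih => rw [pow_succ', pow_succ']; simp [ih]

end geo
end Ell

namespace Ell
set_option linter.unusedSectionVars false
set_option linter.unusedSimpArgs false
open TensorProduct

section alg
variable {L : ℕ} {V : Type*} [AddCommGroup V] [Module ℝ V] {B : LinearMap.BilinForm ℝ V} {a : V} {P : Set V}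
    {k : V → ℕ} {g : V → Bool} {α : Fin (L+3) → V}

/-- the quotient map as a Lie algebra morphism -/
def qm {F : Type*} [LieRing F] [LieAlgebra ℂ F] (I : LieIdeal ℂ F) : F →ₗ⁅ℂ⁆ (F ⧸ I) :=
  { (LieSubmodule.Quotient.mk' I : F →ₗ[ℂ] F ⧸ I) with
    map_lie' := fun {x y} => LieSubmodule.Quotient.mk_bracket _ x y }

theorem qm_apply {F : Type*} [LieRing F] [LieAlgebra ℂ F] (I : LieIdeal ℂ F) (x : F) :
    qm I x = LieSubmodule.Quotient.mk x := rfl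

theorem qm_surj {F : Type*} [LieRing F] [LieAlgebra ℂ F] (I : LieIdeal ℂ F) : Function.Surjective (qm I) :=
  LieSubmodule.Quotient.surjective_mk' I

theorem qm_zero {F : Type*} [LieRing F] [LieAlgebra ℂ F] {I : LieIdeal ℂ F} {x : F} (h : x ∈ I) : qm I x = 0 :=
  LieSubmodule.Quotient.mk_eq_zero'.2 h

/-- lifting to the quotient -/
theorem qlift {F G : Type*} [LieRing F] [LieAlgebra ℂ F] [LieRing G] [LieAlgebra ℂ G] (I : LieIdeal ℂ F) (φ : F →ₗ⁅ℂ⁆ G)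
    (h : ∀ x ∈ I, φ x = 0) : ∃ ψ : (F ⧸ I) →ₗ⁅ℂ⁆ G, ∀ x, ψ (qm I x) = φ x := by
  let ψ0 : (F ⧸ I) →ₗ[ℂ] G := Submodule.liftQ I.toSubmodule (φ : F →ₗ[ℂ] G) (fun x hx => h x hx)
  have h0 : ∀ x, ψ0 (qm I x) = φ x := fun x => Submodule.liftQ_apply _ _ _
  refine ⟨{ ψ0 with map_lie' := ?_ }, h0⟩
  intro x y
  obtain ⟨x, rfl⟩ := qm_surj I x
  obtain ⟨y, rfl⟩ := qm_surj I y
  change ψ0 _ = ⁅ψ0 _, ψ0 _⁆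
  rw [← LieHom.map_lie, h0, h0, h0, LieHom.map_lie]

variable (B a P k g) in
/-- the tuning-free ideal -/
noncomputable abbrev EI := ellIdeal B a P k g (fun _ _ => (1 : ℂ))

theorem rel0 {z} (hz : z ∈ ellRels B a P k g (fun _ _ => (1 : ℂ))) : qm (EI B a P k g) z = 0 :=
  qm_zero (LieSubmodule.subset_lieSpan hz)

variable (B a P k g) in
/-- h in the quotient -/
noncomputable def hq (σ : Vc V) : EllipticLieAlg B a P k g (fun _ _ => (1 : ℂ)) := qm (EI B a P k g) (hFree a P k g σ)
variable (B a P k g) in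
/-- e in the quotient -/
noncomputable def eq (v : V) : EllipticLieAlg B a P k g (fun _ _ => (1 : ℂ)) := qm (EI B a P k g) (eFree a P k g v)

theorem hq_lin (x y : ℂ) (σ τ : Vc V) : hq B a P k g (x • σ + y • τ) = x • hq B a P k g σ + y • hq B a P k g τ := by
  have := rel0 (B := B) (a := a) (P := P) (k := k) (g := g)
    (Or.inl (Or.inl (Or.inl (Or.inl (Or.inl (Or.inl (Or.inl (Or.inl ⟨x, y, σ, τ, rfl⟩))))))))
  rw [map_sub, map_add, map_smul, map_smul, sub_eq_zero] at this
  exact this.symm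

theorem hq_comm (σ τ : Vc V) : ⁅hq B a P k g σ, hq B a P k g τ⁆ = 0 := by
  have := rel0 (B := B) (a := a) (P := P) (k := k) (g := g)
    (Or.inl (Or.inl (Or.inl (Or.inl (Or.inl (Or.inl (Or.inl (Or.inr ⟨σ, τ, rfl⟩))))))))
  rw [LieHom.map_lie] at this
  exact this

theorem hq_eq (σ : Vc V) {v : V} (hv : v ∈ bfull a P k g) :
    ⁅hq B a P k g σ, eq B a P k g v⁆ = (LinearMap.BilinForm.baseChange ℂ B σ ((1 : ℂ) ⊗ₜ[ℝ] v)) • eq B a P k g v := by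
  have := rel0 (B := B) (a := a) (P := P) (k := k) (g := g)
    (Or.inl (Or.inl (Or.inl (Or.inl (Or.inl (Or.inl (Or.inr ⟨σ, v, hv, rfl⟩)))))))
  rw [map_sub, LieHom.map_lie, map_smul, sub_eq_zero] at this
  exact this

theorem eq_sr4 {v : V} (hv : v ∈ bplus a P k g) :
    ⁅eq B a P k g v, eq B a P k g (-v)⁆ = hq B a P k g ((1 : ℂ) ⊗ₜ[ℝ] vee B v) := by
  have := rel0 (B := B) (a := a) (P := P) (k := k) (g := g)
    (Or.inl (Or.inl (Or.inl (Or.inl (Or.inl (Or.inr ⟨v, hv, rfl⟩))))))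
  rw [map_sub, LieHom.map_lie, sub_eq_zero] at this
  exact this

theorem eq_sr5 {v w : V} (hv : v ∈ bfull a P k g) (hw : w ∈ bfull a P k g) (h1 : v ≠ w) (h2 : w ≠ -v) :
    (LieAlgebra.ad ℂ _ (eq B a P k g v) ^ xExp B v w) (eq B a P k g w) = 0 := by
  have := rel0 (B := B) (a := a) (P := P) (k := k) (g := g)
    (Or.inl (Or.inl (Or.inl (Or.inl (Or.inr ⟨v, hv, w, hw, h1, h2, rfl⟩)))))
  rw [ad_pow] at this
  exact this

/-- the generator family of the elliptic Lie algebra -/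
noncomputable def eE (B : LinearMap.BilinForm ℝ V) (a : V) (P : Set V) (k : V → ℕ) (g : V → Bool) (α : Fin (L+3) → V)
    (i : Fin (L+3)) (t ε : Bool) : EllipticLieAlg B a P k g (fun _ _ => (1 : ℂ)) := eq B a P k g (mu α a i t ε)

/-- Cartan elements -/
noncomputable def hE (B : LinearMap.BilinForm ℝ V) (a : V) (P : Set V) (k : V → ℕ) (g : V → Bool)
    (v : V) : EllipticLieAlg B a P k g (fun _ _ => (1 : ℂ)) := hq B a P k g ((1 : ℂ) ⊗ₜ[ℝ] v)

theorem Geo.mem (q : Geo B a P k g α) (i t ε) : mu α a i t ε ∈ _root_.bfull a P k g := (q.bfull _).2 ⟨i, t, ε, rfl⟩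
theorem Geo.memP (q : Geo B a P k g α) (i) : α i ∈ P := q.rg ▸ ⟨i, rfl⟩
theorem Geo.cm (q : Geo B a P k g α) (i) : cMap g (α i) = 1 := by simp [cMap, q.hg]

theorem Geo.rel6 (q : Geo B a P k g α) (i j) (hij : 2 * gm i j = - gm j j) :
    (LieAlgebra.ad ℂ _ (eE B a P k g α i true false) ^ ((kk j).toNat / (kk i).toNat)) (eE B a P k g α j false false) =
    (LieAlgebra.ad ℂ _ (eE B a P k g α i false false) ^ ((kk j).toNat / (kk i).toNat)) (eE B a P k g α j true false) := by
  have := rel0 (B := B) (a := a) (P := P) (k := k) (g := g)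
    (Or.inl (Or.inl (Or.inl (Or.inr ⟨α i, q.memP i, α j, q.memP j, (q.edge i j).2 hij, rfl⟩))))
  rw [map_sub, map_smul, map_smul, ad_pow, ad_pow, q.cm, q.kdiv, q.star, q.star, sub_eq_zero, one_mul, one_smul, Nat.cast_one, one_smul] at this
  simp only [eE, mu_ff]
  exact this

theorem Geo.rel7 (q : Geo B a P k g α) (i j) (hij : 2 * gm i j = - gm j j) :
    (LieAlgebra.ad ℂ _ (eE B a P k g α i true true) ^ ((kk j).toNat / (kk i).toNat)) (eE B a P k g α j false true) =
    (LieAlgebra.ad ℂ _ (eE B a P k g α i false true) ^ ((kk j).toNat / (kk i).toNat)) (eE B a P k g α j true true) := by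
  have := rel0 (B := B) (a := a) (P := P) (k := k) (g := g)
    (Or.inl (Or.inl (Or.inr ⟨α i, q.memP i, α j, q.memP j, (q.edge i j).2 hij, rfl⟩)))
  rw [map_sub, map_smul, map_smul, ad_pow, ad_pow, q.cm, q.kdiv, q.star, q.star, ← mu_ff (α := α) (a := a) i, ← mu_ff (α := α) (a := a) j,
    mu_neg, mu_neg, mu_neg, mu_neg, sub_eq_zero, one_mul, inv_one, one_smul,
    show ((-1 : ℂ) ^ (1 + 1) * ((1 : ℕ) : ℂ)) = 1 by norm_num, one_smul] at this
  exact this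

theorem Geo.rel8 (q : Geo B a P k g α) (i j) (hij : 2 * gm i j = - gm j j) (n : ℕ) (h1 : 1 ≤ n) (h2 : n ≤ (kk j).toNat / (kk i).toNat - 1) :
    (LieAlgebra.ad ℂ _ (eE B a P k g α i false false) ^ n) ((LieAlgebra.ad ℂ _ (eE B a P k g α i true false) ^ ((kk j).toNat / (kk i).toNat - n))
      (eE B a P k g α j false false)) = 0 := by
  have := rel0 (B := B) (a := a) (P := P) (k := k) (g := g)
    (Or.inl (Or.inr ⟨α i, q.memP i, α j, q.memP j, (q.edge i j).2 hij, n, h1, by rw [q.kdiv]; exact h2, rfl⟩))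
  rw [ad_pow, ad_pow, q.kdiv, q.star] at this
  simp only [eE, mu_ff]
  exact this

theorem Geo.rel9 (q : Geo B a P k g α) (i j) (hij : 2 * gm i j = - gm j j) (n : ℕ) (h1 : 1 ≤ n) (h2 : n ≤ (kk j).toNat / (kk i).toNat - 1) :
    (LieAlgebra.ad ℂ _ (eE B a P k g α i false true) ^ n) ((LieAlgebra.ad ℂ _ (eE B a P k g α i true true) ^ ((kk j).toNat / (kk i).toNat - n))
      (eE B a P k g α j false true)) = 0 := by
  have := rel0 (B := B) (a := a) (P := P) (k := k) (g := g)
    (Or.inr ⟨α i, q.memP i, α j, q.memP j, (q.edge i j).2 hij, n, h1, by rw [q.kdiv]; exact h2, rfl⟩)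
  rw [ad_pow, ad_pow, q.kdiv, q.star, ← mu_ff (α := α) (a := a) i, ← mu_ff (α := α) (a := a) j, mu_neg, mu_neg, mu_neg] at this
  exact this

theorem tm_smul (x : ℝ) (v : V) : (1 : ℂ) ⊗ₜ[ℝ] (x • v) = (x : ℂ) • ((1 : ℂ) ⊗ₜ[ℝ] v) := by
  rw [← TensorProduct.smul_tmul, TensorProduct.smul_tmul']
  congr 1

theorem hE_lin (x y : ℝ) (v w : V) : hE B a P k g (x • v + y • w) = (x : ℂ) • hE B a P k g v + (y : ℂ) • hE B a P k g w := by
  rw [hE, hE, hE, ← hq_lin]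
  congr 1
  rw [TensorProduct.tmul_add, tm_smul, tm_smul]

theorem Geo.prs (q : Geo B a P k g α) : Prs (eE B a P k g α) (fun i => hE B a P k g (α i)) (hE B a P k g a) where
  hh i j := hq_comm _ _
  hha i := hq_comm _ _
  he j i t ε := by
    rw [eE, hE, hq_eq _ (q.mem _ _ _), LinearMap.BilinForm.baseChange_tmul, q.Bmu]; simp
  hae i t ε := by
    rw [eE, hE, hq_eq _ (q.mem _ _ _), LinearMap.BilinForm.baseChange_tmul, q.al]; simp
  ef i t := by
    rw [eE, eE, show mu α a i t true = - mu α a i t false from (mu_neg i t false).symm, eq_sr4 ((q.bplus _).2 ⟨_, _, rfl⟩), q.vee]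
    change hE B a P k g _ = _
    rw [show (cc i : ℝ) • (α i + ((if t then kk i else 0 : ℤ) : ℝ) • a) = (cc i : ℝ) • α i + ((cc i : ℝ) * ((if t then kk i else 0 : ℤ) : ℝ)) • a by
      rw [smul_add, smul_smul], hE_lin]
    rw [Complex.ofReal_mul, Complex.ofReal_intCast, Complex.ofReal_intCast, smul_add, smul_smul]
  sr5 i j t t' ε ε' h := by
    have := eq_sr5 (B := B) (q.mem i t ε) (q.mem j t' ε') (fun h' => h ⟨(mu_inj q h').1, (mu_inj q h').2.1⟩)
      (fun h' => by rw [mu_neg] at h'; exact h ⟨(mu_inj q h').1.symm, (mu_inj q h').2.1.symm⟩)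
    rw [q.xExp] at this
    exact this
  sr6 i j ε h := by
    cases ε
    · exact q.rel6 i j h
    · exact q.rel7 i j h
  sr8 i j ε h n h1 h2 := by
    cases ε
    · exact q.rel8 i j h n h1 h2
    · exact q.rel9 i j h n h1 h2

/-- the real basis -/
noncomputable def Geo.bs (q : Geo B a P k g α) : Module.Basis (Fin (L+3) ⊕ Unit) ℝ V := Module.Basis.mk q.li q.top

theorem Geo.bs_apply (q : Geo B a P k g α) (x) : q.bs x = Sum.elim α (fun _ : Unit => a) x := Module.Basis.mk_apply _ _ _

theorem Geo.bsC (q : Geo B a P k g α) (x) : q.bs.baseChange ℂ x = (1 : ℂ) ⊗ₜ[ℝ] (Sum.elim α (fun _ : Unit => a) x) := by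
  rw [Module.Basis.baseChange_apply, q.bs_apply]

variable (B a P k g) in
/-- h in the quotient, linear -/
noncomputable def hql : Vc V →ₗ[ℂ] EllipticLieAlg B a P k g (fun _ _ => (1 : ℂ)) where
  toFun := hq B a P k g
  map_add' x y := by simpa using hq_lin (B := B) (a := a) (P := P) (k := k) (g := g) 1 1 x y
  map_smul' c x := by simpa using hq_lin (B := B) (a := a) (P := P) (k := k) (g := g) c 0 x 0

theorem Geo.gen (q : Geo B a P k g α) : Gen (eE B a P k g α) := by
  rw [Gen]
  set S := LieSubalgebra.lieSpan ℂ _ {x | ∃ i t ε, x = eE B a P k g α i t ε} with hS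
  have he : ∀ i t ε, eE B a P k g α i t ε ∈ S := fun i t ε => LieSubalgebra.subset_lieSpan ⟨i, t, ε, rfl⟩
  have hc : ∀ i : Fin (L+3), (cc i : ℂ) ≠ 0 := fun i => by exact_mod_cast (cc_pos i).ne'
  have hH : ∀ i, hE B a P k g (α i) ∈ S := by
    intro i
    have h1 := S.lie_mem (he i false false) (he i false true)
    rw [q.prs.ef] at h1
    have := S.smul_mem (cc i : ℂ)⁻¹ h1
    rw [smul_smul, inv_mul_cancel₀ (hc i), one_smul] at this
    simpa using this
  have hA : hE B a P k g a ∈ S := by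
    have h1 := S.lie_mem (he 0 true false) (he 0 true true)
    rw [q.prs.ef] at h1
    have := S.smul_mem (cc (0 : Fin (L+3)) : ℂ)⁻¹ h1
    rw [smul_smul, inv_mul_cancel₀ (hc _), one_smul] at this
    have := S.smul_mem (2 : ℂ)⁻¹ (S.sub_mem this (hH 0))
    simpa [smul_smul] using this
  have hS' : ∀ σ, hq B a P k g σ ∈ S := by
    intro σ
    have h1 : (⊤ : Submodule ℂ (Vc V)) ≤ S.toSubmodule.comap (hql B a P k g) := by
      rw [← (q.bs.baseChange ℂ).span_eq, Submodule.span_le]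
      rintro _ ⟨x, rfl⟩
      rw [q.bsC]
      cases x with
      | inl i => exact hH i
      | inr i => exact hA
    exact h1 (Submodule.mem_top (x := σ))
  have hof : ∀ x, qm (EI B a P k g) (FreeLieAlgebra.of ℂ x) ∈ S := by
    rintro (σ | ⟨v, hv⟩)
    · exact hS' σ
    · obtain ⟨i, t, ε, rfl⟩ := (q.bfull v).1 hv
      have := he i t ε
      rw [eE, eq, eFree, dif_pos hv] at this
      exact this
  let φ : FreeLieAlgebra ℂ (EllGen a P k g) →ₗ⁅ℂ⁆ S := FreeLieAlgebra.lift ℂ (fun x => ⟨_, hof x⟩)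
  have hφ : S.incl.comp φ = qm (EI B a P k g) := by
    apply FreeLieAlgebra.hom_ext
    intro x
    simp only [LieHom.comp_apply, φ, FreeLieAlgebra.lift_of_apply]
    rfl
  rw [eq_top_iff]
  intro x _
  obtain ⟨y, rfl⟩ := qm_surj _ x
  rw [← hφ]
  exact (φ y).2

end alg
end Ell

namespace Ell
set_option linter.unusedSectionVars false
set_option linter.unusedSimpArgs false
open TensorProduct

section hom
variable {L : ℕ} {V : Type*} [AddCommGroup V] [Module ℝ V] {B : LinearMap.BilinForm ℝ V} {a : V} {P : Set V}
    {k : V → ℕ} {g : V → Bool} {α : Fin (L+3) → V}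
    {G : Type*} [LieRing G] [LieAlgebra ℂ G] {e : Fin (L+3) → Bool → Bool → G} {h : Fin (L+3) → G} {ha : G}

theorem Geo.vcInd (q : Geo B a P k g α) {p : Vc V → Prop} (h1 : ∀ i, p ((1 : ℂ) ⊗ₜ[ℝ] α i)) (h2 : p ((1 : ℂ) ⊗ₜ[ℝ] a))
    (h3 : ∀ x y, p x → p y → p (x + y)) (h4 : ∀ (c : ℂ) x, p x → p (c • x)) (σ : Vc V) : p σ := by
  have hσ : σ ∈ Submodule.span ℂ (Set.range (q.bs.baseChange ℂ)) := by
    rw [Module.Basis.span_eq]; trivial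
  induction hσ using Submodule.span_induction with
  | mem x hx =>
    obtain ⟨x, rfl⟩ := hx
    rw [q.bsC]
    cases x with
    | inl i => exact h1 i
    | inr i => exact h2
  | zero => simpa using h4 0 _ h2
  | add x y _ _ hx hy => exact h3 _ _ hx hy
  | smul c x _ hx => exact h4 c x hx

/-- Cartan part of the morphism -/
noncomputable def Geo.H (q : Geo B a P k g α) (h : Fin (L+3) → G) (ha : G) : Vc V →ₗ[ℂ] G :=
  (q.bs.baseChange ℂ).constr ℂ (Sum.elim h (fun _ => ha))

theorem Geo.H_al (q : Geo B a P k g α) (i) : q.H h ha ((1 : ℂ) ⊗ₜ[ℝ] α i) = h i := by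
  have := (q.bs.baseChange ℂ).constr_basis ℂ (Sum.elim h (fun _ => ha)) (Sum.inl i)
  rwa [q.bsC] at this
theorem Geo.H_a (q : Geo B a P k g α) : q.H h ha ((1 : ℂ) ⊗ₜ[ℝ] a) = ha := by
  have := (q.bs.baseChange ℂ).constr_basis ℂ (Sum.elim h (fun _ => ha)) (Sum.inr ())
  rwa [q.bsC] at this

theorem Geo.H_comm (q : Geo B a P k g α) (p : Prs e h ha) (σ τ) : ⁅q.H h ha σ, q.H h ha τ⁆ = 0 := by
  have key : ∀ y : G, (∀ i, ⁅h i, y⁆ = 0) → ⁅ha, y⁆ = 0 → ∀ σ, ⁅q.H h ha σ, y⁆ = 0 := by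
    intro y h1 h2 σ
    induction σ using q.vcInd with
    | h1 i => rw [q.H_al, h1]
    | h2 => rw [q.H_a, h2]
    | h3 x y hx hy => rw [map_add, add_lie, hx, hy, add_zero]
    | h4 c x hx => rw [map_smul, smul_lie, hx, smul_zero]
  refine key _ (fun i => sk0 (key _ (fun j => p.hh j i) (sk0 (p.hha i)) τ)) (sk0 (key _ p.hha (lie_self _) τ)) σ

theorem Geo.H_e (q : Geo B a P k g α) (p : Prs e h ha) (σ) (i t ε) :
    ⁅q.H h ha σ, e i t ε⁆ = (LinearMap.BilinForm.baseChange ℂ B σ ((1 : ℂ) ⊗ₜ[ℝ] mu α a i t ε)) • e i t ε := by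
  induction σ using q.vcInd with
  | h1 j => rw [q.H_al, p.he, LinearMap.BilinForm.baseChange_tmul, q.Bmu]; simp
  | h2 => rw [q.H_a, p.hae, LinearMap.BilinForm.baseChange_tmul, q.al]; simp
  | h3 x y hx hy => rw [map_add, add_lie, hx, hy, map_add, LinearMap.add_apply, add_smul]
  | h4 c x hx => rw [map_smul, smul_lie, hx, map_smul, LinearMap.smul_apply, smul_smul, smul_eq_mul]

theorem Geo.exE (q : Geo B a P k g α) (e : Fin (L+3) → Bool → Bool → G) : ∃ E : V → G, ∀ i t ε, E (mu α a i t ε) = e i t ε := by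
  have hinj : Function.Injective (fun x : Fin (L+3) × Bool × Bool => mu α a x.1 x.2.1 x.2.2) := by
    rintro ⟨i, t, ε⟩ ⟨j, t', ε'⟩ hx
    obtain ⟨rfl, rfl, rfl⟩ := mu_inj q hx
    rfl
  exact ⟨Function.extend _ (fun x : Fin (L+3) × Bool × Bool => e x.1 x.2.1 x.2.2) 0, fun i t ε => hinj.extend_apply _ _ (i, t, ε)⟩

theorem Geo.hom (q : Geo B a P k g α) (p : Prs e h ha) :
    ∃ Φ : EllipticLieAlg B a P k g (fun _ _ => (1 : ℂ)) →ₗ⁅ℂ⁆ G, ∀ i t ε, Φ (eE B a P k g α i t ε) = e i t ε := by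
  obtain ⟨E, hE⟩ := q.exE e
  let φ : FreeLieAlgebra ℂ (EllGen a P k g) →ₗ⁅ℂ⁆ G := FreeLieAlgebra.lift ℂ (Sum.elim (q.H h ha) (fun v => E v.1))
  have hh : ∀ σ, φ (hFree a P k g σ) = q.H h ha σ := fun σ => FreeLieAlgebra.lift_of_apply _ _
  have he : ∀ i t ε, φ (eFree a P k g (mu α a i t ε)) = e i t ε := by
    intro i t ε
    rw [eFree, dif_pos (q.mem i t ε), ← hE]
    exact FreeLieAlgebra.lift_of_apply _ _
  have he' : ∀ i, φ (eFree a P k g (α i)) = e i false false := fun i => by rw [← he, mu_ff]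
  have hn : ∀ i, φ (eFree a P k g (-α i)) = e i false true := fun i => by
    rw [← he, ← mu_ff (α := α) (a := a) i, mu_neg]; rfl
  have hr : ∀ z ∈ ellRels B a P k g (fun _ _ => (1 : ℂ)), φ z = 0 := by
    rintro z ((((((((⟨x, y, σ, τ, rfl⟩ | ⟨σ, τ, rfl⟩) | ⟨σ, v, hv, rfl⟩) | ⟨v, hv, rfl⟩) | ⟨v, hv, w, hw, h1, h2, rfl⟩) |
      ⟨v, hv, w, hw, h1, rfl⟩) | ⟨v, hv, w, hw, h1, rfl⟩) | ⟨v, hv, w, hw, h1, n, h2, h3, rfl⟩) | ⟨v, hv, w, hw, h1, n, h2, h3, rfl⟩)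
    · rw [map_sub, map_add, map_smul, map_smul, hh, hh, hh, map_add, map_smul, map_smul, sub_self]
    · rw [LieHom.map_lie, hh, hh, q.H_comm p]
    · obtain ⟨i, t, ε, rfl⟩ := (q.bfull v).1 hv
      rw [map_sub, LieHom.map_lie, map_smul, hh, he, q.H_e p, sub_self]
    · obtain ⟨i, t, rfl⟩ := (q.bplus v).1 hv
      rw [mu_neg, map_sub, LieHom.map_lie, hh, he, he, Bool.not_false, p.ef, q.vee, tm_smul, TensorProduct.tmul_add, tm_smul,
        map_smul, map_add, map_smul, q.H_al, q.H_a, Complex.ofReal_intCast, Complex.ofReal_intCast, sub_self]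
    · obtain ⟨i, t, ε, rfl⟩ := (q.bfull v).1 hv
      obtain ⟨j, t', ε', rfl⟩ := (q.bfull w).1 hw
      rw [ad_pow, he, he, q.xExp, p.sr5]
      rintro ⟨rfl, rfl⟩
      rw [mu_neg] at h2
      by_cases hε : ε = ε'
      · subst hε; exact h1 rfl
      · apply h2
        congr 1
        cases ε <;> cases ε' <;> simp_all
    all_goals
      obtain ⟨i, rfl⟩ : ∃ i, α i = v := by rw [← q.rg] at hv; exact hv
      obtain ⟨j, rfl⟩ : ∃ j, α j = w := by rw [← q.rg] at hw; exact hw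
      rw [q.edge] at h1
    · rw [map_sub, map_smul, map_smul, ad_pow, ad_pow, q.cm, q.kdiv, q.star, q.star, he', he', he, he, p.sr6 i j false h1]
      simp
    · rw [map_sub, map_smul, map_smul, ad_pow, ad_pow, q.cm, q.kdiv, q.star, q.star, mu_neg, mu_neg, hn, hn, he, he, Bool.not_false,
        p.sr6 i j true h1]
      simp
    · rw [q.kdiv] at h3
      rw [ad_pow, ad_pow, q.kdiv, q.star, he', he', he, p.sr8 i j false h1 n h2 h3]
    · rw [q.kdiv] at h3
      rw [ad_pow, ad_pow, q.kdiv, q.star, mu_neg, hn, hn, he, Bool.not_false, p.sr8 i j true h1 n h2 h3]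
  have hI : ∀ z ∈ EI B a P k g, φ z = 0 := by
    intro z hz
    have : EI B a P k g ≤ φ.ker := LieSubmodule.lieSpan_le.2 fun z hz => (LieHom.mem_ker).2 (hr z hz)
    exact LieHom.mem_ker.1 (this hz)
  obtain ⟨Φ, hΦ⟩ := qlift _ φ hI
  exact ⟨Φ, fun i t ε => by rw [eE, eq, hΦ, he]⟩

theorem Geo.dims (q : Geo B a P k g α) {R : Set V} {gr : V → Submodule ℂ (EllipticLieAlg B a P k g (fun _ _ => (1 : ℂ)))}
    (hgr : IsEllGrading B R a P k g (fun _ _ => (1 : ℂ)) gr) (m r : ℤ) :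
    (¬ (Even m ∧ Even r) → Module.finrank ℂ (gr (m • (∑ i, α i) + r • a)) = 1) ∧
    ((Even m ∧ Even r) → ¬ (m = 0 ∧ r = 0) → Module.finrank ℂ (gr (m • (∑ i, α i) + r • a)) = L + 3) := by
  classical
  obtain ⟨h1, h2, -, h4, h5⟩ := hgr
  have := q.prs.dims q.gen (gr := fun d => gr (ev α a d)) (h1.submodule_iSupIndep.comp (ev_inj q)) ?_ ?_ ?_ (fun s => q.hom (eM_prs s)) m r
  · have hev : ev α a (fun _ => m, r) = m • (∑ i, α i) + r • a := by
      simp [ev, Finset.smul_sum]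
    rw [← hev]; exact this
  · intro d d' x hx y hy
    simp only [ev_add]
    exact h2 _ _ x hx y hy
  · intro i t ε
    simp only [ev_dg]
    exact h5 _ (q.mem i t ε)
  · simp only [ev_zero]
    exact h4 _

end hom
end Ell

namespace Ell
set_option linter.unusedSectionVars false
set_option linter.unusedSimpArgs false

theorem pair_eq {x y u v : ℕ} (h : ({x, y} : Finset ℕ) = {u, v}) : (x = u ∧ y = v) ∨ (x = v ∧ y = u) := by
  have h1 : ((({x, y} : Finset ℕ)) : Set ℕ) = (({u, v} : Finset ℕ) : Set ℕ) := by rw [h]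
  rw [Finset.coe_pair, Finset.coe_pair, Set.pair_eq_pair_iff] at h1
  exact h1

section fin
variable {L : ℕ} {V : Type*} [AddCommGroup V] [Module ℝ V] {B : LinearMap.BilinForm ℝ V} {a : V} {P : Set V}
    {k : V → ℕ} {g : V → Bool} {α : Fin (L+3) → V} {R : Set V}

theorem gram_of (hs : ∀ u v, B u v = B v u) (hD : IsTypeDTwo B P (L+2) α) (i j : Fin (L+3)) : B (α i) (α j) = (gm i j : ℝ) := by
  obtain ⟨-, -, h00, h11, hjj, h12, hadj, hl0, hz⟩ := hD
  have hz' : ∀ i j : Fin (L+3), i ≠ j → ¬ (((i : ℕ) = 1 ∧ (j : ℕ) = 2) ∨ ((i : ℕ) = 2 ∧ (j : ℕ) = 1)) →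
      ¬ (2 ≤ (i : ℕ) ∧ (i : ℕ) + 1 = j) → ¬ (2 ≤ (j : ℕ) ∧ (j : ℕ) + 1 = i) →
      ¬ (((i : ℕ) = L + 2 ∧ (j : ℕ) = 0) ∨ ((i : ℕ) = 0 ∧ (j : ℕ) = L + 2)) → B (α i) (α j) = 0 := by
    intro i j hij a1 a2 a3 a4
    refine hz i j hij ?_
    rintro (h | ⟨m, hm, hm', h⟩ | h)
    · exact a1 (pair_eq h)
    · rcases pair_eq h with h | h
      · exact a2 (by omega)
      · exact a3 (by omega)
    · exact a4 (pair_eq h)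
  have hz'' : ∀ (i j : Fin (L+3)) (x y : ℕ), i.val = x → j.val = y → x ≠ y → ¬ ((x = 1 ∧ y = 2) ∨ (x = 2 ∧ y = 1)) →
      ¬ (2 ≤ x ∧ x + 1 = y) → ¬ (2 ≤ y ∧ y + 1 = x) →
      ¬ ((x = L + 2 ∧ y = 0) ∨ (x = 0 ∧ y = L + 2)) → B (α i) (α j) = 0 := by
    rintro i j _ _ rfl rfl h1 h2 h3 h4 h5
    exact hz' i j (fun h => h1 (congrArg Fin.val h)) h2 h3 h4 h5
  have c02 : ∀ q : Fin (L+1), B (α 0) (α q.succ.succ) = (gm (L := L) 0 q.succ.succ : ℝ) := by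
    intro q
    rw [gm02]
    split_ifs with hq
    · subst hq
      rw [hs]; simpa using hl0
    · rw [Int.cast_zero]
      have hqL : q.val ≠ L := fun h => hq (Fin.ext h)
      exact hz'' _ _ 0 (q.val + 2) rfl rfl (by omega) (by omega) (by omega) (by omega) (by omega)
  have c12 : ∀ q : Fin (L+1), B (α 1) (α q.succ.succ) = (gm (L := L) 1 q.succ.succ : ℝ) := by
    intro q
    rw [gm12]
    split_ifs with hq
    · subst hq
      simpa using h12
    · rw [Int.cast_zero]
      have hqL : q.val ≠ 0 := fun h => hq (Fin.ext h)
      exact hz'' _ _ 1 (q.val + 2) rfl rfl (by omega) (by omega) (by omega) (by omega) (by omega)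
  have c01 : B (α 0) (α 1) = 0 := by
    apply hz' <;> simp [Fin.ext_iff]
  induction i using fc3 with
  | h0 =>
    induction j using fc3 with
    | h0 => simpa using h00
    | h1 => simpa using c01
    | h2 q => exact c02 q
  | h1 =>
    induction j using fc3 with
    | h0 => rw [hs]; simpa using c01
    | h1 => simpa using h11
    | h2 q => exact c12 q
  | h2 p =>
    induction j using fc3 with
    | h0 => rw [hs, gm_symm]; exact c02 p
    | h1 => rw [hs, gm_symm]; exact c12 p
    | h2 q =>
      rw [gm2]
      split_ifs with h1 h2
      · subst h1
        rw [hjj _ (by simp)]; norm_num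
      · rcases h2 with h2 | h2
        · have := hadj (p.val + 2) (by omega) (by omega)
          rw [show (⟨p.val + 2 + 1, by omega⟩ : Fin (L+2+1)) = q.succ.succ from Fin.ext (by simp; omega),
            show (⟨p.val + 2, by omega⟩ : Fin (L+2+1)) = p.succ.succ from rfl] at this
          simpa using this
        · have := hadj (q.val + 2) (by omega) (by omega)
          rw [show (⟨q.val + 2 + 1, by omega⟩ : Fin (L+2+1)) = p.succ.succ from Fin.ext (by simp; omega),
            show (⟨q.val + 2, by omega⟩ : Fin (L+2+1)) = q.succ.succ from rfl] at this
          rw [hs]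
          simpa using this
      · rw [Int.cast_zero]
        have hpq : p.val ≠ q.val := fun h => h1 (Fin.ext h)
        exact hz'' _ _ (p.val + 2) (q.val + 2) rfl rfl (by omega) (by omega) (by omega) (by omega) (by omega)

theorem geo_of (hE : IsEARS B R (L+2) 2) (hfs : IsFundamentalSet B R (L+2) P a) (hD : IsTypeDTwo B P (L+2) α)
    (hk0 : k (α 0) = 2) (hk1 : k (α 1) = 1) (hkj : ∀ j : Fin (L+3), 2 ≤ (j : ℕ) → k (α j) = 2)
    (hg : ∀ i : Fin (L+3), g (α i) = false) : Geo B a P k g α := by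
  obtain ⟨-, ha0, ⟨b, -, -, -, hab⟩, -, hPf, hPc, -, -, hc, hli, -⟩ := hfs
  have hBa : B a = 0 := by
    have : a ∈ (LinearMap.ker B : Set V) := by rw [← hE.null_eq]; exact ha0
    exact this
  have al : ∀ v, B a v = 0 := fun v => by rw [hBa]; rfl
  have ha : a ≠ 0 := by
    rintro rfl
    simpa using hab 1 0 (by simp)
  have hinj : Set.InjOn (Submodule.span ℝ {a}).mkQ P := by
    rw [← Set.ncard_image_iff hPf, hc, hPc]
  have hαP : ∀ i, α i ∈ P := fun i => hD.2.1 ▸ ⟨i, rfl⟩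
  have hq : LinearIndependent ℝ (fun i => (Submodule.span ℝ {a}).mkQ (α i)) := by
    refine hli.comp (fun i => (⟨_, α i, hαP i, rfl⟩ : ↥((Submodule.span ℝ {a}).mkQ '' P))) ?_
    intro i j hij
    exact hD.1 (hinj (hαP i) (hαP j) (congrArg Subtype.val hij))
  have li : LinearIndependent ℝ (Sum.elim α (fun _ : Unit => a)) := by
    rw [Fintype.linearIndependent_iff]
    intro c hc
    simp only [Fintype.sum_sum_type, Sum.elim_inl, Sum.elim_inr, Finset.univ_unique, Finset.sum_singleton] at hc
    have h1 := congrArg (Submodule.span ℝ {a}).mkQ hc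
    have h0 : (Submodule.span ℝ {a}).mkQ a = 0 := by simp
    rw [map_add, map_smul, h0, smul_zero, add_zero, map_sum, map_zero] at h1
    simp only [map_smul] at h1
    have h2 := Fintype.linearIndependent_iff.1 hq (fun i => c (Sum.inl i)) h1
    rintro (i | ⟨⟩)
    · exact h2 i
    · simp only [h2, zero_smul, Finset.sum_const_zero, zero_add] at hc
      exact (smul_eq_zero.1 hc).resolve_right ha
  refine ⟨li, ?_, hD.2.1, gram_of hE.symm hD, al, fun v => by rw [hE.symm, al], ?_, hg⟩
  · have := hE.findim
    rw [li.span_eq_top_of_card_eq_finrank' (by rw [hE.dim_eq]; simp)]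
  · intro i
    induction i using fc3 with
    | h0 => rw [hk0]; rfl
    | h1 => rw [hk1]; rfl
    | h2 q => rw [hkj _ (by simp)]; rfl

theorem Geo.delta (q : Geo B a P k g α) (hinj : Function.Injective α) {δ : V} (hδ : IsDelta B P δ) : δ = ∑ i, α i := by
  obtain ⟨⟨s, hs, c, hc, hδ⟩, hcl⟩ := hδ
  have hsα : s = Finset.univ.map ⟨α, hinj⟩ := by
    apply Finset.coe_injective
    rw [hs, ← q.rg]; simp
  have hδ' : δ = ev α a (fun i => (c (α i) : ℤ), 0) := by
    rw [hδ, hsα]; simp [ev]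
  have hmem : ∑ i, α i ∈ (AddSubgroup.closure {δ} : Set V) := by
    rw [hcl]
    refine ⟨sum_mem fun i _ => AddSubgroup.subset_closure (q.rg ▸ ⟨i, rfl⟩), ?_⟩
    change B _ _ = 0
    rw [map_sum]
    refine Finset.sum_eq_zero fun i _ => ?_
    rw [map_sum, LinearMap.sum_apply]
    simp only [q.gram, gm_symm _ i]
    rw [← Int.cast_sum]
    have h1 : ∑ j, gm i j = ba i (fun _ => 1) := by
      rw [show (fun _ => 1 : Fin (L+3) → ℤ) = ∑ j, Pi.single j 1 from (Finset.univ_sum_single _).symm, map_sum]; rfl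
    rw [h1, ba_apply]
    simp [bb_apply]
  rw [SetLike.mem_coe, AddSubgroup.mem_closure_singleton] at hmem
  obtain ⟨n, hn⟩ := hmem
  have h1 : ev α a (fun i => n * (c (α i) : ℤ), 0) = ev α a (fun _ => 1, 0) := by
    have : ev α a (fun _ => 1, 0) = ∑ i, α i := by simp [ev]
    rw [this, ← hn, hδ']; simp [ev, Finset.smul_sum, mul_smul]
  have h2 := congrFun (congrArg Prod.fst (ev_inj q h1)) 0
  have h3 : 0 < c (α 0) := hc _ (by rw [hsα]; simp)
  simp only at h2
  have hn1 : n = 1 := by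
    rcases Int.eq_one_or_neg_one_of_mul_eq_one h2 with h | h
    · exact h
    · subst h; omega
  rw [← hn, hn1, one_smul]

end fin
end Ell

theorem stmt19 {V : Type*} [AddCommGroup V] [Module ℝ V]
    (B : LinearMap.BilinForm ℝ V) (R : Set V) (l : ℕ) (hl : 2 ≤ l)
    (hE : IsEARS B R l 2) (hred : IsReducedRS R)
    (P : Set V) (a : V) (hfs : IsFundamentalSet B R l P a)
    (k : V → ℕ) (g : V → Bool) (hkg : IsKG R a P k g)
    (αf : Fin (l + 1) → V) (hD : IsTypeDTwo B P l αf)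
    (hk0 : k (αf 0) = 2) (hk1 : k (αf 1) = 1)
    (hkj : ∀ j : Fin (l + 1), 2 ≤ (j : ℕ) → k (αf j) = 2)
    (hg : ∀ i : Fin (l + 1), g (αf i) = false)
    (δ : V) (hδ : IsDelta B P δ)
    (gr : V → Submodule ℂ (EllipticLieAlg B a P k g (fun _ _ => (1 : ℂ))))
    (hgr : IsEllGrading B R a P k g (fun _ _ => (1 : ℂ)) gr) :
    ∀ σ : V,
      ((∃ m r : ℤ, σ = (2 * m) • δ + (2 * r) • a) → σ ≠ 0 →
        Module.finrank ℂ (gr σ) = l + 1) ∧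
      ((∃ m r : ℤ, σ = m • δ + r • a) → ¬(∃ m r : ℤ, σ = (2 * m) • δ + (2 * r) • a) →
        Module.finrank ℂ (gr σ) = 1) := by
  obtain ⟨L, rfl⟩ : ∃ L, l = L + 2 := ⟨l - 2, by omega⟩
  have q : Ell.Geo (L := L) B a P k g αf := Ell.geo_of hE hfs hD hk0 hk1 hkj hg
  have hd := q.delta hD.1 hδ
  intro σ
  constructor
  · rintro ⟨m, r, rfl⟩ h0
    rw [hd]
    refine (q.dims hgr (2 * m) (2 * r)).2 ⟨even_two_mul m, even_two_mul r⟩ ?_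
    rintro ⟨h1, h2⟩
    apply h0
    rw [h1, h2]; simp
  · rintro ⟨m, r, rfl⟩ h0
    have h1 : ¬ (Even m ∧ Even r) := by
      rintro ⟨hm, hr⟩
      obtain ⟨m', rfl⟩ := hm.exists_two_nsmul
      obtain ⟨r', rfl⟩ := hr.exists_two_nsmul
      exact h0 ⟨m', r', by simp [mul_smul]⟩
    rw [hd]
    exact (q.dims hgr m r).1 h1
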